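/- Let h ≥ 2 be an integer and let N_h(x) denote the set of h-full ideals of O_K with norm at most x. Then |N_h(x)| = κ γ_h x^{1/h} + O_h(R_{N_h}(x)), where the implied constant depends only on h and K, γ_h = ∏_p (1 + (N(p) − N(p)^{1/h}) / (N(p)²(N(p)^{1/h} − 1))) (product over all prime ideals p, and this product converges), and R_{N_h}(x) = x^{(1/h)(1 − 2/(n_K+1))} if h/(h+1) < 1 − 2/(n_K+1); R_{N_h}(x) = x^{1/(h+1)} log x if h/(h+1) = 1 − 2/(n_K+1); R_{N_h}(x) = x^{1/(h+1)} if h/(h+1) > 1 − 2/(n_K+1). -/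

import Mathlib

open Filter Topology
open scoped BigOperators

noncomputable section

variable (K : Type) [Field K] [NumberField K]

/-- `m` is an `h`-full ideal: every prime ideal dividing `m` divides it to order at least `h`. -/
def IsHFull (h : ℕ) (m : Ideal (NumberField.RingOfIntegers K)) : Prop :=
  m ≠ 0 ∧ ∀ p : Ideal (NumberField.RingOfIntegers K), p.IsPrime → p ∣ m → p ^ h ∣ m

/-- The residue `κ` of the Dedekind zeta function of `K` at `s = 1`. -/
def kappa : ℝ :=
  (2 ^ NumberField.InfinitePlace.nrRealPlaces K *
      (2 * Real.pi) ^ NumberField.InfinitePlace.nrComplexPlaces K *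
      (NumberField.classNumber K) * NumberField.Units.regulator K) /
    ((NumberField.Units.torsionOrder K) * Real.sqrt |(NumberField.discr K : ℝ)|)

/-- The Euler factor of `γ_h` at a prime ideal `p`. -/
def gammaHFactor (h : ℕ) (p : Ideal (NumberField.RingOfIntegers K)) : ℝ :=
  1 + ((Ideal.absNorm p : ℝ) - (Ideal.absNorm p : ℝ) ^ ((1 : ℝ)/h)) /
    ((Ideal.absNorm p : ℝ) ^ 2 * ((Ideal.absNorm p : ℝ) ^ ((1 : ℝ)/h) - 1))

/-- The constant `γ_h`, an infinite product over the (nonzero) prime ideals of `O_K`. -/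
def gammaH (h : ℕ) : ℝ :=
  ∏' p : {p : Ideal (NumberField.RingOfIntegers K) // p.IsPrime ∧ p ≠ ⊥},
    gammaHFactor K h p.1

/-- The error term `R_{N_h}` for the distribution of `h`-full ideals. -/
def RNh (h : ℕ) (x : ℝ) : ℝ :=
  if (h : ℝ)/(h + 1) < 1 - 2/((Module.finrank ℚ K : ℝ) + 1) then
    x ^ (((1 : ℝ)/h) * (1 - 2/((Module.finrank ℚ K : ℝ) + 1)))
  else if (h : ℝ)/(h + 1) = 1 - 2/((Module.finrank ℚ K : ℝ) + 1) then
    x ^ ((1 : ℝ)/(h + 1)) * Real.log x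
  else x ^ ((1 : ℝ)/(h + 1))


open Filter Topology MeasureTheory
open scoped BigOperators ContDiff

namespace HFull

/-- Derivative bounds for a quotient `a / τ`. -/
theorem quot_bound (N : ℕ) (C0 : ℝ) (hC0 : 0 ≤ C0) : ∃ C : ℝ, 0 ≤ C ∧
    ∀ (a τ : ℝ → ℂ) (A L R : ℝ), 0 < L → ContDiff ℝ ∞ a → ContDiff ℝ ∞ τ →
      (∀ s, R < |s| → a s = 0) → (∀ s, |s| ≤ R → L ≤ ‖τ s‖) →
      (∀ j ≤ N, ∀ s, |s| ≤ R → ‖iteratedDeriv j τ s‖ ≤ C0 * L) →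
      (∀ j ≤ N, ∀ s, ‖iteratedDeriv j a s‖ ≤ A) →
      ContDiff ℝ ∞ (fun s => a s / τ s) ∧
      ∀ j ≤ N, ∀ s, ‖iteratedDeriv j (fun s => a s / τ s) s‖ ≤ C * A / L := by
  have key : ∀ M : ℕ, ∃ C : ℝ, 0 ≤ C ∧
    ∀ (a τ b : ℝ → ℂ) (A L s : ℝ), 0 < L → 0 ≤ A → ContDiff ℝ ∞ b → ContDiff ℝ ∞ τ →
      a =ᶠ[𝓝 s] (fun s => b s * τ s) → L ≤ ‖τ s‖ →
      (∀ j ≤ M, ‖iteratedDeriv j τ s‖ ≤ C0 * L) →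
      (∀ j ≤ M, ‖iteratedDeriv j a s‖ ≤ A) →
      ∀ j ≤ M, ‖iteratedDeriv j b s‖ ≤ C * A / L := by
    intro M
    induction M with
    | zero =>
      refine ⟨1, zero_le_one, ?_⟩
      intro a τ b A L s hL hA hb hτ hab hLτ h1 h2 j hj
      obtain rfl : j = 0 := by omega
      have h3 := h2 0 le_rfl
      simp only [iteratedDeriv_zero] at h3 ⊢
      rw [hab.eq_of_nhds, norm_mul] at h3
      rw [le_div_iff₀ hL]
      nlinarith [norm_nonneg (b s)]
    | succ M ih =>
      obtain ⟨C, hC, ih⟩ := ih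
      refine ⟨max C (1 + ∑ i ∈ Finset.range (M+1), ((M+1).choose i : ℝ) * C * C0), le_max_of_le_left hC, ?_⟩
      intro a τ b A L s hL hA hb hτ hab hLτ h1 h2 j hj
      have ihj := ih a τ b A L s hL hA hb hτ hab hLτ (fun j hj => h1 j (by omega)) (fun j hj => h2 j (by omega))
      rcases Nat.lt_or_ge j (M+1) with hlt | hge
      · refine (ihj j (by omega)).trans ?_
        gcongr
        exact le_max_left _ _
      obtain rfl : j = M+1 := by omega
      have h3 : iteratedDeriv (M+1) a s = ∑ i ∈ Finset.range (M+2), ((M+1).choose i : ℂ) * iteratedDeriv i b s * iteratedDeriv (M+1-i) τ s := by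
        rw [hab.iteratedDeriv_eq]
        exact iteratedDeriv_mul (hb.contDiffAt.of_le (by exact_mod_cast le_top)) (hτ.contDiffAt.of_le (by exact_mod_cast le_top))
      rw [Finset.sum_range_succ] at h3
      simp only [Nat.choose_self, Nat.cast_one, one_mul, Nat.sub_self, iteratedDeriv_zero] at h3
      have h4 : ‖iteratedDeriv (M+1) b s * τ s‖ ≤ A + ∑ i ∈ Finset.range (M+1), ((M+1).choose i : ℝ) * (C * A / L) * (C0 * L) := by
        have : iteratedDeriv (M+1) b s * τ s = iteratedDeriv (M+1) a s - ∑ i ∈ Finset.range (M+1), ((M+1).choose i : ℂ) * iteratedDeriv i b s * iteratedDeriv (M+1-i) τ s := by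
          rw [h3]; ring
        rw [this]
        refine (norm_sub_le _ _).trans (add_le_add (h2 _ le_rfl) ?_)
        refine (norm_sum_le _ _).trans (Finset.sum_le_sum ?_)
        intro i hi
        have hi' := Finset.mem_range.1 hi
        rw [norm_mul, norm_mul, Complex.norm_natCast]
        gcongr
        · exact ihj i (by omega)
        · exact h1 _ (by omega)
      have h5 : A + ∑ i ∈ Finset.range (M+1), ((M+1).choose i : ℝ) * (C * A / L) * (C0 * L) = (1 + ∑ i ∈ Finset.range (M+1), ((M+1).choose i : ℝ) * C * C0) * A := by
        rw [add_mul, Finset.sum_mul, one_mul]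
        congr 1
        refine Finset.sum_congr rfl fun i _ => ?_
        field_simp
      rw [h5, norm_mul] at h4
      have h6 : ‖iteratedDeriv (M+1) b s‖ * L ≤ max C (1 + ∑ i ∈ Finset.range (M+1), ((M+1).choose i : ℝ) * C * C0) * A := by
        calc _ ≤ ‖iteratedDeriv (M+1) b s‖ * ‖τ s‖ := by gcongr
          _ ≤ _ := h4
          _ ≤ _ := by gcongr; exact le_max_right _ _
      rwa [le_div_iff₀ hL]
  obtain ⟨C, hC, key⟩ := key N
  refine ⟨C, hC, ?_⟩
  intro a τ A L R hL ha hτ haR hLτ h1 h2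
  have hA : 0 ≤ A := (norm_nonneg _).trans (h2 0 (Nat.zero_le _) 0)
  have hopen : ∀ s, R < |s| → ∀ᶠ t in 𝓝 s, R < |t| := fun s hs =>
    (continuous_abs.tendsto s).eventually (lt_mem_nhds hs)
  have hb : ContDiff ℝ ∞ (fun s => a s / τ s) := by
    rw [contDiff_iff_contDiffAt]
    intro s
    rcases le_or_gt |s| R with hs | hs
    · simp only [div_eq_mul_inv]
      refine ha.contDiffAt.mul (hτ.contDiffAt.inv ?_)
      have := hLτ s hs
      intro h0; rw [h0, norm_zero] at this; linarith
    · have : (fun s => a s / τ s) =ᶠ[𝓝 s] fun _ => 0 := by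
        filter_upwards [hopen s hs] with t ht
        rw [haR t ht, zero_div]
      exact contDiffAt_const.congr_of_eventuallyEq this
  refine ⟨hb, ?_⟩
  intro j hj s
  rcases le_or_gt |s| R with hs | hs
  · refine key a τ _ A L s hL hA hb hτ ?_ (hLτ s hs) (fun j hj => h1 j hj s hs) (fun j hj => h2 j hj s) j hj
    have : τ s ≠ 0 := by
      have := hLτ s hs
      intro h0; rw [h0, norm_zero] at this; linarith
    filter_upwards [hτ.continuous.continuousAt.eventually_ne this] with t ht
    field_simp
  · have : (fun s => a s / τ s) =ᶠ[𝓝 s] fun _ => 0 := by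
      filter_upwards [hopen s hs] with t ht
      rw [haR t ht, zero_div]
    rw [this.iteratedDeriv_eq]
    rw [iteratedDeriv_const]
    have : 0 ≤ C * A / L := by positivity
    split_ifs <;> simpa using this

/-- Non-stationary phase in one variable. -/
theorem osc1 (N : ℕ) (C0 : ℝ) (hC0 : 0 ≤ C0) : ∃ C : ℝ, 0 ≤ C ∧
    ∀ (a E τ : ℝ → ℂ) (A L R : ℝ), 0 < L → 0 ≤ R → ContDiff ℝ ∞ a → ContDiff ℝ ∞ τ →
      (∀ s, HasDerivAt E (τ s * E s) s) → (∀ s, ‖E s‖ ≤ 1) →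
      (∀ s, R < |s| → a s = 0) → (∀ s, |s| ≤ R → L ≤ ‖τ s‖) →
      (∀ j ≤ N, ∀ s, |s| ≤ R → ‖iteratedDeriv j τ s‖ ≤ C0 * L) →
      (∀ j ≤ N, ∀ s, ‖iteratedDeriv j a s‖ ≤ A) →
      ‖∫ s, a s * E s‖ ≤ C * A * R / L ^ N := by
  induction N with
  | zero =>
    refine ⟨2, by norm_num, ?_⟩
    intro a E τ A L R hL hR ha hτ hE hE1 haR hLτ h1 h2
    have h3 : ∫ s, a s * E s = ∫ s in Set.Icc (-R) R, a s * E s := by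
      rw [setIntegral_eq_integral_of_forall_compl_eq_zero]
      intro s hs
      rw [Set.mem_Icc, ← abs_le, not_le] at hs
      rw [haR s hs, zero_mul]
    rw [h3]
    refine (norm_setIntegral_le_of_norm_le_const (C := A) (by simp) ?_).trans ?_
    · intro s _
      have := h2 0 le_rfl s
      rw [iteratedDeriv_zero] at this
      rw [norm_mul]
      nlinarith [hE1 s, norm_nonneg (a s), norm_nonneg (E s)]
    · simp [Measure.real, ENNReal.toReal_ofReal (by linarith : (0:ℝ) ≤ R + R)]
      linarith
  | succ N ih =>
    obtain ⟨C, hC, ih⟩ := ih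
    obtain ⟨C', hC', hq⟩ := quot_bound (N+1) C0 hC0
    refine ⟨C * C', by positivity, ?_⟩
    intro a E τ A L R hL hR ha hτ hE hE1 haR hLτ h1 h2
    obtain ⟨hb, hbd⟩ := hq a τ A L R hL ha hτ haR hLτ h1 h2
    set b := fun s => a s / τ s with hbdef
    have hbR : ∀ s, R < |s| → b s = 0 := fun s hs => by simp [hbdef, haR s hs]
    have hbc : HasCompactSupport b := by
      refine HasCompactSupport.intro (isCompact_Icc (a := -R) (b := R)) ?_
      intro s hs
      rw [Set.mem_Icc, ← abs_le, not_le] at hs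
      exact hbR s hs
    have hEc : Continuous E := continuous_iff_continuousAt.2 fun s => (hE s).continuousAt
    have e1 : ∫ s, a s * E s = ∫ s, b s * (τ s * E s) := by
      congr 1; ext s
      rcases le_or_gt |s| R with hs | hs
      · have : τ s ≠ 0 := by
          have := hLτ s hs
          intro h0; rw [h0, norm_zero] at this; linarith
        simp only [hbdef]; field_simp
      · rw [haR s hs, hbR s hs]; simp
    have hbd1 : ContDiff ℝ ∞ (deriv b) := by
      have := (contDiff_infty_iff_deriv (𝕜 := ℝ) (f := b)).1 hb
      exact this.2
    have e2 : ∫ s, b s * (τ s * E s) = - ∫ s, deriv b s * E s := by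
      refine integral_mul_deriv_eq_deriv_mul_of_integrable (fun s _ => ?_) (fun s _ => ?_) ?_ ?_ ?_
      · exact (hb.differentiable (by simp) s).hasDerivAt
      · exact hE s
      · exact (hb.continuous.mul (hτ.continuous.mul hEc)).integrable_of_hasCompactSupport (hbc.mul_right)
      · exact (hbd1.continuous.mul hEc).integrable_of_hasCompactSupport (hbc.deriv.mul_right)
      · exact (hb.continuous.mul hEc).integrable_of_hasCompactSupport (hbc.mul_right)
    rw [e1, e2, norm_neg]
    refine (ih (deriv b) E τ (C' * A / L) L R hL hR hbd1 hτ hE hE1 ?_ hLτ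
      (fun j hj => h1 j (by omega)) ?_).trans (le_of_eq ?_)
    · intro s hs
      have : b =ᶠ[𝓝 s] fun _ => 0 := by
        filter_upwards [(continuous_abs.tendsto s).eventually (lt_mem_nhds hs)] with t ht
        exact hbR t ht
      rw [this.deriv_eq, deriv_const]
    · intro j hj s
      rw [← iteratedDeriv_succ']
      exact hbd (j+1) (by omega) s
    · rw [pow_succ]; field_simp

end HFull


open Filter Topology MeasureTheory
open scoped BigOperators ContDiff

namespace HFull

set_option linter.unusedSectionVars false
set_option linter.style.haveILetI false

section Abstract

variable {V : Type*} [NormedCommRing V] [NormedAlgebra ℝ V] [FiniteDimensional ℝ V]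
variable {E : Type*} [NormedAddCommGroup E] [NormedSpace ℝ E] [FiniteDimensional ℝ E]
  [MeasurableSpace E] [BorelSpace E]

theorem exp_add' [CompleteSpace V] (x y : V) :
    NormedSpace.exp (x + y) = NormedSpace.exp x * NormedSpace.exp y := by
  let _ := NormedAlgebra.restrictScalars ℚ ℝ V
  exact NormedSpace.exp_add

theorem contDiff_exp' [CompleteSpace V] : ContDiff ℝ ∞ (NormedSpace.exp : V → V) := 
  contDiff_iff_contDiffAt.2 fun x => (NormedSpace.exp_analytic (𝕂 := ℝ) x).contDiffAt

theorem hasDerivAt_line [CompleteSpace V] (tr : V →L[ℝ] ℝ) (A : E →L[ℝ] V) (q : V) (z w : E) (i : ℕ) (s : ℝ) :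
    HasDerivAt (fun s : ℝ => tr (q * NormedSpace.exp (A (z + s • w)) * (A w) ^ i))
      (tr (q * NormedSpace.exp (A (z + s • w)) * (A w) ^ (i+1))) s := by
  have h1 := hasDerivAt_exp_smul_const (𝕂 := ℝ) (A w) s
  have h2 := ((h1.const_mul (q * NormedSpace.exp (A z))).mul_const ((A w)^i))
  have h3 := tr.hasFDerivAt.comp_hasDerivAt s h2
  have e1 : (fun s : ℝ => tr (q * NormedSpace.exp (A (z + s • w)) * (A w) ^ i)) =
      (⇑tr ∘ fun y : ℝ => q * NormedSpace.exp (A z) * NormedSpace.exp (y • A w) * A w ^ i) := by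
    ext t
    simp only [Function.comp, map_add, map_smul, exp_add', mul_assoc]
  have e2 : tr (q * NormedSpace.exp (A (z + s • w)) * A w ^ (i + 1)) =
      tr (q * NormedSpace.exp (A z) * (NormedSpace.exp (s • A w) * A w) * A w ^ i) := by
    simp only [map_add, map_smul, exp_add']
    congr 1; ring
  rw [e1, e2]
  exact h3

theorem iteratedDeriv_line [CompleteSpace V] (tr : V →L[ℝ] ℝ) (A : E →L[ℝ] V) (q : V) (z w : E) (j : ℕ) : ∀ (i : ℕ),
    iteratedDeriv j (fun s : ℝ => Complex.I * ((tr (q * NormedSpace.exp (A (z + s • w)) * (A w) ^ i) : ℝ) : ℂ))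
     = fun s : ℝ => Complex.I * ((tr (q * NormedSpace.exp (A (z + s • w)) * (A w) ^ (i+j)) : ℝ):ℂ) := by
  induction j with
  | zero => intro i; simp
  | succ j ih =>
    intro i
    rw [iteratedDeriv_succ']
    have : deriv (fun s : ℝ => Complex.I * ((tr (q * NormedSpace.exp (A (z + s • w)) * (A w) ^ i) : ℝ) : ℂ))
      = (fun s : ℝ => Complex.I * ((tr (q * NormedSpace.exp (A (z + s • w)) * (A w) ^ (i+1)) : ℝ) : ℂ)) := by
      ext s
      exact ((hasDerivAt_line tr A q z w i s).ofReal_comp.const_mul Complex.I).deriv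
    rw [this, ih]
    ext s
    congr 5; ring

theorem line_deriv_bound (N : ℕ) (ψ : ℝ → ℂ) (hψ : ContDiff ℝ ∞ ψ) (hc : HasCompactSupport ψ) (w : E) :
    ∃ C : ℝ, 0 ≤ C ∧ ∀ (a : E → ℂ) (B : ℝ) (z : E), 0 ≤ B → ContDiff ℝ ∞ a →
      (∀ j ≤ N, ∀ z, ‖iteratedFDeriv ℝ j a z‖ ≤ B) →
      ∀ j ≤ N, ∀ s, ‖iteratedDeriv j (fun s : ℝ => ψ s * a (z + s • w)) s‖ ≤ C * B := by
  have hb : ∀ j : ℕ, ∃ c : ℝ, 0 ≤ c ∧ ∀ s, ‖iteratedFDeriv ℝ j ψ s‖ ≤ c := by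
    intro j
    have h1 : Continuous (iteratedFDeriv ℝ j ψ) := hψ.continuous_iteratedFDeriv (by exact_mod_cast le_top)
    have h2 : HasCompactSupport (iteratedFDeriv ℝ j ψ) := hc.iteratedFDeriv j
    obtain ⟨c, hc⟩ := h1.bounded_above_of_compact_support h2
    exact ⟨c, (norm_nonneg _).trans (hc 0), hc⟩
  choose c hc0 hc using hb
  refine ⟨∑ j ∈ Finset.range (N+1), ∑ i ∈ Finset.range (j+1), (j.choose i) * c i * ‖w‖^(j-i), ?_, ?_⟩
  · refine Finset.sum_nonneg fun j _ => Finset.sum_nonneg fun i _ => ?_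
    have := hc0 i
    positivity
  intro a B z hB ha haB j hj s
  set l : ℝ →L[ℝ] E := (ContinuousLinearMap.id ℝ ℝ).smulRight w with hl
  have hlw : ‖l‖ = ‖w‖ := by
    rw [hl]; simp
  have e : (fun s : ℝ => a (z + s • w)) = (fun y => a (z + y)) ∘ l := by
    ext s; simp [hl]
  have ha' : ContDiff ℝ ∞ (fun y => a (z + y)) := ha.comp (contDiff_const.add contDiff_id)
  have hline : ∀ i ≤ N, ‖iteratedFDeriv ℝ i (fun s : ℝ => a (z + s • w)) s‖ ≤ B * ‖w‖^i := by
    intro i hi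
    rw [e, ContinuousLinearMap.iteratedFDeriv_comp_right l ha' s (by exact_mod_cast le_top)]
    refine (ContinuousMultilinearMap.norm_compContinuousLinearMap_le _ _).trans ?_
    rw [Finset.prod_const, hlw]
    simp only [Finset.card_univ, Fintype.card_fin]
    gcongr
    rw [iteratedFDeriv_comp_add_left]
    exact haB i hi _
  have hs : ContDiff ℝ ∞ (fun s : ℝ => a (z + s • w)) := by
    rw [e]; exact ha'.comp l.contDiff
  rw [← norm_iteratedFDeriv_eq_norm_iteratedDeriv]
  refine (norm_iteratedFDeriv_mul_le hψ hs s (n := j) (by exact_mod_cast le_top)).trans ?_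
  rw [Finset.sum_mul]
  refine le_trans ?_ (Finset.single_le_sum (f := fun j => (∑ i ∈ Finset.range (j+1), (j.choose i) * c i * ‖w‖^(j-i)) * B) ?_ (Finset.mem_range.2 (by omega : j < N+1)))
  · rw [Finset.sum_mul]
    refine Finset.sum_le_sum fun i hi => ?_
    rw [Finset.mem_range] at hi
    calc _ ≤ (j.choose i : ℝ) * c i * (B * ‖w‖^(j-i)) := by
          gcongr
          · have := hc0 i; positivity
          · exact hc i s
          · exact hline _ (by omega)
      _ = _ := by ring
  · intro j _
    refine mul_nonneg (Finset.sum_nonneg fun i _ => ?_) hB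
    have := hc0 i
    positivity

theorem nonstat (μ : Measure E) [μ.IsAddHaarMeasure] (tr : V →L[ℝ] ℝ) (A : E →L[ℝ] V) (w : E) (hw : w ≠ 0)
    (δ : ℝ) (hδ : 0 < δ) (N : ℕ) (C1 : ℝ) (hC1 : 0 ≤ C1) :
    ∃ C : ℝ, 0 ≤ C ∧ ∀ (a : E → ℂ) (B L : ℝ) (q : V), 0 < L → ContDiff ℝ ∞ a →
      (∀ z, δ < ‖z‖ → a z = 0) → (∀ j ≤ N, ∀ z, ‖iteratedFDeriv ℝ j a z‖ ≤ B) →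
      ‖q‖ ≤ C1 * L → (∀ z, ‖z‖ ≤ 3 * δ → L ≤ |tr (q * NormedSpace.exp (A z) * A w)|) →
      ‖∫ z, a z * Complex.exp (Complex.I * ((tr (q * NormedSpace.exp (A z)) : ℝ) : ℂ)) ∂μ‖ ≤ C * B / L ^ N := by
  have : CompleteSpace V := FiniteDimensional.complete ℝ V
  have hw' : 0 < ‖w‖ := norm_pos_iff.2 hw
  set R := δ / ‖w‖ with hR
  have hR0 : 0 < R := by positivity
  let bump : ContDiffBump (0:ℝ) := ⟨R/2, R, by positivity, by linarith⟩
  set ψ : ℝ → ℂ := fun s => ((bump.normed volume s : ℝ) : ℂ) with hψdef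
  have hψ : ContDiff ℝ ∞ ψ := Complex.ofRealCLM.contDiff.comp bump.contDiff_normed
  have hψc : HasCompactSupport ψ := (bump.hasCompactSupport_normed (μ := volume)).comp_left (g := fun x : ℝ => (x:ℂ)) (by simp)
  have hψ0 : ∀ s, R < |s| → ψ s = 0 := by
    intro s hs
    have : s ∉ Function.support (bump.normed volume) := by
      rw [bump.support_normed_eq]; simp [bump]; exact hs.le
    rw [Function.notMem_support] at this
    simp [hψdef, this]
  have hψ1 : ∫ s, ψ s = 1 := by
    have h := bump.integral_normed (μ := volume)
    simp only [hψdef]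
    rw [integral_complex_ofReal, h]; simp
  obtain ⟨Ca, hCa, hline⟩ := line_deriv_bound N ψ hψ hψc w
  -- exp bound
  have hexpc : Continuous (fun z : E => NormedSpace.exp (A z)) := contDiff_exp'.continuous.comp A.continuous
  obtain ⟨M, hM⟩ := (isCompact_closedBall (0:E) (3*δ)).exists_bound_of_continuousOn hexpc.continuousOn
  have hM0 : 0 ≤ M := (norm_nonneg _).trans (hM 0 (by simp; positivity))
  set P := ∑ j ∈ Finset.range (N+1), ‖(A w)^(j+1)‖ with hP
  have hP0 : 0 ≤ P := Finset.sum_nonneg fun _ _ => norm_nonneg _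
  obtain ⟨C, hC, hosc⟩ := osc1 N (‖tr‖ * (C1 * M * P)) (by positivity)
  refine ⟨C * Ca * R * μ.real (Metric.closedBall 0 (2*δ)), by positivity, ?_⟩
  intro a B L q hL ha ha0 haB hq hlow
  have hB : 0 ≤ B := (norm_nonneg _).trans (haB 0 (Nat.zero_le _) 0)
  set Ex : E → ℂ := fun z => Complex.exp (Complex.I * ((tr (q * NormedSpace.exp (A z)) : ℝ) : ℂ)) with hEx
  have hExc : Continuous Ex := by
    refine Complex.continuous_exp.comp (continuous_const.mul (Complex.continuous_ofReal.comp (tr.continuous.comp (continuous_const.mul hexpc))))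
  have hEx1 : ∀ z, ‖Ex z‖ = 1 := by
    intro z
    simp only [hEx]; rw [mul_comm, Complex.norm_exp_ofReal_mul_I]
  have hFc : Continuous (fun z => a z * Ex z) := ha.continuous.mul hExc
  have e1 : ∫ z, a z * Ex z ∂μ = ∫ z, (∫ s, ψ s * (a (z + s • w) * Ex (z + s • w))) ∂μ := by
    have h1 : ∫ z, a z * Ex z ∂μ = ∫ s, (∫ z, ψ s * (a (z + s • w) * Ex (z + s • w)) ∂μ) := by
      have : ∀ s : ℝ, ∫ z, ψ s * (a (z + s • w) * Ex (z + s • w)) ∂μ = ψ s * ∫ z, a z * Ex z ∂μ := by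
        intro s
        rw [integral_const_mul, integral_add_right_eq_self (fun z => a z * Ex z)]
      simp_rw [this]
      rw [integral_mul_const, hψ1, one_mul]
    rw [h1]
    refine MeasureTheory.integral_integral_swap_of_hasCompactSupport ?_ ?_
    · have : Continuous (fun p : ℝ × E => p.2 + p.1 • w) := by fun_prop
      exact (hψ.continuous.comp continuous_fst).mul (hFc.comp this)
    · refine HasCompactSupport.intro ((isCompact_closedBall (0:ℝ) R).prod (isCompact_closedBall (0:E) (2*δ))) ?_
      rintro ⟨s, z⟩ hsz
      simp only [Set.mem_prod, mem_closedBall_zero_iff, not_and_or, not_le, Real.norm_eq_abs] at hsz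
      simp only [Function.uncurry]
      rcases le_or_gt |s| R with hs | hs
      · have hz := hsz.resolve_left (not_lt.2 hs)
        rw [ha0, zero_mul, mul_zero]
        have h1 : ‖s • w‖ ≤ δ := by
          rw [norm_smul, Real.norm_eq_abs]
          calc |s| * ‖w‖ ≤ R * ‖w‖ := by gcongr
            _ = δ := by rw [hR]; field_simp
        have := norm_sub_le (z + s • w) (s • w)
        rw [add_sub_cancel_right] at this
        linarith
      · rw [hψ0 s hs, zero_mul]
  rw [e1]
  have hin0 : ∀ z : E, z ∉ Metric.closedBall (0:E) (2*δ) → (∫ s, ψ s * (a (z + s • w) * Ex (z + s • w))) = 0 := by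
    intro z hz
    simp only [mem_closedBall_zero_iff, not_le] at hz
    rw [← integral_zero ℝ ℂ]
    congr 1; ext s
    rcases le_or_gt |s| R with hs | hs
    · rw [ha0, zero_mul, mul_zero]
      have h1 : ‖s • w‖ ≤ δ := by
        rw [norm_smul, Real.norm_eq_abs]
        calc |s| * ‖w‖ ≤ R * ‖w‖ := by gcongr
          _ = δ := by rw [hR]; field_simp
      have := norm_sub_le (z + s • w) (s • w)
      rw [add_sub_cancel_right] at this
      linarith
    · rw [hψ0 s hs, zero_mul]
  rw [← setIntegral_eq_integral_of_forall_compl_eq_zero hin0]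
  refine (norm_setIntegral_le_of_norm_le_const (C := C * (Ca * B) * R / L^N) ?_ ?_).trans (le_of_eq (by ring))
  · exact (isCompact_closedBall _ _).measure_lt_top
  intro z hz
  rw [mem_closedBall_zero_iff] at hz
  have hz3 : ∀ s : ℝ, |s| ≤ R → ‖z + s • w‖ ≤ 3 * δ := by
    intro s hs
    have h1 : ‖s • w‖ ≤ δ := by
      rw [norm_smul, Real.norm_eq_abs]
      calc |s| * ‖w‖ ≤ R * ‖w‖ := by gcongr
        _ = δ := by rw [hR]; field_simp
    have := norm_add_le z (s • w)
    linarith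
  have hτ : ContDiff ℝ ∞ (fun s : ℝ => Complex.I * ((tr (q * NormedSpace.exp (A (z + s • w)) * (A w) ^ 1) : ℝ) : ℂ)) := by
    refine contDiff_const.mul (Complex.ofRealCLM.contDiff.comp (tr.contDiff.comp ?_))
    refine (contDiff_const.mul (contDiff_exp'.comp (A.contDiff.comp ?_))).mul contDiff_const
    fun_prop
  have := hosc (fun s => ψ s * a (z + s • w)) (fun s => Ex (z + s • w)) 
    (fun s : ℝ => Complex.I * ((tr (q * NormedSpace.exp (A (z + s • w)) * (A w) ^ 1) : ℝ) : ℂ)) (Ca * B) L R hL hR0.le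
    (hψ.mul (ha.comp (by fun_prop))) hτ ?_ (fun s => (hEx1 _).le) ?_ ?_ ?_ ?_
  · simpa only [mul_assoc] using this
  · intro s
    have h := (hasDerivAt_line tr A q z w 0 s).ofReal_comp.const_mul Complex.I
    have h2 := h.cexp
    simp only [pow_zero, mul_one, zero_add, hEx] at h2 ⊢
    convert h2 using 1
    ring
  · intro s hs
    simp [hψ0 s hs]
  · intro s hs
    rw [norm_mul, Complex.norm_I, one_mul, pow_one, Complex.norm_real]
    exact hlow _ (hz3 s hs)
  · intro j hj s hs
    rw [iteratedDeriv_line]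
    simp only
    rw [norm_mul, Complex.norm_I, one_mul, Complex.norm_real]
    refine (tr.le_opNorm _).trans ?_
    have h1 : ‖(A w)^(1+j)‖ ≤ P := by
      rw [add_comm]
      exact Finset.single_le_sum (f := fun j => ‖(A w)^(j+1)‖) (fun _ _ => norm_nonneg _) (Finset.mem_range.2 (by omega))
    calc ‖tr‖ * ‖q * NormedSpace.exp (A (z + s • w)) * (A w)^(1+j)‖ ≤ ‖tr‖ * (((C1 * L) * M) * P) := by
          gcongr
          refine (norm_mul_le _ _).trans ?_
          gcongr
          refine (norm_mul_le _ _).trans ?_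
          gcongr
          exact hM _ (by simpa using hz3 s hs)
      _ = _ := by ring
  · exact hline a B z hB ha haB

end Abstract
end HFull


open Filter Topology MeasureTheory
open scoped BigOperators ContDiff

namespace HFull

set_option linter.unusedSectionVars false
set_option linter.style.haveILetI false

section Abstract

variable {V : Type*} [NormedCommRing V] [NormedAlgebra ℝ V] [FiniteDimensional ℝ V]
variable {E : Type*} [NormedAddCommGroup E] [NormedSpace ℝ E] [FiniteDimensional ℝ E]
  [MeasurableSpace E] [BorelSpace E]

theorem mul_deriv_bound (N : ℕ) (a b : E → ℂ) (B B' : ℝ) (ha : ContDiff ℝ ∞ a) (hb : ContDiff ℝ ∞ b)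
    (hB : 0 ≤ B) (hB' : 0 ≤ B') (z : E)
    (h1 : ∀ j ≤ N, ‖iteratedFDeriv ℝ j a z‖ ≤ B) (h2 : ∀ j ≤ N, ‖iteratedFDeriv ℝ j b z‖ ≤ B') :
    ∀ j ≤ N, ‖iteratedFDeriv ℝ j (fun z => a z * b z) z‖ ≤ 2 ^ N * (B * B') := by
  intro j hj
  refine (norm_iteratedFDeriv_mul_le ha hb z (n := j) (by exact_mod_cast le_top)).trans ?_
  calc _ ≤ ∑ i ∈ Finset.range (j+1), (j.choose i : ℝ) * (B * B') := by
        refine Finset.sum_le_sum fun i hi => ?_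
        rw [Finset.mem_range] at hi
        rw [mul_assoc]
        gcongr
        · exact h1 i (by omega)
        · exact h2 (j-i) (by omega)
    _ = 2 ^ j * (B * B') := by
        rw [← Finset.sum_mul]
        congr 1
        exact_mod_cast Nat.sum_range_choose j
    _ ≤ _ := by gcongr; norm_num

/-- lower bound for the Hessian-like quantity -/
theorem lower_basis (tr : V →L[ℝ] ℝ) (A : E →L[ℝ] V) (hA : Function.Injective A)
    (hAr : ∀ v, tr v = 0 → ∃ z, A z = v) (hA0 : ∀ z, tr (A z) = 0)
    (hnd : ∀ p, (∀ v, tr (p * v) = 0) → p = 0) (h1 : tr 1 ≠ 0) :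
    ∃ c : ℝ, 0 < c ∧ ∀ ζ : E, ζ ≠ 0 → ∃ j, c * ‖ζ‖ ≤ |tr (A ζ * A (Module.finBasis ℝ E j))| := by
  let T : E →ₗ[ℝ] (Fin (Module.finrank ℝ E) → ℝ) :=
    LinearMap.pi fun j => (tr : V →ₗ[ℝ] ℝ) ∘ₗ (LinearMap.mulRight ℝ (A (Module.finBasis ℝ E j))) ∘ₗ (A : E →ₗ[ℝ] V)
  have hT : ∀ ζ j, T ζ j = tr (A ζ * A (Module.finBasis ℝ E j)) := fun ζ j => rfl
  have hinj : LinearMap.ker T = ⊥ := by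
    rw [LinearMap.ker_eq_bot']
    intro ζ hζ
    have h2 : ∀ w, tr (A ζ * A w) = 0 := by
      intro w
      have h3 : (tr : V →ₗ[ℝ] ℝ) ∘ₗ (LinearMap.mulLeft ℝ (A ζ)) ∘ₗ (A : E →ₗ[ℝ] V) = 0 := by
        refine (Module.finBasis ℝ E).ext fun j => ?_
        have := congrFun hζ j
        rw [hT] at this
        simpa using this
      simpa using LinearMap.congr_fun h3 w
    have h3 : A ζ = 0 := by
      refine hnd _ fun v => ?_
      obtain ⟨w, hw⟩ := hAr (v - (tr v / tr 1) • 1) (by simp [h1])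
      have : v = A w + (tr v / tr 1) • 1 := by rw [hw]; abel
      rw [this, mul_add, map_add, h2]
      simp [hA0]
    exact hA (by rw [h3, map_zero])
  obtain ⟨K, hK, hanti⟩ := LinearMap.exists_antilipschitzWith T hinj
  have hK' : (0:ℝ) < K := hK
  refine ⟨(K:ℝ)⁻¹, by positivity, ?_⟩
  intro ζ hζ
  by_contra! hcon
  have hζ' : 0 < ‖ζ‖ := norm_pos_iff.2 hζ
  have h2 : ‖T ζ‖ < (K:ℝ)⁻¹ * ‖ζ‖ := by
    rw [pi_norm_lt_iff (by positivity)]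
    intro j
    rw [hT]; exact hcon j
  have h3 := hanti.le_mul_dist ζ 0
  rw [dist_zero_right, map_zero, dist_zero_right] at h3
  have : (K:ℝ) * ‖T ζ‖ < ‖ζ‖ := by
    calc _ < (K:ℝ) * ((K:ℝ)⁻¹ * ‖ζ‖) := by gcongr
      _ = _ := by field_simp
  linarith

theorem stat_setup (tr : V →L[ℝ] ℝ) (A : E →L[ℝ] V) (hA : Function.Injective A)
    (hAr : ∀ v, tr v = 0 → ∃ z, A z = v) (hA0 : ∀ z, tr (A z) = 0)
    (hnd : ∀ p, (∀ v, tr (p * v) = 0) → p = 0) (h1 : tr 1 ≠ 0) (c0 : ℝ) (hc0 : c0 ≠ 0) :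
    ∃ δ ε c P : ℝ, 0 < δ ∧ 0 < ε ∧ 0 < c ∧ 0 ≤ P ∧ 
      (∀ p : V, ‖p - c0 • (1:V)‖ ≤ ε → ∀ ζ : E, ‖ζ‖ ≤ 2 * δ → 
        ‖p * (NormedSpace.exp (A ζ) - 1)‖ ≤ P * ‖ζ‖) ∧
      (∀ p : V, ‖p - c0 • (1:V)‖ ≤ ε → ∀ ζ : E, ζ ≠ 0 → ‖ζ‖ ≤ 2 * δ → ∃ j, ∀ z : E, ‖z‖ ≤ 3 * δ →
        c * ‖ζ‖ ≤ |tr (p * (NormedSpace.exp (A ζ) - 1) * NormedSpace.exp (A z) * A (Module.finBasis ℝ E j))|) := by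
  have : CompleteSpace V := FiniteDimensional.complete ℝ V
  obtain ⟨c, hc, hlow⟩ := lower_basis tr A hA hAr hA0 hnd h1
  set W := ∑ j, ‖A (Module.finBasis ℝ E j)‖ with hW
  have hW0 : 0 ≤ W := Finset.sum_nonneg fun _ _ => norm_nonneg _
  have hWj : ∀ j, ‖A (Module.finBasis ℝ E j)‖ ≤ W := fun j =>
    Finset.single_le_sum (f := fun j => ‖A (Module.finBasis ℝ E j)‖) (fun _ _ => norm_nonneg _) (Finset.mem_univ j)
  set D := ‖tr‖ * W + 1 with hD
  have hD0 : 0 < D := by positivity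
  have hc0' : 0 < |c0| := abs_pos.2 hc0
  set e := |c0| * c / (2 * D) with he
  have he0 : 0 < e := by positivity
  set Q := ‖c0 • (1:V)‖ + 1 with hQ
  have hQ0 : 0 < Q := by positivity
  set η := e / (2 * (‖A‖ + 1)) with hη
  have hη0 : 0 < η := by positivity
  -- continuity of p exp(Az)
  have hcont : Continuous (fun x : V × E => x.1 * NormedSpace.exp (A x.2)) :=
    continuous_fst.mul (contDiff_exp'.continuous.comp (A.continuous.comp continuous_snd))
  have h2 : ∀ᶠ x : V × E in 𝓝 (c0 • (1:V), (0:E)), ‖x.1 * NormedSpace.exp (A x.2) - c0 • (1:V)‖ < min η 1 := by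
    have h := hcont.tendsto (c0 • (1:V), (0:E))
    simp only [map_zero, NormedSpace.exp_zero, mul_one] at h
    have h' := (h.sub_const (c0 • (1:V))).norm
    rw [sub_self, norm_zero] at h'
    exact h'.eventually (gt_mem_nhds (by positivity))
  rw [Metric.eventually_nhds_iff] at h2
  obtain ⟨r, hr, h2⟩ := h2
  -- little o
  have h3 : ∀ᶠ v : V in 𝓝 0, ‖NormedSpace.exp v - 1 - v‖ ≤ min (η / Q) 1 * ‖v‖ := by
    have h := (hasFDerivAt_exp_zero (𝕂 := ℝ) (𝔸 := V)).isLittleO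
    have := h.def (c := min (η/Q) 1) (by positivity)
    simpa using this
  have h4 : ∀ᶠ ζ : E in 𝓝 0, ‖NormedSpace.exp (A ζ) - 1 - A ζ‖ ≤ min (η / Q) 1 * ‖A ζ‖ := by
    have h := A.continuous.tendsto 0
    rw [map_zero] at h
    exact h.eventually h3
  rw [Metric.eventually_nhds_iff] at h4
  obtain ⟨r', hr', h4⟩ := h4
  refine ⟨min r r' / 4, min (r/2) 1, |c0| * c / 2, Q * (2 * ‖A‖), by positivity, by positivity, by positivity, by positivity, ?_, ?_⟩
  · intro p hp ζ hζ
    have hpQ : ‖p‖ ≤ Q := by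
      have h5 := norm_add_le (p - c0 • (1:V)) (c0 • (1:V))
      rw [sub_add_cancel] at h5
      have := hp.trans (min_le_right _ _)
      linarith
    have h5 := h4 (y := ζ) (by rw [dist_zero_right]; have := min_le_right r r'; linarith)
    refine (norm_mul_le _ _).trans ?_
    rw [mul_assoc]
    gcongr
    have h6 := norm_add_le (NormedSpace.exp (A ζ) - 1 - A ζ) (A ζ)
    rw [sub_add_cancel] at h6
    have h7 : min (η / Q) 1 * ‖A ζ‖ ≤ 1 * ‖A ζ‖ := by gcongr; exact min_le_right _ _
    have h8 := A.le_opNorm ζ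
    linarith
  · intro p hp ζ hζ0 hζ
    obtain ⟨j, hj⟩ := hlow ζ hζ0
    refine ⟨j, fun z hz => ?_⟩
    have h5 := h4 (y := ζ) (by rw [dist_zero_right]; have := min_le_right r r'; linarith)
    have h6 := h2 (y := (p, z)) (by
      rw [Prod.dist_eq, max_lt_iff]
      constructor
      · simp only; rw [dist_eq_norm]; have := min_le_left (r/2) 1; linarith
      · simp only; rw [dist_zero_right]; have := min_le_left r r'; linarith)
    simp only at h6
    set X := p * NormedSpace.exp (A z) with hX
    have hXQ : ‖X‖ ≤ Q := by
      have h5 := norm_add_le (X - c0 • (1:V)) (c0 • (1:V))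
      rw [sub_add_cancel] at h5
      have := h6.le.trans (min_le_right _ _)
      linarith
    set wj := A (Module.finBasis ℝ E j)
    have e1 : tr (p * (NormedSpace.exp (A ζ) - 1) * NormedSpace.exp (A z) * wj) = 
        c0 * tr (A ζ * wj) + tr ((X * (NormedSpace.exp (A ζ) - 1 - A ζ) + (X - c0 • (1:V)) * A ζ) * wj) := by
      have e0 : c0 * tr (A ζ * wj) = tr (c0 • (A ζ * wj)) := by rw [map_smul, smul_eq_mul]
      rw [e0, ← map_add]
      congr 1
      rw [hX, Algebra.smul_def, Algebra.smul_def]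
      ring
    have e2 : |tr ((X * (NormedSpace.exp (A ζ) - 1 - A ζ) + (X - c0 • (1:V)) * A ζ) * wj)| ≤ |c0| * c / 2 * ‖ζ‖ := by
      have hAζ := A.le_opNorm ζ
      have b1 : ‖X * (NormedSpace.exp (A ζ) - 1 - A ζ)‖ ≤ Q * ((η/Q) * (‖A‖ * ‖ζ‖)) := by
        refine (norm_mul_le _ _).trans ?_
        gcongr
        refine h5.trans ?_
        gcongr
        exact min_le_left _ _
      have b2 : ‖(X - c0 • (1:V)) * A ζ‖ ≤ η * (‖A‖ * ‖ζ‖) := by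
        refine (norm_mul_le _ _).trans ?_
        gcongr
        exact h6.le.trans (min_le_left _ _)
      calc _ ≤ ‖tr‖ * ‖(X * (NormedSpace.exp (A ζ) - 1 - A ζ) + (X - c0 • (1:V)) * A ζ) * wj‖ := tr.le_opNorm _
        _ ≤ ‖tr‖ * ((Q * ((η/Q) * (‖A‖ * ‖ζ‖)) + η * (‖A‖ * ‖ζ‖)) * W) := by
            gcongr
            refine (norm_mul_le _ _).trans ?_
            gcongr
            · exact (norm_add_le _ _).trans (add_le_add b1 b2)
            · exact hWj j
        _ = (‖tr‖ * W) * (‖A‖ * (2 * η)) * ‖ζ‖ := by field_simp; ring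
        _ ≤ D * ((‖A‖ + 1) * (2 * η)) * ‖ζ‖ := by
            gcongr
            · rw [hD]; linarith
            · linarith
        _ = |c0| * c / 2 * ‖ζ‖ := by rw [hη, he]; field_simp
    rw [e1]
    have e3 : |c0| * (c * ‖ζ‖) ≤ |c0 * tr (A ζ * wj)| := by rw [abs_mul]; gcongr
    have := abs_sub_abs_le_abs_sub (c0 * tr (A ζ * wj)) (-(tr ((X * (NormedSpace.exp (A ζ) - 1 - A ζ) + (X - c0 • (1:V)) * A ζ) * wj)))
    rw [abs_neg, sub_neg_eq_add] at this
    linarith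

theorem stat (μ : Measure E) [μ.IsAddHaarMeasure] (tr : V →L[ℝ] ℝ) (A : E →L[ℝ] V) (hA : Function.Injective A)
    (hAr : ∀ v, tr v = 0 → ∃ z, A z = v) (hA0 : ∀ z, tr (A z) = 0)
    (hnd : ∀ p, (∀ v, tr (p * v) = 0) → p = 0) (h1 : tr 1 ≠ 0) (c0 : ℝ) (hc0 : c0 ≠ 0) :
    ∃ δ ε C : ℝ, 0 < δ ∧ 0 < ε ∧ 0 ≤ C ∧ ∀ (p : V) (b : E → ℂ) (B Λ : ℝ), 0 < Λ → 
      ‖p - c0 • (1:V)‖ ≤ ε → ContDiff ℝ ∞ b → (∀ z, δ < ‖z‖ → b z = 0) → 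
      (∀ j ≤ Module.finrank ℝ E + 1, ∀ z, ‖iteratedFDeriv ℝ j b z‖ ≤ B) →
      ‖∫ z, b z * Complex.exp (Complex.I * ((tr ((Λ • p) * NormedSpace.exp (A z)) : ℝ) : ℂ)) ∂μ‖ ^ 2 
        ≤ C * B ^ 2 / Λ ^ (Module.finrank ℝ E) := by
  have : CompleteSpace V := FiniteDimensional.complete ℝ V
  obtain ⟨δ, ε, c, P, hδ, hε, hc, hP, hup, hlow⟩ := stat_setup tr A hA hAr hA0 hnd h1 c0 hc0
  set m := Module.finrank ℝ E with hm
  set N := m + 1 with hN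
  have hns := fun j => nonstat μ tr A (Module.finBasis ℝ E j) ((Module.finBasis ℝ E).ne_zero j) δ hδ N (P / c) (by positivity)
  choose Cj hCj hns using hns
  set C3 := ∑ j, Cj j with hC3
  have hC3' : ∀ j, Cj j ≤ C3 := fun j => Finset.single_le_sum (f := Cj) (fun _ _ => hCj _) (Finset.mem_univ j)
  have hC30 : 0 ≤ C3 := Finset.sum_nonneg fun j _ => hCj j
  set vol := μ.real (Metric.closedBall (0:E) δ) with hvol
  have hvol0 : 0 ≤ vol := measureReal_nonneg
  set C4 := 2 ^ N * vol + C3 * 2 ^ N / c ^ N * 2 ^ N with hC4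
  have hC40 : 0 ≤ C4 := by positivity
  set I0 := ∫ u : E, (1 + ‖u‖) ^ (-(N:ℝ)) ∂μ with hI0
  have hint : Integrable (fun u : E => (1 + ‖u‖) ^ (-(N:ℝ))) μ := by
    refine integrable_one_add_norm ?_
    rw [hN, ← hm]; push_cast; linarith
  have hI00 : 0 ≤ I0 := integral_nonneg fun u => by positivity
  refine ⟨δ, ε, C4 * I0, hδ, hε, by positivity, ?_⟩
  intro p b B Λ hΛ hp hb hb0 hbB
  have hB : 0 ≤ B := (norm_nonneg _).trans (hbB 0 (Nat.zero_le _) 0)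
  have hexpc : Continuous (fun z : E => NormedSpace.exp (A z)) := contDiff_exp'.continuous.comp A.continuous
  set Ex : E → ℂ := fun z => Complex.exp (Complex.I * ((tr ((Λ • p) * NormedSpace.exp (A z)) : ℝ) : ℂ)) with hEx
  have hExc : Continuous Ex := by
    refine Complex.continuous_exp.comp (continuous_const.mul (Complex.continuous_ofReal.comp (tr.continuous.comp (continuous_const.mul hexpc))))
  have hEx1 : ∀ z, ‖Ex z‖ = 1 := by
    intro z
    simp only [hEx]; rw [mul_comm, Complex.norm_exp_ofReal_mul_I]
  have hFc : Continuous (fun z => b z * Ex z) := hb.continuous.mul hExc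
  set S := ∫ z, b z * Ex z ∂μ with hS
  -- rewrite |S|^2
  have e1 : S * (starRingEnd ℂ) S = ∫ ζ, (∫ z, (starRingEnd ℂ) (b z * Ex z) * (b (z + ζ) * Ex (z + ζ)) ∂μ) ∂μ := by
    have h2 : S * (starRingEnd ℂ) S = ∫ z, (∫ ζ, (starRingEnd ℂ) (b z * Ex z) * (b (z + ζ) * Ex (z + ζ)) ∂μ) ∂μ := by
      have : ∀ z : E, ∫ ζ, (starRingEnd ℂ) (b z * Ex z) * (b (z + ζ) * Ex (z + ζ)) ∂μ = (starRingEnd ℂ) (b z * Ex z) * S := by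
        intro z
        rw [integral_const_mul, integral_add_left_eq_self (fun z => b z * Ex z)]
      simp_rw [this]
      rw [integral_mul_const, integral_conj, mul_comm]
    rw [h2]
    refine MeasureTheory.integral_integral_swap_of_hasCompactSupport ?_ ?_
    · exact (Complex.continuous_conj.comp (hFc.comp continuous_fst)).mul (hFc.comp (continuous_fst.add continuous_snd))
    · refine HasCompactSupport.intro ((isCompact_closedBall (0:E) δ).prod (isCompact_closedBall (0:E) (2*δ))) ?_
      rintro ⟨z, ζ⟩ hsz
      simp only [Set.mem_prod, mem_closedBall_zero_iff, not_and_or, not_le] at hsz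
      simp only [Function.uncurry]
      rcases le_or_gt ‖z‖ δ with hs | hs
      · have hz := hsz.resolve_left (not_lt.2 hs)
        rw [hb0 (z + ζ), zero_mul, mul_zero]
        have := norm_sub_le (z + ζ) z
        rw [add_sub_cancel_left] at this
        linarith
      · rw [hb0 z hs, zero_mul, map_zero, zero_mul]
  have hJ : ∀ ζ : E, ‖∫ z, (starRingEnd ℂ) (b z * Ex z) * (b (z + ζ) * Ex (z + ζ)) ∂μ‖ ≤ C4 * B^2 * (1 + ‖Λ • ζ‖) ^ (-(N:ℝ)) := by
    intro ζ
    have hb00 : ∀ z, ‖b z‖ ≤ B := fun z => by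
      have := hbB 0 (Nat.zero_le _) z
      rwa [norm_iteratedFDeriv_zero] at this
    rw [norm_smul, Real.norm_eq_abs, abs_of_pos hΛ, Real.rpow_neg (by positivity), Real.rpow_natCast, ← div_eq_mul_inv]
    rcases le_or_gt (Λ * ‖ζ‖) 1 with hΛζ | hΛζ
    · -- trivial bound
      have h2 : ∀ z, z ∉ Metric.closedBall (0:E) δ → (starRingEnd ℂ) (b z * Ex z) * (b (z + ζ) * Ex (z + ζ)) = 0 := by
        intro z hz
        rw [mem_closedBall_zero_iff, not_le] at hz
        rw [hb0 z hz, zero_mul, map_zero, zero_mul]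
      rw [← setIntegral_eq_integral_of_forall_compl_eq_zero h2]
      refine (norm_setIntegral_le_of_norm_le_const (C := B * B) (isCompact_closedBall _ _).measure_lt_top ?_).trans ?_
      · intro z _
        rw [norm_mul, RCLike.norm_conj, norm_mul, norm_mul, hEx1, hEx1, mul_one, mul_one]
        exact mul_le_mul (hb00 _) (hb00 _) (norm_nonneg _) hB
      · rw [le_div_iff₀ (by positivity)]
        calc B * B * vol * (1 + Λ * ‖ζ‖)^N ≤ B * B * vol * (1 + 1)^N := by gcongr
          _ = (2^N * vol) * B^2 := by norm_num; ring
          _ ≤ C4 * B^2 := by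
            gcongr
            rw [hC4]
            have : 0 ≤ C3 * 2 ^ N / c ^ N * 2 ^ N := by positivity
            linarith
    · rcases le_or_gt ‖ζ‖ (2*δ) with hζ | hζ
      · have hζ0 : ζ ≠ 0 := by
          rintro rfl
          simp at hΛζ
          linarith
        have hζ' : 0 < ‖ζ‖ := norm_pos_iff.2 hζ0
        obtain ⟨j, hj⟩ := hlow p hp ζ hζ0 hζ
        have hbc : ContDiff ℝ ∞ (fun z => (starRingEnd ℂ) (b z)) := 
          Complex.conjCLE.contDiff.comp hb
        have hbs : ContDiff ℝ ∞ (fun z => b (z + ζ)) := hb.comp (contDiff_id.add contDiff_const)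
        have e2 : ∀ z, (starRingEnd ℂ) (b z * Ex z) * (b (z + ζ) * Ex (z + ζ)) = 
            ((starRingEnd ℂ) (b z) * b (z + ζ)) * Complex.exp (Complex.I * ((tr (((Λ • p) * (NormedSpace.exp (A ζ) - 1)) * NormedSpace.exp (A z)) : ℝ) : ℂ)) := by
          intro z
          have : (starRingEnd ℂ) (Ex z) * Ex (z + ζ) = Complex.exp (Complex.I * ((tr (((Λ • p) * (NormedSpace.exp (A ζ) - 1)) * NormedSpace.exp (A z)) : ℝ) : ℂ)) := by
            simp only [hEx]
            rw [← Complex.exp_conj, ← Complex.exp_add]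
            congr 1
            rw [map_mul, Complex.conj_I, Complex.conj_ofReal, neg_mul, neg_add_eq_sub, ← mul_sub, ← Complex.ofReal_sub, ← map_sub]
            congr 4
            rw [map_add, exp_add']; ring
          rw [map_mul, ← this]; ring
        simp_rw [e2]
        refine (hns j (fun z => (starRingEnd ℂ) (b z) * b (z + ζ)) (2^N * (B * B)) (Λ * (c * ‖ζ‖)) ((Λ • p) * (NormedSpace.exp (A ζ) - 1)) (by positivity) (hbc.mul hbs) ?_ ?_ ?_ ?_).trans ?_
        · intro z hz; rw [hb0 z hz, map_zero, zero_mul]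
        · intro i hi z
          refine mul_deriv_bound N _ _ B B hbc hbs hB hB z ?_ ?_ i hi
          · intro k hk
            have := LinearIsometryEquiv.norm_iteratedFDeriv_comp_left (𝕜 := ℝ) Complex.conjLIE b z k
            refine le_trans (le_of_eq this) (hbB k hk z)
          · intro k hk
            rw [iteratedFDeriv_comp_add_right]
            exact hbB k hk _
        · rw [smul_mul_assoc, norm_smul, Real.norm_eq_abs, abs_of_pos hΛ]
          calc _ ≤ Λ * (P * ‖ζ‖) := by gcongr; exact hup p hp ζ hζ
            _ = _ := by field_simp
        · intro z hz
          rw [smul_mul_assoc, smul_mul_assoc, smul_mul_assoc, map_smul, smul_eq_mul, abs_mul, abs_of_pos hΛ]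
          gcongr
          exact hj z hz
        · rw [le_div_iff₀ (by positivity), div_mul_eq_mul_div, div_le_iff₀ (by positivity)]
          calc Cj j * (2^N * (B * B)) * (1 + Λ * ‖ζ‖)^N ≤ C3 * (2^N * (B * B)) * (Λ * ‖ζ‖ + Λ * ‖ζ‖)^N := by
                gcongr
                exact hC3' j
            _ = (C3 * 2^N / c^N * 2^N) * B^2 * (Λ * (c * ‖ζ‖))^N := by
                rw [← two_mul, mul_pow, mul_pow, mul_pow, mul_pow]; field_simp
            _ ≤ _ := by
                gcongr
                rw [hC4]
                have : 0 ≤ 2 ^ N * vol := by positivity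
                linarith
      · have h2 : ∀ z, (starRingEnd ℂ) (b z * Ex z) * (b (z + ζ) * Ex (z + ζ)) = 0 := by
          intro z
          rcases le_or_gt ‖z‖ δ with hs | hs
          · rw [hb0 (z + ζ), zero_mul, mul_zero]
            have := norm_sub_le (z + ζ) z
            rw [add_sub_cancel_left] at this
            linarith
          · rw [hb0 z hs, zero_mul, map_zero, zero_mul]
        simp_rw [h2]
        simp only [integral_zero, norm_zero]
        positivity
  have hint2 : Integrable (fun ζ : E => C4 * B^2 * (1 + ‖Λ • ζ‖) ^ (-(N:ℝ))) μ :=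
    (hint.comp_smul hΛ.ne').const_mul _
  have h2 : ‖S‖^2 = ‖S * (starRingEnd ℂ) S‖ := by rw [norm_mul, RCLike.norm_conj, sq]
  rw [h2, e1]
  refine (norm_integral_le_of_norm_le hint2 (Eventually.of_forall hJ)).trans (le_of_eq ?_)
  rw [integral_const_mul, Measure.integral_comp_smul μ (fun u : E => (1 + ‖u‖) ^ (-(N:ℝ))) Λ, ← hI0, smul_eq_mul, abs_of_pos (by positivity), ← hm]
  field_simp

end Abstract
end HFull


open Filter Topology MeasureTheory
open scoped BigOperators ContDiff

namespace HFull

set_option linter.unusedSectionVars false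
set_option linter.style.haveILetI false

theorem exists_inv_pow (k : ℕ) (c : ℝ) (hc : 0 < c) : ∃ h : ℝ → ℂ, ContDiff ℝ ∞ h ∧
    ∀ t, c ≤ |t| → h t = ((t:ℂ)^k)⁻¹ := by
  let bump : ContDiffBump (0:ℝ) := ⟨c/2, c, by positivity, by linarith⟩
  refine ⟨fun t => ((1 - bump t : ℝ) : ℂ) * ((t:ℂ)^k)⁻¹, ?_, ?_⟩
  · rw [contDiff_iff_contDiffAt]
    intro t
    by_cases ht : t = 0
    · subst ht
      have : (fun t : ℝ => ((1 - bump t : ℝ) : ℂ) * ((t:ℂ)^k)⁻¹) =ᶠ[𝓝 0] fun _ => 0 := by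
        filter_upwards [bump.eventuallyEq_one] with t ht
        rw [ht]; simp
      exact contDiffAt_const.congr_of_eventuallyEq this
    · refine ContDiffAt.mul ?_ ?_
      · exact (Complex.ofRealCLM.contDiff.comp (contDiff_const.sub bump.contDiff)).contDiffAt
      · refine ContDiffAt.inv ?_ ?_
        · exact (Complex.ofRealCLM.contDiff.pow k).contDiffAt
        · exact pow_ne_zero _ (by exact_mod_cast ht)
  · intro t ht
    have : bump t = 0 := bump.zero_of_le_dist (by simpa [bump] using ht)
    simp [this]

theorem ibp_exp (k : ℕ) : ∀ (g : ℝ → ℂ) (T : ℝ), T ≠ 0 → ContDiff ℝ ∞ g → HasCompactSupport g →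
    ∫ σ, g σ * Complex.exp (Complex.I * ((σ * T : ℝ) : ℂ)) =
      (Complex.I) ^ k * ((T:ℂ)^k)⁻¹ * ∫ σ, iteratedDeriv k g σ * Complex.exp (Complex.I * ((σ * T : ℝ) : ℂ)) := by
  induction k with
  | zero => intro g T _ _ _; simp
  | succ k ih =>
    intro g T hT hg hgc
    have hT' : (T:ℂ) ≠ 0 := by exact_mod_cast hT
    have hd : ∀ s : ℝ, HasDerivAt (fun σ : ℝ => Complex.exp (Complex.I * ((σ * T : ℝ) : ℂ))) ((Complex.I * T) * Complex.exp (Complex.I * ((s * T : ℝ) : ℂ))) s := by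
      intro s
      have h := (((hasDerivAt_id s).mul_const T).ofReal_comp.const_mul Complex.I).cexp
      simp only [id] at h
      convert h using 1
      push_cast; ring
    have hEc : Continuous (fun σ : ℝ => Complex.exp (Complex.I * ((σ * T : ℝ) : ℂ))) := 
      continuous_iff_continuousAt.2 fun s => (hd s).continuousAt
    have hg1 : ContDiff ℝ ∞ (deriv g) := ((contDiff_infty_iff_deriv (𝕜 := ℝ) (f := g)).1 hg).2
    have e2 : ∫ s, g s * ((Complex.I * T) * Complex.exp (Complex.I * ((s * T : ℝ) : ℂ))) = - ∫ s, deriv g s * Complex.exp (Complex.I * ((s * T : ℝ) : ℂ)) := by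
      refine integral_mul_deriv_eq_deriv_mul_of_integrable (fun s _ => ?_) (fun s _ => ?_) ?_ ?_ ?_
      · exact (hg.differentiable (by simp) s).hasDerivAt
      · exact hd s
      · exact (hg.continuous.mul (continuous_const.mul hEc)).integrable_of_hasCompactSupport (hgc.mul_right)
      · exact (hg1.continuous.mul hEc).integrable_of_hasCompactSupport (hgc.deriv.mul_right)
      · exact (hg.continuous.mul hEc).integrable_of_hasCompactSupport (hgc.mul_right)
    have e3 := ih (deriv g) T hT hg1 hgc.deriv
    rw [iteratedDeriv_succ']
    have e4 : ∫ s, g s * ((Complex.I * T) * Complex.exp (Complex.I * ((s * T : ℝ) : ℂ))) = (Complex.I * T) * ∫ s, g s * Complex.exp (Complex.I * ((s * T : ℝ) : ℂ)) := by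
      rw [← integral_const_mul]; congr 1; ext s; ring
    rw [e4] at e2
    have hI : Complex.I * T ≠ 0 := mul_ne_zero Complex.I_ne_zero hT'
    have e5 : ∫ s, g s * Complex.exp (Complex.I * ((s * T : ℝ) : ℂ)) = (Complex.I * (T:ℂ)⁻¹) * ∫ s, deriv g s * Complex.exp (Complex.I * ((s * T : ℝ) : ℂ)) := by
      have : (Complex.I * (T:ℂ)⁻¹) * ((Complex.I * T) * ∫ s, g s * Complex.exp (Complex.I * ((s * T : ℝ) : ℂ))) = 
         - ∫ s, g s * Complex.exp (Complex.I * ((s * T : ℝ) : ℂ)) := by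
        rw [← mul_assoc]
        have : Complex.I * (T:ℂ)⁻¹ * (Complex.I * T) = Complex.I * Complex.I := by field_simp
        rw [this, Complex.I_mul_I]; ring
      rw [e2] at this
      linear_combination this
    rw [e5, e3, pow_succ, pow_succ]
    rw [mul_inv]; ring

section Abstract

variable {V : Type*} [NormedCommRing V] [NormedAlgebra ℝ V] [FiniteDimensional ℝ V]
variable {E : Type*} [NormedAddCommGroup E] [NormedSpace ℝ E] [FiniteDimensional ℝ E]
  [MeasurableSpace E] [BorelSpace E]

theorem joint_bound (f : V × E → ℂ) (hf : ContDiff ℝ ∞ f) (p0 : V) (ε δ : ℝ) (N : ℕ) :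
    ∃ C : ℝ, 0 ≤ C ∧ ∀ p : V, ‖p - p0‖ ≤ ε → ∀ z : E, ‖z‖ ≤ δ → ∀ j ≤ N, 
      ‖iteratedFDeriv ℝ j (fun z => f (p, z)) z‖ ≤ C := by
  have hK : IsCompact (Metric.closedBall p0 ε ×ˢ Metric.closedBall (0:E) δ) := by
    have : ProperSpace V := FiniteDimensional.proper ℝ V
    have : ProperSpace E := FiniteDimensional.proper ℝ E
    exact (isCompact_closedBall _ _).prod (isCompact_closedBall _ _)
  have h1 : ∀ j : ℕ, ∃ c : ℝ, ∀ x ∈ Metric.closedBall p0 ε ×ˢ Metric.closedBall (0:E) δ, ‖iteratedFDeriv ℝ j f x‖ ≤ c := fun j =>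
    hK.exists_bound_of_continuousOn (hf.continuous_iteratedFDeriv (by exact_mod_cast le_top)).continuousOn
  choose c hc using h1
  refine ⟨∑ j ∈ Finset.range (N+1), |c j|, Finset.sum_nonneg fun _ _ => abs_nonneg _, ?_⟩
  intro p hp z hz j hj
  have e : (fun z => f (p, z)) = (fun y => f ((p, 0) + y)) ∘ (ContinuousLinearMap.inr ℝ V E) := by
    ext z; simp
  have hf' : ContDiff ℝ ∞ (fun y => f ((p, 0) + y)) := hf.comp (contDiff_const.add contDiff_id)
  rw [e, ContinuousLinearMap.iteratedFDeriv_comp_right _ hf' z (by exact_mod_cast le_top)]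
  refine (ContinuousMultilinearMap.norm_compContinuousLinearMap_le _ _).trans ?_
  rw [Finset.prod_const, iteratedFDeriv_comp_add_left]
  have h2 : ‖ContinuousLinearMap.inr ℝ V E‖ ^ (Finset.univ : Finset (Fin j)).card ≤ 1 := 
    pow_le_one₀ (norm_nonneg _) (ContinuousLinearMap.norm_inr_le_one ℝ V E)
  have h3 := hc j ((p,0) + (ContinuousLinearMap.inr ℝ V E) z) (by simp [dist_eq_norm, hp, hz])
  have h4 : |c j| ≤ ∑ j ∈ Finset.range (N+1), |c j| := Finset.single_le_sum (f := fun j => |c j|) (fun _ _ => abs_nonneg _) (Finset.mem_range.2 (by omega))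
  calc _ ≤ ‖iteratedFDeriv ℝ j f ((p,0) + (ContinuousLinearMap.inr ℝ V E) z)‖ * 1 := by gcongr
    _ ≤ _ := by rw [mul_one]; exact h3.trans ((le_abs_self _).trans h4)

theorem mul_supp_bound (N : ℕ) (a f : E → ℂ) (B B' δ : ℝ) (ha : ContDiff ℝ ∞ a) (hf : ContDiff ℝ ∞ f)
    (hB' : 0 ≤ B') (ha0 : ∀ z, δ < ‖z‖ → a z = 0)
    (h1 : ∀ j ≤ N, ∀ z, ‖iteratedFDeriv ℝ j a z‖ ≤ B) (h2 : ∀ z, ‖z‖ ≤ δ → ∀ j ≤ N, ‖iteratedFDeriv ℝ j f z‖ ≤ B') :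
    ∀ j ≤ N, ∀ z, ‖iteratedFDeriv ℝ j (fun z => a z * f z) z‖ ≤ 2 ^ N * (B * B') := by
  intro j hj z
  have hB : 0 ≤ B := (norm_nonneg _).trans (h1 0 (Nat.zero_le _) 0)
  rcases le_or_gt ‖z‖ δ with hz | hz
  · exact mul_deriv_bound N a f B B' ha hf hB hB' z (fun j hj => h1 j hj z) (h2 z hz) j hj
  · have hs : tsupport (fun z => a z * f z) ⊆ Metric.closedBall 0 δ := by
      refine closure_minimal ?_ Metric.isClosed_closedBall
      intro y hy
      rw [mem_closedBall_zero_iff]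
      by_contra! h
      exact hy (by simp [ha0 y h])
    have h3 : iteratedFDeriv ℝ j (fun z => a z * f z) z = 0 := by
      by_contra h
      have := hs (support_iteratedFDeriv_subset (𝕜 := ℝ) j h)
      rw [mem_closedBall_zero_iff] at this
      linarith
    rw [h3, norm_zero]; positivity

theorem osc_nonstat (μ : Measure E) [μ.IsAddHaarMeasure] (tr : V →L[ℝ] ℝ) (A : E →L[ℝ] V) 
    (k : ℕ) (p0 : V) (w : E) (hw : tr (p0 * A w) ≠ 0) :
    ∃ (δ ε C : ℝ) (N : ℕ), 0 < δ ∧ 0 < ε ∧ 0 ≤ C ∧ ∀ (p : V) (a : E → ℂ) (B : ℝ) (g : ℝ → ℂ) (G l : ℝ),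
      ‖p - p0‖ < ε → 1 ≤ l → ContDiff ℝ ∞ a → (∀ z, δ < ‖z‖ → a z = 0) → 
      (∀ j ≤ N, ∀ z, ‖iteratedFDeriv ℝ j a z‖ ≤ B) → ContDiff ℝ ∞ g → (∀ σ, σ ∉ Set.Icc (1/2:ℝ) 2 → g σ = 0) →
      ∫ σ, ‖g σ‖ ≤ G → ∫ σ, ‖iteratedDeriv k g σ‖ ≤ G →
      ‖∫ σ, g σ * ∫ z, a z * Complex.exp (Complex.I * ((tr (((l * σ) • p) * NormedSpace.exp (A z)) : ℝ) : ℂ)) ∂μ‖ 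
        ≤ C * B * G * l ^ (-(k + (Module.finrank ℝ E : ℝ) / 2)) := by
  have : CompleteSpace V := FiniteDimensional.complete ℝ V
  set m := Module.finrank ℝ E with hm
  set c := |tr (p0 * A w)| / 2 with hc
  have hc0 : 0 < c := by have := abs_pos.2 hw; positivity
  have hw0 : w ≠ 0 := by rintro rfl; simp at hw
  have hcont : Continuous (fun x : V × E => |tr (x.1 * NormedSpace.exp (A x.2) * A w)|) :=
    (tr.continuous.comp ((continuous_fst.mul (contDiff_exp'.continuous.comp (A.continuous.comp continuous_snd))).mul continuous_const)).abs
  have h2 : ∀ᶠ x : V × E in 𝓝 (p0, (0:E)), c < |tr (x.1 * NormedSpace.exp (A x.2) * A w)| := by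
    refine (hcont.tendsto (p0, (0:E))).eventually (lt_mem_nhds ?_)
    have := abs_pos.2 hw
    simp only [map_zero, NormedSpace.exp_zero, mul_one, hc]
    linarith
  rw [Metric.eventually_nhds_iff] at h2
  obtain ⟨r, hr, h2⟩ := h2
  obtain ⟨Cn, hCn, hns⟩ := nonstat μ tr A w hw0 (r/4) (by positivity) (k+m) ((‖p0‖ + r)/c) (by positivity)
  refine ⟨r/4, r, Cn * 2^(k+m) / c^(k+m), k+m, by positivity, by positivity, by positivity, ?_⟩
  intro p a B g G l hp hl ha ha0 haB hg hg0 hG _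
  have hB : 0 ≤ B := (norm_nonneg _).trans (haB 0 (Nat.zero_le _) 0)
  have hl0 : 0 < l := by linarith
  have hgc : HasCompactSupport g := HasCompactSupport.intro isCompact_Icc hg0
  set D := Cn * 2^(k+m) / c^(k+m) * B * l ^ (-(k + (m : ℝ) / 2)) with hD
  have hpt : ∀ σ, ‖g σ * ∫ z, a z * Complex.exp (Complex.I * ((tr (((l * σ) • p) * NormedSpace.exp (A z)) : ℝ) : ℂ)) ∂μ‖ ≤ ‖g σ‖ * D := by
    intro σ
    by_cases hσ : σ ∈ Set.Icc (1/2:ℝ) 2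
    · rw [norm_mul]
      gcongr
      have hσ0 : 0 < σ := by have := hσ.1; linarith
      refine (hns a B (l * σ * c) ((l * σ) • p) (by positivity) ha ha0 haB ?_ ?_).trans ?_
      · rw [norm_smul, Real.norm_eq_abs, abs_of_pos (by positivity)]
        have h5 := norm_add_le (p - p0) p0
        rw [sub_add_cancel] at h5
        calc l * σ * ‖p‖ ≤ l * σ * (‖p0‖ + r) := by gcongr; linarith
          _ = _ := by field_simp
      · intro z hz
        rw [smul_mul_assoc, smul_mul_assoc, map_smul, smul_eq_mul, abs_mul, abs_of_pos (by positivity : 0 < l * σ)]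
        gcongr
        refine (h2 (y := (p, z)) ?_).le
        rw [Prod.dist_eq, max_lt_iff]
        constructor
        · simp only; rwa [dist_eq_norm]
        · simp only; rw [dist_zero_right]; linarith
      · have h3 : (l * (1/2) * c)^(k+m) ≤ (l * σ * c)^(k+m) := by
          gcongr; exact hσ.1
        calc Cn * B / (l * σ * c)^(k+m) ≤ Cn * B / (l * (1/2) * c)^(k+m) := by gcongr
          _ = Cn * 2^(k+m) / c^(k+m) * B * l ^ (-((k+m : ℕ) : ℝ)) := by
              rw [Real.rpow_neg hl0.le, Real.rpow_natCast, mul_pow, mul_pow, one_div, inv_pow]; field_simp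
          _ ≤ D := by
              rw [hD]
              gcongr
              · push_cast; have : (0:ℝ) ≤ m := by positivity
                linarith
    · rw [hg0 σ hσ]; simp
  refine (norm_integral_le_of_norm_le ?_ (Eventually.of_forall hpt)).trans ?_
  · exact ((hg.continuous.integrable_of_hasCompactSupport hgc).norm).mul_const _
  · rw [integral_mul_const]
    calc (∫ σ, ‖g σ‖) * D ≤ G * D := by gcongr
      _ = _ := by rw [hD]; ring

theorem osc_stat (μ : Measure E) [μ.IsAddHaarMeasure] (tr : V →L[ℝ] ℝ) (A : E →L[ℝ] V) (hA : Function.Injective A)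
    (hAr : ∀ v, tr v = 0 → ∃ z, A z = v) (hA0 : ∀ z, tr (A z) = 0)
    (hnd : ∀ p, (∀ v, tr (p * v) = 0) → p = 0) (h1 : tr 1 ≠ 0)
    (k : ℕ) (p0 : V) (c0 : ℝ) (hc0 : c0 ≠ 0) (hp0 : p0 = c0 • (1:V)) :
    ∃ (δ ε C : ℝ) (N : ℕ), 0 < δ ∧ 0 < ε ∧ 0 ≤ C ∧ ∀ (p : V) (a : E → ℂ) (B : ℝ) (g : ℝ → ℂ) (G l : ℝ),
      ‖p - p0‖ < ε → 1 ≤ l → ContDiff ℝ ∞ a → (∀ z, δ < ‖z‖ → a z = 0) → 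
      (∀ j ≤ N, ∀ z, ‖iteratedFDeriv ℝ j a z‖ ≤ B) → ContDiff ℝ ∞ g → (∀ σ, σ ∉ Set.Icc (1/2:ℝ) 2 → g σ = 0) →
      ∫ σ, ‖g σ‖ ≤ G → ∫ σ, ‖iteratedDeriv k g σ‖ ≤ G →
      ‖∫ σ, g σ * ∫ z, a z * Complex.exp (Complex.I * ((tr (((l * σ) • p) * NormedSpace.exp (A z)) : ℝ) : ℂ)) ∂μ‖ 
        ≤ C * B * G * l ^ (-(k + (Module.finrank ℝ E : ℝ) / 2)) := by
  have : CompleteSpace V := FiniteDimensional.complete ℝ V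
  obtain ⟨δ1, ε1, C1, hδ1, hε1, hC1, hst⟩ := stat μ tr A hA hAr hA0 hnd h1 c0 hc0
  set m := Module.finrank ℝ E with hm
  have htr : tr p0 ≠ 0 := by rw [hp0, map_smul, smul_eq_mul]; exact mul_ne_zero hc0 h1
  set c := |tr p0| / 2 with hc
  have hc0 : 0 < c := by have := abs_pos.2 htr; positivity
  have hexpc : Continuous (fun z : E => NormedSpace.exp (A z)) := contDiff_exp'.continuous.comp A.continuous
  have hcont : Continuous (fun x : V × E => |tr (x.1 * NormedSpace.exp (A x.2))|) :=
    (tr.continuous.comp ((continuous_fst.mul (contDiff_exp'.continuous.comp (A.continuous.comp continuous_snd))))).abs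
  have h2 : ∀ᶠ x : V × E in 𝓝 (p0, (0:E)), c < |tr (x.1 * NormedSpace.exp (A x.2))| := by
    refine (hcont.tendsto (p0, (0:E))).eventually (lt_mem_nhds ?_)
    have := abs_pos.2 htr
    simp only [map_zero, NormedSpace.exp_zero, mul_one, hc]
    linarith
  rw [Metric.eventually_nhds_iff] at h2
  obtain ⟨r, hr, h2⟩ := h2
  obtain ⟨h, hh, hhk⟩ := exists_inv_pow k c hc0
  set f : V × E → ℂ := fun x => h (tr (x.1 * NormedSpace.exp (A x.2))) with hf
  have hfs : ContDiff ℝ ∞ f := hh.comp (tr.contDiff.comp (contDiff_fst.mul (contDiff_exp'.comp (A.contDiff.comp contDiff_snd))))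
  set δ := min δ1 (r/2) with hδ
  obtain ⟨Cf, hCf, hfb⟩ := joint_bound f hfs p0 r δ (m+1)
  refine ⟨δ, min ε1 r, √(C1 * 2^m) * (2^(m+1) * Cf), m+1, by positivity, by positivity, by positivity, ?_⟩
  intro p a B g G l hp hl ha ha0 haB hg hg0 _ hG
  have hB : 0 ≤ B := (norm_nonneg _).trans (haB 0 (Nat.zero_le _) 0)
  have hl0 : 0 < l := by linarith
  have hgc : HasCompactSupport g := HasCompactSupport.intro isCompact_Icc hg0
  have hpr : ‖p - p0‖ < r := hp.trans_le (min_le_right _ _)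
  set T : E → ℝ := fun z => tr (p * NormedSpace.exp (A z)) with hT
  have hTc : Continuous T := tr.continuous.comp (continuous_const.mul hexpc)
  have hTlow : ∀ z, ‖z‖ ≤ δ → c ≤ |T z| := by
    intro z hz
    refine (h2 (y := (p, z)) ?_).le
    rw [Prod.dist_eq, max_lt_iff]
    constructor
    · simp only; rwa [dist_eq_norm]
    · simp only; rw [dist_zero_right]; have := min_le_right δ1 (r/2); rw [← hδ] at this; linarith
  set e : ℝ → E → ℂ := fun σ z => Complex.exp (Complex.I * ((tr (((l * σ) • p) * NormedSpace.exp (A z)) : ℝ) : ℂ)) with he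
  have heT : ∀ σ z, e σ z = Complex.exp (Complex.I * ((σ * (l * T z) : ℝ) : ℂ)) := by
    intro σ z
    simp only [he, hT]
    rw [smul_mul_assoc, map_smul, smul_eq_mul]
    rw [show l * σ * tr (p * NormedSpace.exp (A z)) = σ * (l * tr (p * NormedSpace.exp (A z))) by ring]
  have hec : Continuous (fun x : ℝ × E => e x.1 x.2) := by
    simp_rw [heT]
    fun_prop
  have hgk : ContDiff ℝ ∞ (iteratedDeriv k g) := by
    rw [iteratedDeriv_eq_iterate]; exact hg.iterate_deriv k
  have hgks : ∀ σ, σ ∉ Set.Icc (1/2:ℝ) 2 → iteratedDeriv k g σ = 0 := by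
    intro σ hσ
    have hs : tsupport g ⊆ Set.Icc (1/2:ℝ) 2 := by
      refine closure_minimal ?_ isClosed_Icc
      intro y hy; by_contra h; exact hy (hg0 y h)
    have h3 : iteratedFDeriv ℝ k g σ = 0 := by
      by_contra h
      exact hσ (hs (support_iteratedFDeriv_subset (𝕜 := ℝ) k h))
    rw [iteratedDeriv_eq_iteratedFDeriv, h3]; simp
  -- swap lemma
  have swap : ∀ (g : ℝ → ℂ) (a : E → ℂ), Continuous g → (∀ σ, σ ∉ Set.Icc (1/2:ℝ) 2 → g σ = 0) → Continuous a → 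
      (∀ z, δ < ‖z‖ → a z = 0) → ∫ σ, g σ * ∫ z, a z * e σ z ∂μ = ∫ z, a z * (∫ σ, g σ * e σ z) ∂μ := by
    intro g a hg hg0 ha ha0
    have e1 : ∀ σ, g σ * ∫ z, a z * e σ z ∂μ = ∫ z, g σ * (a z * e σ z) ∂μ := fun σ => by rw [integral_const_mul]
    have e2 : ∀ z, a z * ∫ σ, g σ * e σ z = ∫ σ, g σ * (a z * e σ z) := fun z => by
      rw [← integral_const_mul]; congr 1; ext σ; ring
    simp_rw [e1, e2]
    refine MeasureTheory.integral_integral_swap_of_hasCompactSupport ?_ ?_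
    · exact (hg.comp continuous_fst).mul ((ha.comp continuous_snd).mul hec)
    · refine HasCompactSupport.intro ((isCompact_Icc (a := (1/2:ℝ)) (b := 2)).prod (isCompact_closedBall (0:E) δ)) ?_
      rintro ⟨s, z⟩ hsz
      simp only [Set.mem_prod, mem_closedBall_zero_iff, not_and_or, not_le] at hsz
      simp only [Function.uncurry]
      rcases hsz with h | h
      · rw [hg0 s h, zero_mul]
      · rw [ha0 z h]; simp
  set b : E → ℂ := fun z => a z * f (p, z) with hb
  have hfp : ContDiff ℝ ∞ (fun z => f (p, z)) := hfs.comp (contDiff_const.prodMk contDiff_id)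
  have hbs : ContDiff ℝ ∞ b := ha.mul hfp
  have hb0 : ∀ z, δ < ‖z‖ → b z = 0 := fun z hz => by simp [hb, ha0 z hz]
  have hbB := mul_supp_bound (m+1) a (fun z => f (p,z)) B Cf δ ha hfp hCf ha0 haB (hfb p hpr.le)
  have main : ∫ σ, g σ * ∫ z, a z * e σ z ∂μ = (Complex.I)^k * ((l:ℂ)^k)⁻¹ * ∫ σ, iteratedDeriv k g σ * ∫ z, b z * e σ z ∂μ := by
    rw [swap g a hg.continuous hg0 ha.continuous ha0, swap _ b hgk.continuous hgks hbs.continuous hb0, ← integral_const_mul]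
    congr 1; ext z
    rcases le_or_gt ‖z‖ δ with hz | hz
    · have hTz := hTlow z hz
      have hTz0 : T z ≠ 0 := by intro h; rw [h, abs_zero] at hTz; linarith
      simp_rw [heT]
      rw [ibp_exp k g (l * T z) (mul_ne_zero hl0.ne' hTz0) hg hgc]
      simp only [hb, hf]
      rw [hhk _ hTz]
      push_cast
      rw [mul_pow, mul_inv]; ring
    · rw [ha0 z hz, hb0 z hz]; simp
  change ‖∫ σ, g σ * ∫ z, a z * e σ z ∂μ‖ ≤ _
  rw [main, norm_mul, norm_mul, norm_pow, Complex.norm_I, one_pow, one_mul, norm_inv, norm_pow, Complex.norm_real, Real.norm_eq_abs, abs_of_pos hl0]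
  set D := √(C1 * 2^m) * (2^(m+1) * (B * Cf)) * l ^ (-((m : ℝ) / 2)) with hD
  have hpt : ∀ σ, ‖iteratedDeriv k g σ * ∫ z, b z * e σ z ∂μ‖ ≤ ‖iteratedDeriv k g σ‖ * D := by
    intro σ
    by_cases hσ : σ ∈ Set.Icc (1/2:ℝ) 2
    · rw [norm_mul]
      gcongr
      have hσ0 : 0 < σ := by have := hσ.1; linarith
      have h3 := hst p b (2^(m+1) * (B * Cf)) (l * σ) (by positivity) (by rw [← hp0]; exact (hp.trans_le (min_le_left _ _)).le)
        hbs (fun z hz => hb0 z (lt_of_le_of_lt (min_le_left _ _) hz)) hbB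
      refine le_of_sq_le_sq ?_ (by positivity)
      refine h3.trans ?_
      have h4 : (l * (1/2))^m ≤ (l * σ)^m := by gcongr; exact hσ.1
      calc _ ≤ C1 * (2^(m+1) * (B * Cf))^2 / (l * (1/2))^m := by gcongr
        _ = D^2 := by
          have q1 : √(C1 * 2^m) ^ 2 = C1 * 2^m := Real.sq_sqrt (by positivity)
          have q2 : (l ^ (-((m : ℝ) / 2))) ^ 2 = (l^m)⁻¹ := by
            rw [← Real.rpow_natCast (l ^ _), ← Real.rpow_mul hl0.le]
            have : -((m:ℝ)/2) * (2:ℕ) = -(m:ℝ) := by push_cast; ring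
            rw [this, Real.rpow_neg hl0.le, Real.rpow_natCast]
          have q3 : D^2 = √(C1 * 2^m) ^ 2 * (2^(m+1) * (B * Cf))^2 * (l ^ (-((m : ℝ) / 2))) ^ 2 := by
            rw [hD]; ring
          rw [q3, q1, q2, mul_pow l, one_div, inv_pow]
          field_simp
    · rw [hgks σ hσ]; simp
  calc _ ≤ (l^k)⁻¹ * ((∫ σ, ‖iteratedDeriv k g σ‖) * D) := by
        gcongr
        refine (norm_integral_le_of_norm_le ?_ (Eventually.of_forall hpt)).trans (le_of_eq (integral_mul_const _ _))
        exact ((hgk.continuous.integrable_of_hasCompactSupport (HasCompactSupport.intro isCompact_Icc hgks)).norm).mul_const _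
    _ ≤ (l^k)⁻¹ * (G * D) := by gcongr
    _ = _ := by
      rw [hD, neg_add, Real.rpow_add hl0, Real.rpow_neg hl0.le (k:ℝ), Real.rpow_natCast]; ring

theorem osc_main (μ : Measure E) [μ.IsAddHaarMeasure] (tr : V →L[ℝ] ℝ) (A : E →L[ℝ] V) (hA : Function.Injective A)
    (hAr : ∀ v, tr v = 0 → ∃ z, A z = v) (hA0 : ∀ z, tr (A z) = 0)
    (hnd : ∀ p, (∀ v, tr (p * v) = 0) → p = 0) (h1 : tr 1 ≠ 0) (k : ℕ) :
    ∃ (δ C : ℝ) (N : ℕ), 0 < δ ∧ 0 ≤ C ∧ ∀ (p : V) (a : E → ℂ) (B : ℝ) (g : ℝ → ℂ) (G l : ℝ),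
      ‖p‖ = 1 → 1 ≤ l → ContDiff ℝ ∞ a → (∀ z, δ < ‖z‖ → a z = 0) → 
      (∀ j ≤ N, ∀ z, ‖iteratedFDeriv ℝ j a z‖ ≤ B) → ContDiff ℝ ∞ g → (∀ σ, σ ∉ Set.Icc (1/2:ℝ) 2 → g σ = 0) →
      ∫ σ, ‖g σ‖ ≤ G → ∫ σ, ‖iteratedDeriv k g σ‖ ≤ G →
      ‖∫ σ, g σ * ∫ z, a z * Complex.exp (Complex.I * ((tr (((l * σ) • p) * NormedSpace.exp (A z)) : ℝ) : ℂ)) ∂μ‖ 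
        ≤ C * B * G * l ^ (-(k + (Module.finrank ℝ E : ℝ) / 2)) := by
  let Good : Set V → Prop := fun s => ∃ (δ C : ℝ) (N : ℕ), 0 < δ ∧ 0 ≤ C ∧ ∀ (p : V) (a : E → ℂ) (B : ℝ) (g : ℝ → ℂ) (G l : ℝ),
      p ∈ s → 1 ≤ l → ContDiff ℝ ∞ a → (∀ z, δ < ‖z‖ → a z = 0) → 
      (∀ j ≤ N, ∀ z, ‖iteratedFDeriv ℝ j a z‖ ≤ B) → ContDiff ℝ ∞ g → (∀ σ, σ ∉ Set.Icc (1/2:ℝ) 2 → g σ = 0) →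
      ∫ σ, ‖g σ‖ ≤ G → ∫ σ, ‖iteratedDeriv k g σ‖ ≤ G →
      ‖∫ σ, g σ * ∫ z, a z * Complex.exp (Complex.I * ((tr (((l * σ) • p) * NormedSpace.exp (A z)) : ℝ) : ℂ)) ∂μ‖ 
        ≤ C * B * G * l ^ (-(k + (Module.finrank ℝ E : ℝ) / 2))
  have hprop : ProperSpace V := FiniteDimensional.proper ℝ V
  have main : Good (Metric.sphere (0:V) 1) := by
    refine (isCompact_sphere (0:V) 1).induction_on (p := Good) ?_ ?_ ?_ ?_
    · exact ⟨1, 0, 0, one_pos, le_rfl, fun p a B g G l hp => by simp at hp⟩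
    · rintro s t hst ⟨δ, C, N, hδ, hC, h⟩
      exact ⟨δ, C, N, hδ, hC, fun p a B g G l hp => h p a B g G l (hst hp)⟩
    · rintro s t ⟨δ, C, N, hδ, hC, h⟩ ⟨δ', C', N', hδ', hC', h'⟩
      refine ⟨min δ δ', C + C', max N N', by positivity, by positivity, ?_⟩
      intro p a B g G l hp hl ha ha0 haB hg hg0 hG1 hG2
      have hB : 0 ≤ B := (norm_nonneg _).trans (haB 0 (Nat.zero_le _) 0)
      have hG : 0 ≤ G := (integral_nonneg fun _ => norm_nonneg _).trans hG1
      have hl0 : 0 < l := by linarith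
      rcases hp with hp | hp
      · refine (h p a B g G l hp hl ha (fun z hz => ha0 z (lt_of_le_of_lt (min_le_left _ _) hz)) (fun j hj => haB j (hj.trans (le_max_left _ _))) hg hg0 hG1 hG2).trans ?_
        gcongr
        linarith
      · refine (h' p a B g G l hp hl ha (fun z hz => ha0 z (lt_of_le_of_lt (min_le_right _ _) hz)) (fun j hj => haB j (hj.trans (le_max_right _ _))) hg hg0 hG1 hG2).trans ?_
        gcongr
        linarith
    · intro p0 hp0
      have hp0' : p0 ≠ 0 := by rintro rfl; simp at hp0
      by_cases hw : ∃ w, tr (p0 * A w) ≠ 0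
      · obtain ⟨w, hw⟩ := hw
        obtain ⟨δ, ε, C, N, hδ, hε, hC, h⟩ := osc_nonstat μ tr A k p0 w hw
        refine ⟨Metric.ball p0 ε, mem_nhdsWithin_of_mem_nhds (Metric.ball_mem_nhds _ hε), δ, C, N, hδ, hC, ?_⟩
        intro p a B g G l hp
        exact h p a B g G l (by rwa [mem_ball_iff_norm] at hp)
      · push Not at hw
        have e : p0 = (tr p0 / tr 1) • (1:V) := by
          rw [← sub_eq_zero]
          refine hnd _ fun v => ?_
          obtain ⟨w, hw'⟩ := hAr (v - (tr v / tr 1) • 1) (by simp [h1])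
          have hv : v = A w + (tr v / tr 1) • 1 := by rw [hw']; abel
          rw [hv, mul_add, map_add, sub_mul, map_sub, hw]
          simp [hA0, h1]
        have hc0 : tr p0 / tr 1 ≠ 0 := by
          intro h; rw [h, zero_smul] at e; exact hp0' e
        obtain ⟨δ, ε, C, N, hδ, hε, hC, h⟩ := osc_stat μ tr A hA hAr hA0 hnd h1 k p0 _ hc0 e
        refine ⟨Metric.ball p0 ε, mem_nhdsWithin_of_mem_nhds (Metric.ball_mem_nhds _ hε), δ, C, N, hδ, hC, ?_⟩
        intro p a B g G l hp
        exact h p a B g G l (by rwa [mem_ball_iff_norm] at hp)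
  obtain ⟨δ, C, N, hδ, hC, h⟩ := main
  exact ⟨δ, C, N, hδ, hC, fun p a B g G l hp => h p a B g G l (by simpa using hp)⟩

end Abstract
end HFull


open Filter Topology MeasureTheory
open scoped BigOperators ContDiff

namespace HFull

set_option linter.unusedSectionVars false
set_option linter.style.haveILetI false

theorem gbound (k : ℕ) (χ : ℝ → ℂ) (hχ : ContDiff ℝ ∞ χ) (hχc : HasCompactSupport χ) :
    ∃ C : ℝ, 0 ≤ C ∧ ∀ (M : ℝ) (γ : ℝ → ℂ) (Q : ℝ), 1/8 ≤ M → M ≤ 4 → ContDiff ℝ ∞ γ →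
      HasCompactSupport γ → (∀ i ≤ k, ∫ t, ‖iteratedDeriv i γ t‖ ≤ Q) →
      ∀ j ≤ k, ∫ σ, ‖iteratedDeriv j (fun σ => χ σ * γ (M * σ)) σ‖ ≤ C * Q := by
  have hb : ∀ i : ℕ, ∃ B, ∀ x, ‖iteratedDeriv i χ x‖ ≤ B := by
    intro i
    refine Continuous.bounded_above_of_compact_support (hχ.continuous_iteratedDeriv i (by exact_mod_cast le_top)) ?_
    rw [iteratedDeriv_eq_iterate]
    clear hχ
    induction i with
    | zero => simpa
    | succ i ih => rw [Function.iterate_succ']; exact ih.deriv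
  choose B hB using hb
  have hB0 : ∀ i, 0 ≤ B i := fun i => (norm_nonneg _).trans (hB i 0)
  refine ⟨∑ j ∈ Finset.range (k+1), ∑ i ∈ Finset.range (j+1), (j.choose i : ℝ) * B i * 4^(j-i) * 8, ?_, ?_⟩
  · refine Finset.sum_nonneg fun j _ => Finset.sum_nonneg fun i _ => ?_
    have := hB0 i
    positivity
  intro M γ Q hM hM' hγ hγc hQ j hj
  have hM0 : 0 < M := by linarith
  have hQ0 : 0 ≤ Q := (integral_nonneg fun _ => norm_nonneg _).trans (hQ 0 (Nat.zero_le _))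
  have hcs : ∀ i, HasCompactSupport (iteratedDeriv i γ) := by
    intro i
    rw [iteratedDeriv_eq_iterate]
    clear hγ hQ
    induction i with
    | zero => simpa
    | succ i ih => rw [Function.iterate_succ']; exact ih.deriv
  have hint : ∀ i, Integrable (fun σ => ‖iteratedDeriv i γ (M * σ)‖) := by
    intro i
    have : Integrable (fun σ => ‖iteratedDeriv i γ σ‖) :=
      ((hγ.continuous_iteratedDeriv i (by exact_mod_cast le_top)).integrable_of_hasCompactSupport (hcs i)).norm
    exact this.comp_mul_left' hM0.ne'
  have hsc : ∀ i ≤ k, ∫ σ, ‖iteratedDeriv i γ (M * σ)‖ ≤ 8 * Q := by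
    intro i hi
    rw [Measure.integral_comp_mul_left (fun σ => ‖iteratedDeriv i γ σ‖) M, abs_of_pos (inv_pos.mpr hM0), smul_eq_mul]
    have : M⁻¹ ≤ 8 := by
      rw [inv_le_comm₀ hM0 (by norm_num)]; linarith
    exact mul_le_mul this (hQ i hi) (integral_nonneg fun _ => norm_nonneg _) (by norm_num)
  have hγM : ContDiff ℝ ∞ (fun σ => γ (M * σ)) := hγ.comp (contDiff_const.mul contDiff_id)
  have e : ∀ σ, ‖iteratedDeriv j (fun σ => χ σ * γ (M * σ)) σ‖ ≤
      ∑ i ∈ Finset.range (j+1), ((j.choose i : ℝ) * B i * 4^(j-i)) * ‖iteratedDeriv (j-i) γ (M * σ)‖ := by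
    intro σ
    have := iteratedDeriv_mul (n := j) (x := σ) (f := χ) (g := fun σ => γ (M * σ)) 
      (hχ.contDiffAt.of_le (by exact_mod_cast le_top)) (hγM.contDiffAt.of_le (by exact_mod_cast le_top))
    change iteratedDeriv j (fun σ => χ σ * γ (M * σ)) σ = _ at this
    rw [this]
    refine (norm_sum_le _ _).trans (Finset.sum_le_sum fun i _ => ?_)
    rw [iteratedDeriv_comp_const_smul (contDiff_infty.mp hγ (j-i)) M]
    simp only [norm_mul, norm_smul, norm_pow, Real.norm_eq_abs, abs_of_pos hM0]
    have h1 : ‖((j.choose i : ℕ) : ℂ)‖ = (j.choose i : ℝ) := by simp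
    rw [h1]
    have := hB i σ
    have := hB0 i
    rw [← mul_assoc]
    gcongr
  have e2 := integral_mono_of_nonneg (μ := volume) (Eventually.of_forall fun σ => norm_nonneg _) 
    (integrable_finsetSum _ fun i _ => ((hint (j-i)).const_mul ((j.choose i : ℝ) * B i * 4^(j-i)))) (Eventually.of_forall e)
  refine e2.trans ?_
  rw [integral_finsetSum _ fun i _ => ((hint (j-i)).const_mul ((j.choose i : ℝ) * B i * 4^(j-i)))]
  have e3 : ∑ i ∈ Finset.range (j+1), ∫ σ, ((j.choose i : ℝ) * B i * 4^(j-i)) * ‖iteratedDeriv (j-i) γ (M * σ)‖ ≤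
      (∑ i ∈ Finset.range (j+1), (j.choose i : ℝ) * B i * 4^(j-i) * 8) * Q := by
    rw [Finset.sum_mul]
    refine Finset.sum_le_sum fun i _ => ?_
    rw [integral_const_mul, mul_assoc _ 8 Q]
    have := hB0 i
    exact mul_le_mul_of_nonneg_left (hsc _ (by omega)) (by positivity)
  refine e3.trans (mul_le_mul_of_nonneg_right ?_ hQ0)
  refine Finset.single_le_sum (f := fun j => ∑ i ∈ Finset.range (j+1), (j.choose i : ℝ) * B i * 4^(j-i) * 8) (fun j _ => Finset.sum_nonneg fun i _ => ?_) (Finset.mem_range.mpr (by omega))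
  have := hB0 i
  positivity

end HFull


open Filter Topology MeasureTheory
open scoped BigOperators ContDiff

namespace HFull

set_option linter.unusedSectionVars false
set_option linter.style.haveILetI false

section Abstract
variable {V : Type*} [NormedCommRing V] [NormedAlgebra ℝ V] [FiniteDimensional ℝ V]
  [MeasurableSpace V] [BorelSpace V]
variable {E : Type*} [NormedAddCommGroup E] [NormedSpace ℝ E] [FiniteDimensional ℝ E] [MeasurableSpace E] [BorelSpace E]

theorem unit_lower (Kc : Set V) (hK : IsCompact Kc) (hu : ∀ y ∈ Kc, IsUnit y) :
    ∃ c : ℝ, 0 < c ∧ ∀ y ∈ Kc, ∀ ξ : V, c * ‖ξ‖ ≤ ‖ξ * y‖ := by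
  haveI : CompleteSpace V := FiniteDimensional.complete ℝ V
  have hc : ContinuousOn (fun y : V => Ring.inverse y) Kc := by
    intro y hy
    obtain ⟨u, rfl⟩ := hu y hy
    exact (NormedRing.inverse_continuousAt u).continuousWithinAt
  obtain ⟨C, hC⟩ := hK.exists_bound_of_continuousOn hc
  refine ⟨(|C| + 1)⁻¹, by positivity, fun y hy ξ => ?_⟩
  have h1 : ξ = (ξ * y) * Ring.inverse y := by
    rw [mul_assoc, Ring.mul_inverse_cancel _ (hu y hy), mul_one]
  have h2 : ‖ξ‖ ≤ ‖ξ * y‖ * (|C| + 1) := by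
    calc ‖ξ‖ = ‖(ξ * y) * Ring.inverse y‖ := by rw [← h1]
      _ ≤ ‖ξ * y‖ * ‖Ring.inverse y‖ := norm_mul_le _ _
      _ ≤ ‖ξ * y‖ * (|C| + 1) := by
        gcongr
        have := hC y hy
        have := le_abs_self C
        linarith
  rw [inv_mul_le_iff₀ (by positivity)]
  linarith

set_option maxHeartbeats 1600000 in
theorem decay (ν : Measure V) [ν.IsAddHaarMeasure] (μ : Measure E) [μ.IsAddHaarMeasure]
    (tr : V →L[ℝ] ℝ) (A : E →L[ℝ] V) (hA : Function.Injective A)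
    (hAr : ∀ v, tr v = 0 → ∃ z, A z = v) (hA0 : ∀ z, tr (A z) = 0)
    (hnd : ∀ p, (∀ v, tr (p * v) = 0) → p = 0) (h1 : tr 1 ≠ 0)
    (hmp : ∀ z : E, MeasurePreserving (fun y => NormedSpace.exp (A z) * y) ν ν)
    (M : V → ℝ) (hM : ∀ (σ : ℝ) (z : E) (y : V), 0 < σ → M ((σ • NormedSpace.exp (A z)) * y) = σ * M y)
    (φ : V → ℂ) (hφ : ∀ (σ : ℝ) (z : E) (y : V), 0 < σ → φ ((σ • NormedSpace.exp (A z)) * y) = φ (NormedSpace.exp (A z) * y))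
    (hφs : ∀ y, M y ≠ 0 → ContDiff ℝ ∞ (fun z : E => φ (NormedSpace.exp (A z) * y)))
    (hφb : ∀ N : ℕ, ∃ D : ℝ, ∀ y, M y ≠ 0 → ∀ j ≤ N, ∀ z, ‖iteratedFDeriv ℝ j (fun z : E => φ (NormedSpace.exp (A z) * y)) z‖ ≤ D)
    (Kc : Set V) (hK : IsCompact Kc) (hu : ∀ y ∈ Kc, IsUnit y)
    (hKφ : ∀ y, φ y ≠ 0 → M y ∈ Set.Icc (1/4 : ℝ) 2 → y ∈ Kc) (k : ℕ) :
    ∃ (C c : ℝ), 0 ≤ C ∧ 0 < c ∧ ∀ (γ : ℝ → ℂ) (Q : ℝ) (ξ : V), ContDiff ℝ ∞ γ →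
      (∀ t, t ∉ Set.Icc (1/4 : ℝ) 2 → γ t = 0) → Continuous (fun y => φ y * γ (M y)) →
      (∀ i ≤ k, ∫ t, ‖iteratedDeriv i γ t‖ ≤ Q) → 1 ≤ c * ‖ξ‖ →
      ‖∫ y, (φ y * γ (M y)) * Complex.exp (Complex.I * ((tr (ξ * y) : ℝ) : ℂ)) ∂ν‖ 
        ≤ C * Q * ‖ξ‖ ^ (-(k + (Module.finrank ℝ E : ℝ) / 2)) := by
  haveI : CompleteSpace V := FiniteDimensional.complete ℝ V
  haveI : ProperSpace V := FiniteDimensional.proper ℝ V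
  haveI : ProperSpace E := FiniteDimensional.proper ℝ E
  haveI : SecondCountableTopology V := secondCountable_of_proper
  haveI : SecondCountableTopology E := secondCountable_of_proper
  obtain ⟨δ, C0, N, hδ, hC0, hosc⟩ := osc_main μ tr A hA hAr hA0 hnd h1 k
  let b0 : ContDiffBump (1 : ℝ) := ⟨1/4, 1/2, by norm_num, by norm_num⟩
  let b1 : ContDiffBump (0 : E) := ⟨δ/2, δ, by positivity, by linarith⟩
  let ψ0 : ℝ → ℂ := fun σ => ((b0.normed volume σ : ℝ) : ℂ)
  let ψ : E → ℂ := fun z => ((b1.normed μ z : ℝ) : ℂ)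
  have hpsiZs : ContDiff ℝ ∞ ψ0 := Complex.ofRealCLM.contDiff.comp b0.contDiff_normed
  have hψs : ContDiff ℝ ∞ ψ := Complex.ofRealCLM.contDiff.comp b1.contDiff_normed
  have hpsiZi : ∫ σ, ψ0 σ = 1 := by
    have := b0.integral_normed (μ := volume)
    simp only [ψ0]; rw [integral_complex_ofReal, this]; simp
  have hψi : ∫ z, ψ z ∂μ = 1 := by
    have := b1.integral_normed (μ := μ)
    simp only [ψ]; rw [integral_complex_ofReal, this]; simp
  have hpsiZz : ∀ σ, σ ∉ Set.Icc (1/2:ℝ) 2 → ψ0 σ = 0 := by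
    intro σ hσ
    have : b0.normed volume σ = 0 := by
      rw [← Function.notMem_support, b0.support_normed_eq]
      intro h
      rw [Metric.mem_ball, Real.dist_eq, abs_lt] at h
      apply hσ
      simp only [b0] at h
      constructor <;> linarith [h.1, h.2]
    simp [ψ0, this]
  have hψz : ∀ z, δ < ‖z‖ → ψ z = 0 := by
    intro z hz
    have : b1.normed μ z = 0 := by
      rw [← Function.notMem_support, b1.support_normed_eq]
      intro h
      rw [mem_ball_zero_iff] at h
      simp only [b1] at h
      linarith
    simp [ψ, this]
  set n := Module.finrank ℝ V with hn
  let χ : ℝ → ℂ := fun σ => ψ0 σ * (σ:ℂ) ^ n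
  have hχs : ContDiff ℝ ∞ χ := hpsiZs.mul (Complex.ofRealCLM.contDiff.pow n)
  have hχz : ∀ σ, σ ∉ Set.Icc (1/2:ℝ) 2 → χ σ = 0 := fun σ hσ => by simp [χ, hpsiZz σ hσ]
  have hχc : HasCompactSupport χ := HasCompactSupport.intro isCompact_Icc hχz
  obtain ⟨Cg, hCg0, hCg⟩ := gbound k χ hχs hχc
  have hBψ : ∃ B : ℝ, 0 ≤ B ∧ ∀ j ≤ N, ∀ z, ‖iteratedFDeriv ℝ j ψ z‖ ≤ B := by
    have : ∀ j : ℕ, ∃ B, ∀ z, ‖iteratedFDeriv ℝ j ψ z‖ ≤ B := fun j =>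
      Continuous.bounded_above_of_compact_support (hψs.continuous_iteratedFDeriv (by exact_mod_cast le_top)) 
        ((HasCompactSupport.intro (isCompact_closedBall (0:E) δ) (fun z hz => hψz z (by simpa using hz))).iteratedFDeriv j)
    choose B hB using this
    have hB0 : ∀ i, 0 ≤ B i := fun i => (norm_nonneg _).trans (hB i 0)
    exact ⟨∑ j ∈ Finset.range (N+1), B j, Finset.sum_nonneg fun i _ => hB0 i, fun j hj z => (hB j z).trans
      (Finset.single_le_sum (fun i _ => hB0 i) (Finset.mem_range.mpr (by omega)))⟩
  obtain ⟨B, hB0, hB⟩ := hBψ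
  obtain ⟨D', hD'⟩ := hφb N
  let D := |D'|
  have hD : ∀ y, M y ≠ 0 → ∀ j ≤ N, ∀ z, ‖iteratedFDeriv ℝ j (fun z : E => φ (NormedSpace.exp (A z) * y)) z‖ ≤ D :=
    fun y hy j hj z => (hD' y hy j hj z).trans (le_abs_self _)
  -- the compact set of relevant y
  let Kc' : Set V := (fun q : (ℝ × E) × V => (q.1.1⁻¹ • NormedSpace.exp (A (-q.1.2))) * q.2) '' 
    ((Set.Icc (1/2:ℝ) 2 ×ˢ Metric.closedBall (0:E) δ) ×ˢ Kc)
  have hexpc : Continuous (NormedSpace.exp : V → V) := contDiff_exp'.continuous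
  have hKc' : IsCompact Kc' := by
    refine ((isCompact_Icc.prod (isCompact_closedBall _ _)).prod hK).image_of_continuousOn ?_
    refine ContinuousOn.mul (ContinuousOn.smul ?_ ?_) continuous_snd.continuousOn
    · refine ContinuousOn.inv₀ (continuous_fst.comp continuous_fst).continuousOn ?_
      rintro q ⟨⟨⟨hq, -⟩, -⟩, -⟩ h0
      linarith
    · exact (hexpc.comp (A.continuous.comp (continuous_snd.comp continuous_fst).neg)).continuousOn
  have hexpinv : ∀ z, NormedSpace.exp (A (-z)) * NormedSpace.exp (A z) = 1 := by
    intro z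
    rw [← exp_add', ← map_add]; simp
  have hu' : ∀ y ∈ Kc', IsUnit y := by
    rintro _ ⟨⟨⟨σ, z⟩, y⟩, ⟨⟨hσ, hz⟩, hy⟩, rfl⟩
    have hσ0 : σ ≠ 0 := by have := hσ.1; simp only at this; intro h; simp only [h] at this; norm_num at this
    refine IsUnit.mul ?_ (hu y hy)
    refine IsUnit.of_mul_eq_one (σ • NormedSpace.exp (A z)) ?_
    simp only
    rw [smul_mul_smul_comm, hexpinv, inv_mul_cancel₀ hσ0, one_smul]
  have hmemK : ∀ σ z y, σ ∈ Set.Icc (1/2:ℝ) 2 → ‖z‖ ≤ δ → (σ • NormedSpace.exp (A z)) * y ∈ Kc → y ∈ Kc' := by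
    intro σ z y hσ hz hy
    have hσ0 : σ ≠ 0 := by have := hσ.1; intro h; rw [h] at this; norm_num at this
    refine ⟨((σ, z), _), ⟨⟨hσ, by simpa using hz⟩, hy⟩, ?_⟩
    simp only
    rw [← mul_assoc, smul_mul_smul_comm, hexpinv, inv_mul_cancel₀ hσ0, one_smul, one_mul]
  obtain ⟨c, hc0, hc⟩ := unit_lower Kc' hKc' hu'
  have hνK : ν Kc' < ⊤ := hKc'.measure_lt_top
  refine ⟨C0 * (2^N * (B * D)) * Cg * c ^ (-(k + (Module.finrank ℝ E : ℝ) / 2)) * ν.real Kc', c, by positivity, hc0, ?_⟩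
  intro γ Q ξ hγ hγz hGc hQ hξ
  have hγc : HasCompactSupport γ := HasCompactSupport.intro isCompact_Icc hγz
  have hQ0 : 0 ≤ Q := (integral_nonneg fun _ => norm_nonneg _).trans (hQ 0 (Nat.zero_le _))
  set F : V → ℂ := fun y => (φ y * γ (M y)) * Complex.exp (Complex.I * ((tr (ξ * y) : ℝ) : ℂ)) with hF
  have hFc : Continuous F := by
    refine hGc.mul ?_
    fun_prop
  have hFK : ∀ y, F y ≠ 0 → y ∈ Kc := by
    intro y hy
    simp only [hF, mul_ne_zero_iff] at hy
    refine hKφ y hy.1.1 ?_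
    by_contra h
    exact hy.1.2 (hγz _ h)
  have hav : ∀ (σ : ℝ) (z : E), 0 < σ → ∫ y, F y ∂ν = (σ:ℂ)^n * ∫ y, F ((σ • NormedSpace.exp (A z)) * y) ∂ν := by
    intro σ z hσ
    have e1 : ∫ y, F ((σ • NormedSpace.exp (A z)) * y) ∂ν = ∫ y, F (σ • y) ∂ν := by
      have := (hmp z).map_eq
      conv_rhs => rw [← this]
      rw [integral_map (hmp z).measurable.aemeasurable (Continuous.aestronglyMeasurable (by fun_prop))]
      simp only [smul_mul_assoc]
    rw [e1, Measure.integral_comp_smul ν F σ, abs_of_pos (by positivity), Complex.real_smul, ← mul_assoc, ← hn]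
    push_cast
    rw [mul_inv_cancel₀ (pow_ne_zero _ (by exact_mod_cast hσ.ne')), one_mul]
  let H : (ℝ × E) → V → ℂ := fun q y => (ψ0 q.1 * ψ q.2 * (q.1:ℂ)^n) * F ((q.1 • NormedSpace.exp (A q.2)) * y)
  have hHcont : Continuous (Function.uncurry H) := by
    have := hpsiZs.continuous
    have := hψs.continuous
    simp only [H, Function.uncurry_def]
    fun_prop
  have hHz : ∀ q y, H q y ≠ 0 → q.1 ∈ Set.Icc (1/2:ℝ) 2 ∧ ‖q.2‖ ≤ δ ∧ y ∈ Kc' := by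
    intro q y hq
    simp only [H, mul_ne_zero_iff] at hq
    have a1 : q.1 ∈ Set.Icc (1/2:ℝ) 2 := by by_contra h; exact hq.1.1.1 (hpsiZz _ h)
    have a2 : ‖q.2‖ ≤ δ := by by_contra h; exact hq.1.1.2 (hψz _ (not_le.mp h))
    exact ⟨a1, a2, hmemK _ _ _ a1 a2 (hFK _ hq.2)⟩
  have hHcs : HasCompactSupport (Function.uncurry H) := by
    refine HasCompactSupport.intro ((isCompact_Icc (a := (1/2:ℝ)) (b := 2)).prod (isCompact_closedBall (0:E) δ) |>.prod hKc') ?_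
    rintro ⟨q, y⟩ hq
    by_contra h
    obtain ⟨h1, h2, h3⟩ := hHz q y h
    exact hq ⟨⟨h1, by simpa using h2⟩, h3⟩
  have hswap := integral_integral_swap_of_hasCompactSupport (μ := (volume : Measure ℝ).prod μ) (ν := ν) hHcont hHcs
  have hleft : ∫ q, ∫ y, H q y ∂ν ∂((volume : Measure ℝ).prod μ) = ∫ y, F y ∂ν := by
    have : ∀ q : ℝ × E, ∫ y, H q y ∂ν = (ψ0 q.1 * ψ q.2) * ∫ y, F y ∂ν := by
      intro q
      simp only [H]
      rw [integral_const_mul]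
      by_cases hq : 0 < q.1
      · rw [hav q.1 q.2 hq]; ring
      · rw [hpsiZz q.1 (fun h => hq (by linarith [h.1]))]; simp
    simp only [this]
    rw [integral_mul_const, integral_prod_mul, hpsiZi, hψi]; simp
  rw [← hleft, hswap]
  have hinner : ∀ y, ‖∫ q, H q y ∂((volume : Measure ℝ).prod μ)‖ ≤ 
      C0 * (2^N * (B * D)) * (Cg * Q) * (c * ‖ξ‖) ^ (-(k + (Module.finrank ℝ E : ℝ) / 2)) := by
    intro y
    have hR : 0 ≤ C0 * (2^N * (B * D)) * (Cg * Q) * (c * ‖ξ‖) ^ (-(k + (Module.finrank ℝ E : ℝ) / 2)) := by positivity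
    by_cases hall : ∀ q, H q y = 0
    · simpa only [hall, integral_zero, norm_zero] using hR
    push Not at hall
    obtain ⟨q0, hq0⟩ := hall
    obtain ⟨hq1, hq2, hyK⟩ := hHz q0 y hq0
    have hMy : 1/8 ≤ M y ∧ M y ≤ 4 := by
      have h3 : γ (q0.1 * M y) ≠ 0 := by
        simp only [H, hF, mul_ne_zero_iff] at hq0
        rw [hM _ _ _ (by linarith [hq1.1])] at hq0
        exact hq0.2.1.2
      have h4 : q0.1 * M y ∈ Set.Icc (1/4:ℝ) 2 := by
        by_contra h; exact h3 (hγz _ h)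
      have := hq1.1
      have := hq1.2
      have hMp : 0 < M y := by
        by_contra h
        have : q0.1 * M y ≤ 0 := mul_nonpos_of_nonneg_of_nonpos (by linarith) (by linarith)
        linarith [h4.1]
      constructor <;> nlinarith [h4.1, h4.2]
    have hM0 : M y ≠ 0 := by linarith [hMy.1]
    set l := ‖ξ * y‖ with hl
    have hl1 : c * ‖ξ‖ ≤ l := hc y hyK ξ
    have hl0 : 0 < l := by linarith
    let p : V := l⁻¹ • (ξ * y)
    have hp : ‖p‖ = 1 := by
      simp only [p, norm_smul, norm_inv, Real.norm_eq_abs, abs_of_pos hl0]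
      exact inv_mul_cancel₀ hl0.ne'
    let g : ℝ → ℂ := fun σ => χ σ * γ (M y * σ)
    let a : E → ℂ := fun z => ψ z * φ (NormedSpace.exp (A z) * y)
    have hgs : ContDiff ℝ ∞ g := hχs.mul (hγ.comp (contDiff_const.mul contDiff_id))
    have has : ContDiff ℝ ∞ a := hψs.mul (hφs y hM0)
    have haB : ∀ j ≤ N, ∀ z, ‖iteratedFDeriv ℝ j a z‖ ≤ 2^N * (B * D) := by
      intro j hj z
      exact mul_deriv_bound N ψ (fun z => φ (NormedSpace.exp (A z) * y)) B D hψs (hφs y hM0) hB0 (abs_nonneg _) z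
        (fun i hi => hB i hi z) (fun i hi => hD y hM0 i hi z) j hj
    have hg0 := hCg (M y) γ Q hMy.1 hMy.2 hγ hγc hQ 0 (Nat.zero_le _)
    have hgk := hCg (M y) γ Q hMy.1 hMy.2 hγ hγc hQ k le_rfl
    have key := hosc p a (2^N * (B * D)) g (Cg * Q) l hp (by linarith) has (fun z hz => by simp [a, hψz z hz]) haB hgs
      (fun σ hσ => by simp [g, hχz σ hσ]) (by simpa only [iteratedDeriv_zero] using hg0) hgk
    have e : ∫ q, H q y ∂((volume : Measure ℝ).prod μ) = 
        ∫ σ, g σ * ∫ z, a z * Complex.exp (Complex.I * ((tr (((l * σ) • p) * NormedSpace.exp (A z)) : ℝ) : ℂ)) ∂μ := by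
      have hint : Integrable (fun q => H q y) ((volume : Measure ℝ).prod μ) := by
        have hcq : Continuous fun q : ℝ × E => H q y := by
          have h5 : Continuous fun q : ℝ × E => (q, y) := continuous_id.prodMk continuous_const
          have h6 := hHcont.comp h5
          exact h6
        refine Continuous.integrable_of_hasCompactSupport hcq ?_
        refine HasCompactSupport.intro ((isCompact_Icc (a := (1/2:ℝ)) (b := 2)).prod (isCompact_closedBall (0:E) δ)) ?_
        intro q hq
        by_contra h
        obtain ⟨h1, h2, h3⟩ := hHz q y h
        exact hq ⟨h1, by simpa using h2⟩
      rw [integral_prod _ hint]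
      refine integral_congr_ae (Eventually.of_forall fun σ => ?_)
      simp only
      rw [← integral_const_mul]
      refine integral_congr_ae (Eventually.of_forall fun z => ?_)
      simp only
      by_cases hσ : σ ∈ Set.Icc (1/2:ℝ) 2
      · have hσ0 : 0 < σ := by linarith [hσ.1]
        simp only [H, hF, g, χ, a, p]
        rw [hM _ _ _ hσ0, hφ _ _ _ hσ0]
        have : ξ * (σ • NormedSpace.exp (A z) * y) = ((l * σ) • l⁻¹ • (ξ * y)) * NormedSpace.exp (A z) := by
          rw [smul_smul, mul_comm l σ, mul_assoc, mul_inv_cancel₀ hl0.ne', mul_one]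
          simp only [smul_mul_assoc, mul_smul_comm]
          congr 1; ring
        rw [this, mul_comm σ (M y)]
        ring
      · simp [H, g, hχz σ hσ, hpsiZz σ hσ]
    rw [e]
    refine key.trans ?_
    refine mul_le_mul_of_nonneg_left ?_ (by positivity)
    refine Real.rpow_le_rpow_of_nonpos (by linarith) hl1 ?_
    rw [neg_nonpos]; positivity
  have hzero : ∀ y, y ∉ Kc' → ∫ q, H q y ∂((volume : Measure ℝ).prod μ) = 0 := by
    intro y hy
    have : ∀ q, H q y = 0 := fun q => by
      by_contra h; exact hy (hHz q y h).2.2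
    simp [this]
  rw [← setIntegral_eq_integral_of_forall_compl_eq_zero (s := Kc') hzero]
  refine (norm_setIntegral_le_of_norm_le_const hνK (fun y _ => hinner y)).trans (le_of_eq ?_)
  rw [Real.mul_rpow hc0.le (norm_nonneg _)]
  ring

end Abstract
end HFull


open Filter Topology MeasureTheory
open scoped BigOperators ContDiff

namespace HFull

set_option linter.unusedSectionVars false
set_option linter.style.haveILetI false

noncomputable section
section Concrete
open NumberField NumberField.InfinitePlace NumberField.mixedEmbedding Module
open scoped Classical

variable (K : Type) [Field K] [NumberField K]

/-- real part at a place -/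
def reAt (w : InfinitePlace K) : mixedSpace K →L[ℝ] ℝ :=
  if hw : IsReal w then (ContinuousLinearMap.proj ⟨w, hw⟩).comp (ContinuousLinearMap.fst ℝ _ _)
  else Complex.reCLM.comp ((ContinuousLinearMap.proj ⟨w, not_isReal_iff_isComplex.mp hw⟩).comp (ContinuousLinearMap.snd ℝ _ _))

theorem reAt_real {w : InfinitePlace K} (hw : IsReal w) (y : mixedSpace K) : reAt K w y = y.1 ⟨w, hw⟩ := by
  simp [reAt, hw]

theorem reAt_complex {w : InfinitePlace K} (hw : IsComplex w) (y : mixedSpace K) : reAt K w y = (y.2 ⟨w, hw⟩).re := by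
  simp [reAt, not_isReal_iff_isComplex.mpr hw]

def trV : mixedSpace K →L[ℝ] ℝ := ∑ w : InfinitePlace K, (mult w : ℝ) • reAt K w

theorem trV_apply (y : mixedSpace K) : trV K y = ∑ w : InfinitePlace K, (mult w : ℝ) * reAt K w y := by
  simp [trV]

theorem exp_fst (y : mixedSpace K) (w) : (NormedSpace.exp y).1 w = Real.exp (y.1 w) := by
  have := NormedSpace.map_exp ((Pi.evalRingHom (fun _ : {w : InfinitePlace K // IsReal w} => ℝ) w).comp (RingHom.fst _ ({w : InfinitePlace K // IsComplex w} → ℂ))) 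
    (by simp only [RingHom.coe_comp]; exact (continuous_apply w).comp continuous_fst) y
  simpa [Real.exp_eq_exp_ℝ] using this

theorem exp_snd (y : mixedSpace K) (w) : (NormedSpace.exp y).2 w = Complex.exp (y.2 w) := by
  have := NormedSpace.map_exp ((Pi.evalRingHom (fun _ : {w : InfinitePlace K // IsComplex w} => ℂ) w).comp (RingHom.snd ({w : InfinitePlace K // IsReal w} → ℝ) _)) 
    (by simp only [RingHom.coe_comp]; exact (continuous_apply w).comp continuous_snd) y
  simpa [Complex.exp_eq_exp_ℂ] using this

theorem normAtPlace_exp (w : InfinitePlace K) (y : mixedSpace K) : 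
    normAtPlace w (NormedSpace.exp y) = Real.exp (reAt K w y) := by
  rcases isReal_or_isComplex w with hw | hw
  · rw [normAtPlace_apply_of_isReal hw, reAt_real K hw, exp_fst]; simp
  · rw [normAtPlace_apply_of_isComplex hw, reAt_complex K hw, exp_snd, Complex.norm_exp]

theorem norm_exp (y : mixedSpace K) : mixedEmbedding.norm (NormedSpace.exp y) = Real.exp (trV K y) := by
  rw [mixedEmbedding.norm_apply, trV_apply, Real.exp_sum]
  refine Finset.prod_congr rfl fun w _ => ?_
  rw [normAtPlace_exp, ← Real.exp_nat_mul]

theorem trV_one : trV K 1 ≠ 0 := by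
  rw [trV_apply]
  have : ∀ w : InfinitePlace K, reAt K w 1 = 1 := by
    intro w
    rcases isReal_or_isComplex w with hw | hw
    · rw [reAt_real K hw]; simp
    · rw [reAt_complex K hw]; simp
  simp only [this, mul_one]
  rw [← Nat.cast_sum, sum_mult_eq]
  exact_mod_cast finrank_pos.ne'

theorem trV_nd (p : mixedSpace K) (h : ∀ v, trV K (p * v) = 0) : p = 0 := by
  have h1 := h (p.1, fun w => star (p.2 w))
  rw [trV_apply] at h1
  have h2 : ∀ w, reAt K w (p * (p.1, fun w => star (p.2 w))) = (normAtPlace w p)^2 := by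
    intro w
    rcases isReal_or_isComplex w with hw | hw
    · rw [reAt_real K hw, normAtPlace_apply_of_isReal hw]; simp [pow_two]
    · rw [reAt_complex K hw, normAtPlace_apply_of_isComplex hw]
      simp [Complex.sq_norm, Complex.normSq_apply]
  simp only [h2] at h1
  rw [Finset.sum_eq_zero_iff_of_nonneg (fun w _ => by positivity)] at h1
  rw [← forall_normAtPlace_eq_zero_iff]
  intro w
  have := h1 w (Finset.mem_univ _)
  have hm : (mult w : ℝ) ≠ 0 := by exact_mod_cast mult_ne_zero
  simpa [hm] using this

theorem abs_det_mul (x : mixedSpace K) : |LinearMap.det (LinearMap.mulLeft ℝ x)| = mixedEmbedding.norm x := by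
  have e : LinearMap.mulLeft ℝ x = LinearMap.prodMap 
      (LinearMap.pi fun w => (LinearMap.mulLeft ℝ (x.1 w)).comp (LinearMap.proj w))
      (LinearMap.pi fun w => (LinearMap.mulLeft ℝ (x.2 w)).comp (LinearMap.proj w)) := by
    ext <;> simp
  have h1 : ∀ c : ℝ, LinearMap.det (LinearMap.mulLeft ℝ c) = c := fun c => by simp
  have h2 : ∀ c : ℂ, LinearMap.det (LinearMap.mulLeft ℝ c) = ‖c‖^2 := fun c => by
    rw [Complex.sq_norm, ← Algebra.norm_complex_apply, Algebra.norm_apply]; rfl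
  rw [e, LinearMap.det_prodMap, LinearMap.det_pi, LinearMap.det_pi, mixedEmbedding.norm_apply, prod_eq_prod_mul_prod,
    abs_mul, Finset.abs_prod, Finset.abs_prod]
  congr 1
  · refine Finset.prod_congr rfl fun w _ => ?_
    rw [h1, mult_isReal, normAtPlace_apply_of_isReal w.2]; simp
  · refine Finset.prod_congr rfl fun w _ => ?_
    rw [h2, mult_isComplex, normAtPlace_apply_of_isComplex w.2]; simp

theorem mp_exp (y : mixedSpace K) (hy : trV K y = 0) :
    MeasurePreserving (fun v : mixedSpace K => NormedSpace.exp y * v) volume volume := by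
  have h1 : |LinearMap.det (LinearMap.mulLeft ℝ (NormedSpace.exp y : mixedSpace K))| = 1 := by
    rw [abs_det_mul, norm_exp, hy, Real.exp_zero]
  refine ⟨(continuous_const.mul continuous_id).measurable, ?_⟩
  have := Measure.map_linearMap_addHaar_eq_smul_addHaar (volume : Measure (mixedSpace K)) (f := LinearMap.mulLeft ℝ (NormedSpace.exp y : mixedSpace K))
    (by intro h; rw [h] at h1; simp at h1)
  rw [abs_inv, h1] at this
  have h3 : Measure.map (⇑(LinearMap.mulLeft ℝ (NormedSpace.exp y : mixedSpace K))) volume = (volume : Measure (mixedSpace K)) := by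
    simpa using this
  exact h3

abbrev Etr := LinearMap.ker (trV K : mixedSpace K →ₗ[ℝ] ℝ)

theorem finrank_Etr : finrank ℝ (Etr K) + 1 = finrank ℚ K := by
  have h := LinearMap.finrank_range_add_finrank_ker (trV K : mixedSpace K →ₗ[ℝ] ℝ)
  have hs : LinearMap.range (trV K : mixedSpace K →ₗ[ℝ] ℝ) = ⊤ := by
    rw [LinearMap.range_eq_top]
    apply LinearMap.surjective
    intro h0
    apply trV_one K
    simpa using congrArg (fun f => f 1) h0
  rw [hs, finrank_top, finrank_self, mixedEmbedding.finrank] at h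
  rw [add_comm]; exact h

def Mn (y : mixedSpace K) : ℝ := (mixedEmbedding.norm y) ^ ((finrank ℚ K : ℝ)⁻¹)

theorem Mn_nonneg (y : mixedSpace K) : 0 ≤ Mn K y := Real.rpow_nonneg (mixedEmbedding.norm_nonneg y) _

theorem Mn_pow (y : mixedSpace K) : Mn K y ^ (finrank ℚ K) = mixedEmbedding.norm y := 
  Real.rpow_inv_natCast_pow (mixedEmbedding.norm_nonneg y) finrank_pos.ne'

theorem Mn_smul (σ : ℝ) (hσ : 0 < σ) (y : mixedSpace K) : Mn K (σ • y) = σ * Mn K y := by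
  rw [Mn, mixedEmbedding.norm_smul, Real.mul_rpow (by positivity) (mixedEmbedding.norm_nonneg y), abs_of_pos hσ,
    Real.pow_rpow_inv_natCast hσ.le finrank_pos.ne', Mn]

theorem Mn_exp_mul (z y : mixedSpace K) (hz : trV K z = 0) : Mn K (NormedSpace.exp z * y) = Mn K y := by
  rw [Mn, map_mul, norm_exp, hz, Real.exp_zero, one_mul, Mn]

theorem Mn_ne_zero {y : mixedSpace K} : Mn K y ≠ 0 ↔ mixedEmbedding.norm y ≠ 0 := by
  rw [← Mn_pow]; simp [finrank_pos.ne']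

theorem continuous_Mn : Continuous (Mn K) := 
  (mixedEmbedding.continuous_norm K).rpow_const (fun _ => Or.inr (by positivity))

open NumberField.Units NumberField.Units.dirichletUnitTheorem NumberField.mixedEmbedding.fundamentalCone

abbrev ubas : Basis (Fin (rank K)) ℝ (logSpace K) := (basisUnitLattice K).ofZLatticeBasis ℝ _

/-- one dimensional smooth partition of unity -/
def rho (x : ℝ) : ℝ := Real.smoothTransition (x + 1) - Real.smoothTransition x

theorem rho_contDiff : ContDiff ℝ ∞ rho :=
  (Real.smoothTransition.contDiff.comp (contDiff_id.add contDiff_const)).sub Real.smoothTransition.contDiff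

theorem rho_zero (x : ℝ) (hx : 1 < |x|) : rho x = 0 := by
  rcases lt_abs.mp hx with h | h
  · rw [rho, Real.smoothTransition.one_of_one_le (by linarith), Real.smoothTransition.one_of_one_le (by linarith)]; simp
  · rw [rho, Real.smoothTransition.zero_of_nonpos (by linarith), Real.smoothTransition.zero_of_nonpos (by linarith)]; simp

def PhiL (u : logSpace K) : ℂ := ((∏ j, rho ((ubas K).repr u j) : ℝ) : ℂ)

theorem continuous_coord (j) : Continuous fun u : logSpace K => (ubas K).repr u j := 
  LinearMap.continuous_of_finiteDimensional ((ubas K).coord j)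

theorem PhiL_contDiff : ContDiff ℝ ∞ (PhiL K) := by
  have h : ContDiff ℝ ∞ fun u : logSpace K => ∏ j, rho ((ubas K).repr u j) := by
    refine contDiff_prod fun j _ => rho_contDiff.comp ?_
    exact (LinearMap.toContinuousLinearMap ((ubas K).coord j)).contDiff
  exact Complex.ofRealCLM.contDiff.comp h

def cube : Set (logSpace K) := {u | ∀ j, |(ubas K).repr u j| ≤ 1}

theorem isCompact_cube : IsCompact (cube K) := by
  have h : IsCompact ((ubas K).equivFun.symm.toContinuousLinearEquiv '' (Set.pi Set.univ fun _ => Set.Icc (-1:ℝ) 1)) := 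
    (isCompact_univ_pi fun _ => isCompact_Icc).image (ContinuousLinearEquiv.continuous _)
  refine h.of_isClosed_subset ?_ ?_
  · simp only [cube, Set.ofPred_forall]
    exact isClosed_iInter fun j => isClosed_le (continuous_coord K j).abs continuous_const
  · intro u hu
    refine ⟨(ubas K).equivFun u, ?_, ?_⟩
    · intro j _
      have := abs_le.mp (hu j)
      simpa using this
    · exact (ubas K).equivFun.symm_apply_apply u

theorem PhiL_zero (u : logSpace K) (hu : u ∉ cube K) : PhiL K u = 0 := by
  simp only [cube, Set.mem_ofPred_eq, not_forall, not_le] at hu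
  obtain ⟨j, hj⟩ := hu
  rw [PhiL, Finset.prod_eq_zero (Finset.mem_univ j) (rho_zero _ hj)]; simp

def phi (y : mixedSpace K) : ℂ := if Mn K y = 0 then 0 else PhiL K (logMap y)

theorem phi_ne {y : mixedSpace K} (h : Mn K y ≠ 0) : phi K y = PhiL K (logMap y) := by simp [phi, h]
theorem phi_eq {y : mixedSpace K} (h : Mn K y = 0) : phi K y = 0 := by simp [phi, h]

def Llin : mixedSpace K →L[ℝ] logSpace K := ContinuousLinearMap.pi fun w => (mult w.1 : ℝ) • reAt K w.1

theorem logMap_exp (z : mixedSpace K) (hz : trV K z = 0) : logMap (NormedSpace.exp z) = Llin K z := by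
  ext w
  rw [logMap_apply_of_norm_eq_one (by rw [norm_exp, hz, Real.exp_zero]), normAtPlace_exp, Real.log_exp]
  simp [Llin]

theorem phi_exp_mul (z y : mixedSpace K) (hz : trV K z = 0) (hy : Mn K y ≠ 0) : 
    phi K (NormedSpace.exp z * y) = PhiL K (logMap y + Llin K z) := by
  rw [phi_ne K (by rwa [Mn_exp_mul K z y hz]), logMap_mul (by rw [norm_exp]; positivity) ((Mn_ne_zero K).mp hy), logMap_exp K z hz, add_comm]

end Concrete
end
end HFull


open Filter Topology MeasureTheory
open scoped BigOperators ContDiff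

namespace HFull

set_option linter.unusedSectionVars false
set_option linter.style.haveILetI false

noncomputable section
section Concrete
open NumberField NumberField.InfinitePlace NumberField.mixedEmbedding Module
open scoped Classical
open NumberField.Units NumberField.Units.dirichletUnitTheorem NumberField.mixedEmbedding.fundamentalCone

variable (K : Type) [Field K] [NumberField K]

def Kset : Set (mixedSpace K) := {y | Mn K y ∈ Set.Icc (1/4 : ℝ) 2 ∧ logMap y ∈ cube K}

theorem continuousOn_logMap : ContinuousOn (logMap (K := K)) {y | mixedEmbedding.norm y ≠ 0} := by
  refine continuousOn_pi.mpr fun w => ?_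
  simp only [logMap_apply]
  refine continuousOn_const.mul (ContinuousOn.sub ?_ (ContinuousOn.mul ?_ continuousOn_const))
  · refine ContinuousOn.log (continuous_normAtPlace w.1).continuousOn fun y hy => ?_
    exact mixedEmbedding.norm_ne_zero_iff.mp hy w.1
  · exact ContinuousOn.log (mixedEmbedding.continuous_norm K).continuousOn fun y hy => hy

theorem isCompact_Kset : IsCompact (Kset K) := by
  have hcl : IsClosed (Kset K) := by
    have h1 : IsClosed {y : mixedSpace K | Mn K y ∈ Set.Icc (1/4 : ℝ) 2} := isClosed_Icc.preimage (continuous_Mn K)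
    have h2 : ContinuousOn (logMap (K := K)) {y : mixedSpace K | Mn K y ∈ Set.Icc (1/4 : ℝ) 2} := by
      refine (continuousOn_logMap K).mono fun y hy => ?_
      exact (Mn_ne_zero K).mp (by have := hy.1; intro h; rw [h] at this; norm_num at this)
    exact h2.preimage_isClosed_of_isClosed h1 (isCompact_cube K).isClosed
  obtain ⟨R, hR⟩ := (isCompact_cube K).isBounded.exists_norm_le
  rw [Metric.isCompact_iff_isClosed_bounded]
  refine ⟨hcl, ?_⟩
  have hn0 : 0 < finrank ℚ K := finrank_pos
  set R1 := R + Real.log 4 with hR1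
  have hlog4 : 0 < Real.log 4 := Real.log_pos (by norm_num)
  set R2 := finrank ℚ K * Real.log 4 + (Fintype.card (InfinitePlace K)) * (2 * R1) with hR2
  rw [isBounded_iff_forall_norm_le]
  refine ⟨max (Real.exp R1) (Real.exp R2), fun y hy => ?_⟩
  obtain ⟨⟨hy1, hy2⟩, hy3⟩ := hy
  have hRn : ‖logMap y‖ ≤ R := hR _ hy3
  have hR0 : 0 ≤ R := (norm_nonneg _).trans hRn
  have hM0 : 0 < Mn K y := by linarith
  have hnorm : mixedEmbedding.norm y ≠ 0 := (Mn_ne_zero K).mp hM0.ne'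
  have hlogM : |Real.log (Mn K y)| ≤ Real.log 4 := by
    rw [abs_le]
    constructor
    · rw [← Real.log_inv]; exact Real.log_le_log (by norm_num) (by linarith)
    · exact Real.log_le_log hM0 (by linarith)
  have hlogn : Real.log (mixedEmbedding.norm y) = finrank ℚ K * Real.log (Mn K y) := by
    rw [← Mn_pow K y, Real.log_pow]
  have hw1 : ∀ w, w ≠ w₀ → |Real.log (normAtPlace w y)| ≤ R1 := by
    intro w hw
    have h1 : |logMap y ⟨w, hw⟩| ≤ R := (norm_le_pi_norm (logMap y) ⟨w, hw⟩).trans hRn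
    rw [logMap_apply, hlogn, mul_comm (finrank ℚ K : ℝ), mul_assoc, mul_inv_cancel₀ (by exact_mod_cast hn0.ne'), mul_one, abs_mul] at h1
    have hm : (1:ℝ) ≤ |(mult w : ℝ)| := by
      rw [abs_of_nonneg (by positivity)]; exact_mod_cast mult_pos
    have h2 : |Real.log (normAtPlace w y) - Real.log (Mn K y)| ≤ R := by
      refine le_trans ?_ h1
      exact le_mul_of_one_le_left (abs_nonneg _) hm
    have := abs_sub_abs_le_abs_sub (Real.log (normAtPlace w y)) (Real.log (Mn K y))
    linarith
  have hpos : ∀ w, 0 < normAtPlace w y := fun w => lt_of_le_of_ne (normAtPlace_nonneg w y) (Ne.symm (mixedEmbedding.norm_ne_zero_iff.mp hnorm w))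
  have hw0 : Real.log (normAtPlace w₀ y) ≤ R2 := by
    have h1 : Real.log (mixedEmbedding.norm y) = ∑ w : InfinitePlace K, (mult w : ℝ) * Real.log (normAtPlace w y) := by
      rw [mixedEmbedding.norm_apply, Real.log_prod (fun w _ => pow_ne_zero _ (hpos w).ne')]
      simp [Real.log_pow]
    rw [← Finset.add_sum_erase _ _ (Finset.mem_univ (w₀ : InfinitePlace K))] at h1
    have h2 : |∑ w ∈ (Finset.univ : Finset (InfinitePlace K)).erase w₀, (mult w : ℝ) * Real.log (normAtPlace w y)| ≤ (Fintype.card (InfinitePlace K)) * (2 * R1) := by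
      refine (Finset.abs_sum_le_sum_abs _ _).trans ?_
      refine (Finset.sum_le_card_nsmul _ _ (2 * R1) ?_).trans ?_
      · intro w hw
        rw [abs_mul, abs_of_nonneg (by positivity)]
        have hm : (mult w : ℝ) ≤ 2 := by
          unfold mult; split_ifs <;> norm_num
        exact mul_le_mul hm (hw1 w (Finset.ne_of_mem_erase hw)) (abs_nonneg _) (by norm_num)
      · rw [nsmul_eq_mul]
        have : 0 ≤ R1 := by positivity
        gcongr
        exact (Finset.card_erase_le).trans (le_of_eq rfl)
    have h3 : |Real.log (mixedEmbedding.norm y)| ≤ finrank ℚ K * Real.log 4 := by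
      rw [hlogn, abs_mul, abs_of_nonneg (by positivity : (0:ℝ) ≤ finrank ℚ K)]
      gcongr
    have h4 : (mult (w₀ : InfinitePlace K) : ℝ) * Real.log (normAtPlace w₀ y) ≤ R2 := by
      have := neg_abs_le (∑ w ∈ (Finset.univ : Finset (InfinitePlace K)).erase w₀, (mult w : ℝ) * Real.log (normAtPlace w y))
      have := le_abs_self (Real.log (mixedEmbedding.norm y))
      rw [hR2]
      linarith
    have hR2' : 0 ≤ R2 := by positivity
    have hm : (1:ℝ) ≤ (mult (w₀ : InfinitePlace K) : ℝ) := by exact_mod_cast mult_pos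
    by_cases hl : 0 ≤ Real.log (normAtPlace w₀ y)
    · nlinarith
    · linarith
  rw [norm_eq_sup'_normAtPlace]
  refine Finset.sup'_le _ _ fun w _ => ?_
  by_cases hw : w = w₀
  · subst hw
    refine le_trans ?_ (le_max_right _ _)
    rw [← Real.exp_log (hpos w₀)]
    exact Real.exp_le_exp.mpr hw0
  · refine le_trans ?_ (le_max_left _ _)
    rw [← Real.exp_log (hpos w)]
    exact Real.exp_le_exp.mpr ((le_abs_self _).trans (hw1 w hw))

theorem isUnit_of_norm {y : mixedSpace K} (h : mixedEmbedding.norm y ≠ 0) : IsUnit y := by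
  have hw := mixedEmbedding.norm_ne_zero_iff.mp h
  refine IsUnit.of_mul_eq_one (fun w => (y.1 w)⁻¹, fun w => (y.2 w)⁻¹) ?_
  ext w
  · have := hw w.1
    rw [normAtPlace_apply_of_isReal w.2, norm_ne_zero_iff] at this
    simp only [Prod.fst_mul, Pi.mul_apply]
    exact mul_inv_cancel₀ this
  · have := hw w.1
    rw [normAtPlace_apply_of_isComplex w.2, norm_ne_zero_iff] at this
    simp only [Prod.snd_mul, Pi.mul_apply]
    exact mul_inv_cancel₀ this

theorem isUnit_Kset : ∀ y ∈ Kset K, IsUnit y := fun y hy => 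
  isUnit_of_norm K ((Mn_ne_zero K).mp (by have := hy.1.1; intro h; rw [h] at this; norm_num at this))

theorem cont_G (γ : ℝ → ℂ) (hγ : Continuous γ) (hz : ∀ t, t ∉ Set.Icc (1/4 : ℝ) 2 → γ t = 0) :
    Continuous fun y => phi K y * γ (Mn K y) := by
  rw [continuous_iff_continuousAt]
  intro y
  by_cases hy : Mn K y = 0
  · have : (fun y => phi K y * γ (Mn K y)) =ᶠ[𝓝 y] fun _ => 0 := by
      have h1 : ∀ᶠ x in 𝓝 y, Mn K x < 1/4 := (continuous_Mn K).continuousAt.eventually_lt_const (by rw [hy]; norm_num)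
      filter_upwards [h1] with x hx
      rw [hz _ (fun h => by linarith [h.1]), mul_zero]
    exact continuousAt_const.congr this.symm
  · have h0 : mixedEmbedding.norm y ≠ 0 := (Mn_ne_zero K).mp hy
    have hop : IsOpen {y : mixedSpace K | mixedEmbedding.norm y ≠ 0} := 
      isOpen_ne_fun (mixedEmbedding.continuous_norm K) continuous_const
    have h1 : ContinuousAt (logMap (K := K)) y := (continuousOn_logMap K).continuousAt (hop.mem_nhds h0)
    refine ContinuousAt.mul ?_ (hγ.comp (continuous_Mn K)).continuousAt
    have h2 : ContinuousAt (fun y => PhiL K (logMap y)) y := (PhiL_contDiff K).continuous.continuousAt.comp h1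
    refine h2.congr ?_
    filter_upwards [hop.mem_nhds h0] with x hx
    exact (phi_ne K ((Mn_ne_zero K).mpr hx)).symm

theorem phi_smul (σ : ℝ) (hσ : 0 < σ) (y : mixedSpace K) : phi K (σ • y) = phi K y := by
  have hM := Mn_smul K σ hσ y
  by_cases hy : Mn K y = 0
  · rw [phi_eq K hy, phi_eq K (by rw [hM, hy, mul_zero])]
  · rw [phi_ne K hy, phi_ne K (by rw [hM]; exact mul_ne_zero hσ.ne' hy), logMap_real_smul ((Mn_ne_zero K).mp hy) hσ.ne']

theorem PhiL_bound (N : ℕ) : ∃ D : ℝ, 0 ≤ D ∧ ∀ j ≤ N, ∀ u, ‖iteratedFDeriv ℝ j (PhiL K) u‖ ≤ D := by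
  have : ∀ j : ℕ, ∃ B, ∀ z, ‖iteratedFDeriv ℝ j (PhiL K) z‖ ≤ B := fun j =>
    Continuous.bounded_above_of_compact_support ((PhiL_contDiff K).continuous_iteratedFDeriv (by exact_mod_cast le_top)) 
      ((HasCompactSupport.intro (isCompact_cube K) (PhiL_zero K)).iteratedFDeriv j)
  choose B hB using this
  have hB0 : ∀ i, 0 ≤ B i := fun i => (norm_nonneg _).trans (hB i 0)
  exact ⟨∑ j ∈ Finset.range (N+1), B j, Finset.sum_nonneg fun i _ => hB0 i, fun j hj z => (hB j z).trans
    (Finset.single_le_sum (fun i _ => hB0 i) (Finset.mem_range.mpr (by omega)))⟩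

def LE : Etr K →L[ℝ] logSpace K := (Llin K).comp (Etr K).subtypeL

theorem decayK (k : ℕ) : ∃ (C c : ℝ), 0 ≤ C ∧ 0 < c ∧ ∀ (γ : ℝ → ℂ) (Q : ℝ) (ξ : mixedSpace K), ContDiff ℝ ∞ γ →
      (∀ t, t ∉ Set.Icc (1/4 : ℝ) 2 → γ t = 0) → 
      (∀ i ≤ k, ∫ t, ‖iteratedDeriv i γ t‖ ≤ Q) → 1 ≤ c * ‖ξ‖ →
      ‖∫ y, (phi K y * γ (Mn K y)) * Complex.exp (Complex.I * ((trV K (ξ * y) : ℝ) : ℂ))‖ 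
        ≤ C * Q * ‖ξ‖ ^ (-(k + ((finrank ℚ K : ℝ) - 1) / 2)) := by
  have hz0 : ∀ z : Etr K, trV K (z : mixedSpace K) = 0 := fun z => z.2
  have hcomp : ∀ y, Mn K y ≠ 0 → (fun z : Etr K => phi K (NormedSpace.exp ((Etr K).subtypeL z) * y)) = 
      (fun u => PhiL K (logMap y + u)) ∘ (LE K) := by
    intro y hy
    ext z
    exact phi_exp_mul K z y (hz0 z) hy
  have hsm : ∀ y, ContDiff ℝ ∞ (fun u => PhiL K (logMap y + u)) := fun y => 
    (PhiL_contDiff K).comp (contDiff_const.add contDiff_id)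
  obtain ⟨C, c, hC, hc, h⟩ := decay (volume : Measure (mixedSpace K)) (Measure.addHaar : Measure (Etr K)) (trV K) (Etr K).subtypeL
    Subtype.val_injective (fun v hv => ⟨⟨v, hv⟩, rfl⟩) hz0 (trV_nd K) (trV_one K) (fun z => mp_exp K z (hz0 z))
    (Mn K) (fun σ z y hσ => by rw [smul_mul_assoc, Mn_smul K σ hσ]; congr 1; exact Mn_exp_mul K z y (hz0 z)) (phi K)
    (fun σ z y hσ => by rw [smul_mul_assoc, phi_smul K σ hσ])
    (fun y hy => by rw [hcomp y hy]; exact (hsm y).comp (LE K).contDiff)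
    (fun N => by
      obtain ⟨D, hD0, hD⟩ := PhiL_bound K N
      refine ⟨D * (‖LE K‖ + 1)^N, fun y hy j hj z => ?_⟩
      rw [hcomp y hy, ContinuousLinearMap.iteratedFDeriv_comp_right (LE K) (hsm y) z (by exact_mod_cast le_top)]
      refine (ContinuousMultilinearMap.norm_compContinuousLinearMap_le _ _).trans ?_
      rw [iteratedFDeriv_comp_add_left]
      simp only [Finset.prod_const, Finset.card_univ, Fintype.card_fin]
      refine mul_le_mul (hD j hj _) ?_ (by positivity) hD0
      refine (pow_le_pow_left₀ (norm_nonneg _) (by linarith : ‖LE K‖ ≤ ‖LE K‖ + 1) j).trans ?_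
      exact pow_le_pow_right₀ (by linarith [norm_nonneg (LE K)]) hj)
    (Kset K) (isCompact_Kset K) (isUnit_Kset K) (fun y hy hM => ⟨hM, by
      by_contra hc
      have hM0 : Mn K y ≠ 0 := by have := hM.1; intro h; rw [h] at this; norm_num at this
      exact hy (by rw [phi_ne K hM0]; exact PhiL_zero K _ hc)⟩) k
  refine ⟨C, c, hC, hc, fun γ Q ξ hγ hγz hQ hξ => ?_⟩
  have := h γ Q ξ hγ hγz (cont_G K γ hγ.continuous hγz) hQ hξ
  have e : (finrank ℝ (Etr K) : ℝ) = (finrank ℚ K : ℝ) - 1 := by rw [← finrank_Etr K]; push_cast; ring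
  rwa [e] at this

end Concrete
end
end HFull


open Filter Topology MeasureTheory
open scoped BigOperators ContDiff

namespace HFull

set_option linter.unusedSectionVars false
set_option linter.style.haveILetI false

noncomputable section
section Poisson
variable {ι : Type*} [Fintype ι]

def fhat (f : (ι → ℝ) → ℂ) (κ : ι → ℤ) : ℂ :=
  ∫ x, Complex.exp (-(2 * Real.pi * Complex.I * ((∑ i, (κ i : ℝ) * x i : ℝ) : ℂ))) * f x

def vz (m : ι → ℤ) : ι → ℝ := fun i => (m i : ℝ)

theorem vz_add (m m' : ι → ℤ) : vz (m + m') = vz m + vz m' := by ext i; simp [vz]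

theorem mFourier_coe (κ : ι → ℤ) (x : ι → ℝ) : 
    UnitAddTorus.mFourier (-κ) (fun i => (x i : UnitAddCircle)) = 
      Complex.exp (-(2 * Real.pi * Complex.I * ((∑ i, (κ i : ℝ) * x i : ℝ) : ℂ))) := by
  simp only [UnitAddTorus.mFourier, ContinuousMap.coe_mk, fourier_coe_apply, Pi.neg_apply]
  rw [← Complex.exp_sum]
  congr 1
  push_cast
  rw [Finset.mul_sum, ← Finset.sum_neg_distrib]
  refine Finset.sum_congr rfl fun i _ => ?_
  ring

theorem finite_supp (f : (ι → ℝ) → ℂ) (hc : HasCompactSupport f) (R : ℝ) :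
    ∃ Fs : Finset (ι → ℤ), ∀ x, ‖x‖ ≤ R → ∀ m, f (x + vz m) ≠ 0 → m ∈ Fs := by
  classical
  obtain ⟨R', hR'⟩ := hc.isCompact.isBounded.exists_norm_le
  obtain ⟨N, hN⟩ := exists_nat_ge (R + R')
  refine ⟨Finset.Icc (fun _ => -(N:ℤ)) (fun _ => (N:ℤ)), fun x hx m hm => ?_⟩
  have h1 : ‖x + vz m‖ ≤ R' := hR' _ (subset_tsupport f hm)
  have h2 : ‖vz m‖ ≤ N := by
    have : vz m = (x + vz m) - x := by abel
    rw [this]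
    exact (norm_sub_le _ _).trans (by linarith)
  rw [Finset.mem_Icc]
  have h3 : ∀ i, |(m i : ℝ)| ≤ N := fun i => (norm_le_pi_norm (vz m) i).trans h2
  constructor <;> intro i <;> have := abs_le.mp (h3 i)
  · have h4 := this.1; exact_mod_cast h4
  · have h4 := this.2; exact_mod_cast h4

def per (f : (ι → ℝ) → ℂ) (x : ι → ℝ) : ℂ := ∑' m : ι → ℤ, f (x + vz m)

theorem per_continuous (f : (ι → ℝ) → ℂ) (hf : Continuous f) (hc : HasCompactSupport f) : Continuous (per f) := by
  rw [continuous_iff_continuousAt]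
  intro x
  obtain ⟨Fs, hFs⟩ := finite_supp f hc (‖x‖ + 1)
  have h1 : per f =ᶠ[𝓝 x] fun y => ∑ m ∈ Fs, f (y + vz m) := by
    filter_upwards [Metric.ball_mem_nhds x one_pos] with y hy
    refine tsum_eq_sum fun m hm => ?_
    by_contra h
    refine hm (hFs y ?_ m h)
    rw [mem_ball_iff_norm] at hy
    have := norm_sub_norm_le y x
    linarith
  refine ContinuousAt.congr ?_ h1.symm
  exact Continuous.continuousAt (by fun_prop)

theorem per_periodic (f : (ι → ℝ) → ℂ) (x : ι → ℝ) (m : ι → ℤ) : per f (x + vz m) = per f x := by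
  simp only [per, add_assoc, ← vz_add]
  exact (Equiv.addLeft m).tsum_eq (fun m' => f (x + vz m'))

theorem poisson (f : (ι → ℝ) → ℂ) (hf : Continuous f) (hc : HasCompactSupport f) 
    (hs : Summable (fhat f)) : HasSum (fhat f) (∑' m : ι → ℤ, f (vz m)) := by
  -- lift to the torus
  let sec : UnitAddTorus ι → (ι → ℝ) := fun t i => Function.surjInv (QuotientAddGroup.mk_surjective (s := AddSubgroup.zmultiples (1:ℝ))) (t i)
  let pr : (ι → ℝ) → UnitAddTorus ι := fun x i => (x i : UnitAddCircle)
  have hlift : ∀ x, per f (sec (pr x)) = per f x := by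
    intro x
    have : ∀ i, ∃ m : ℤ, sec (pr x) i = x i + m := by
      intro i
      have h1 : ((sec (pr x) i : ℝ) : UnitAddCircle) = (x i : UnitAddCircle) := 
        Function.surjInv_eq (QuotientAddGroup.mk_surjective (s := AddSubgroup.zmultiples (1:ℝ))) (pr x i)
      rw [eq_comm, ← sub_eq_zero, ← AddCircle.coe_sub, AddCircle.coe_eq_zero_iff] at h1
      obtain ⟨m, hm⟩ := h1
      refine ⟨-m, ?_⟩
      push_cast
      simp at hm
      linarith
    choose m hm using this
    have : sec (pr x) = x + vz m := by ext i; simp [hm, vz]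
    rw [this, per_periodic]
  have hprq : IsQuotientMap pr := by
    have : IsOpenQuotientMap pr := IsOpenQuotientMap.piMap (fun _ => QuotientAddGroup.isOpenQuotientMap_mk)
    exact this.isQuotientMap
  let P : C(UnitAddTorus ι, ℂ) := ⟨fun t => per f (sec t), by
    rw [hprq.continuous_iff]
    have : (fun t => per f (sec t)) ∘ pr = per f := funext hlift
    rw [this]; exact per_continuous f hf hc⟩
  have hcoef : ∀ κ, UnitAddTorus.mFourierCoeff P κ = fhat f κ := by
    intro κ
    rw [UnitAddTorus.mFourierCoeff_eq_integral P κ 0]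
    let Sm : (ι → ℤ) → Set (ι → ℝ) := fun m => {x | ∀ i, x i ∈ Set.Ioc (m i : ℝ) (m i + 1)}
    let h : (ι → ℝ) → ℂ := fun x => Complex.exp (-(2 * Real.pi * Complex.I * ((∑ i, (κ i : ℝ) * x i : ℝ) : ℂ))) * f x
    have hhc : Continuous h := by simp only [h]; fun_prop
    have hhs : HasCompactSupport h := hc.mul_left
    have hper : ∀ x m, Complex.exp (-(2 * Real.pi * Complex.I * ((∑ i, (κ i : ℝ) * x i : ℝ) : ℂ))) * f (x + vz m) = h (x + vz m) := by
      intro x m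
      simp only [h]
      congr 1
      rw [Complex.exp_eq_exp_iff_exists_int]
      refine ⟨∑ i, κ i * m i, ?_⟩
      simp only [Pi.add_apply, mul_add, Finset.sum_add_distrib, vz]
      push_cast
      ring
    obtain ⟨Fs, hFs⟩ := finite_supp f hc 1
    have hS0 : {x : ι → ℝ | ∀ i, x i ∈ Set.Ioc ((0 : ι → ℝ) i) ((0 : ι → ℝ) i + 1)} = Sm 0 := by
      ext x; simp [Sm]
    rw [hS0]
    have hmeas : ∀ m, MeasurableSet (Sm m) := by
      intro m
      have : Sm m = Set.pi Set.univ fun i => Set.Ioc (m i : ℝ) (m i + 1) := by ext x; simp [Sm]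
      rw [this]
      exact MeasurableSet.univ_pi fun i => measurableSet_Ioc
    have hSx : ∀ x ∈ Sm 0, ‖x‖ ≤ 1 := by
      intro x hx
      rw [pi_norm_le_iff_of_nonneg zero_le_one]
      intro i
      have := hx i
      simp only [Pi.zero_apply, Int.cast_zero, Set.mem_Ioc] at this
      rw [Real.norm_eq_abs, abs_le]
      constructor <;> linarith
    have e1 : ∫ x in Sm 0, UnitAddTorus.mFourier (-κ) (fun i => (x i : UnitAddCircle)) • P (fun i => (x i : UnitAddCircle)) = 
        ∫ x in Sm 0, ∑ m ∈ Fs, h (x + vz m) := by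
      refine setIntegral_congr_fun (hmeas 0) fun x hx => ?_
      rw [mFourier_coe]
      have : P (fun i => (x i : UnitAddCircle)) = per f x := hlift x
      rw [this, per, tsum_eq_sum (s := Fs) (fun m hm => by
        by_contra h'
        exact hm (hFs x (hSx x hx) m h')), smul_eq_mul, Finset.mul_sum]
      exact Finset.sum_congr rfl fun m _ => hper x m
    rw [e1]
    have hint : Integrable h := hhc.integrable_of_hasCompactSupport hhs
    rw [integral_finsetSum _ fun m _ => (hint.comp_add_right (vz m)).integrableOn]
    have e2 : ∀ m, ∫ x in Sm 0, h (x + vz m) = ∫ x in Sm m, h x := by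
      intro m
      have hpre : (fun x => x + vz m) ⁻¹' (Sm m) = Sm 0 := by
        ext x
        simp only [Sm, Set.mem_preimage, Set.mem_ofPred_eq, Pi.add_apply, vz, Set.mem_Ioc, Pi.zero_apply, Int.cast_zero]
        refine forall_congr' fun i => ?_
        constructor <;> rintro ⟨h1, h2⟩ <;> constructor <;> linarith
      rw [← hpre]
      exact (measurePreserving_add_right volume (vz m)).setIntegral_preimage_emb (MeasurableEquiv.addRight (vz m)).measurableEmbedding h (Sm m)
    simp only [e2]
    rw [← integral_biUnion_finset Fs (fun m _ => hmeas m) ?_ (fun m _ => hint.integrableOn)]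
    · rw [setIntegral_eq_integral_of_forall_compl_eq_zero]
      · rfl
      intro x hx
      by_contra hne
      apply hx
      simp only [Set.mem_iUnion]
      let m : ι → ℤ := fun i => ⌈x i⌉ - 1
      have hxm : x - vz m ∈ Sm 0 := by
        intro i
        simp only [Pi.sub_apply, vz, m, Set.mem_Ioc, Pi.zero_apply]
        push_cast
        constructor <;> linarith [Int.le_ceil (x i), Int.ceil_lt_add_one (x i)]
      refine ⟨m, hFs (x - vz m) (hSx _ hxm) m ?_, ?_⟩
      · rw [sub_add_cancel]
        simp only [h] at hne
        exact (mul_ne_zero_iff.mp hne).2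
      · intro i
        simp only [m, Set.mem_Ioc]
        push_cast
        constructor <;> linarith [Int.le_ceil (x i), Int.ceil_lt_add_one (x i)]
    · intro m _ m' _ hmm
      rw [Function.onFun, Set.disjoint_left]
      intro x hx hx'
      apply hmm
      ext i
      have h1 := hx i
      have h2 := hx' i
      have a1 : ⌈x i⌉ = m i + 1 := by rw [Int.ceil_eq_iff]; push_cast; constructor <;> linarith [h1.1, h1.2]
      have a2 : ⌈x i⌉ = m' i + 1 := by rw [Int.ceil_eq_iff]; push_cast; constructor <;> linarith [h2.1, h2.2]
      omega
  have hsum : Summable (UnitAddTorus.mFourierCoeff P) := by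
    have : UnitAddTorus.mFourierCoeff P = fhat f := funext hcoef
    rw [this]; exact hs
  have key := UnitAddTorus.hasSum_mFourier_series_apply_of_summable hsum (pr 0)
  have hP0 : P (pr 0) = ∑' m : ι → ℤ, f (vz m) := by
    have : P (pr 0) = per f 0 := hlift 0
    rw [this, per]; simp
  rw [hP0] at key
  convert key using 2 with κ
  rw [hcoef κ]
  have : UnitAddTorus.mFourier κ (pr 0) = 1 := by
    have := mFourier_coe (-κ) 0
    rw [neg_neg] at this
    refine Eq.trans this ?_
    simp
  rw [this]; simp

end Poisson
end
end HFull


open Filter Topology MeasureTheory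
open scoped BigOperators ContDiff

namespace HFull

set_option linter.unusedSectionVars false
set_option linter.style.haveILetI false

noncomputable section
section Gam

def SC (t : ℝ) : ℂ := ((Real.smoothTransition t : ℝ) : ℂ)

theorem SC_contDiff : ContDiff ℝ ∞ SC :=
  Complex.ofRealCLM.contDiff.comp (Real.smoothTransition.contDiff (n := ⊤))

def gamR (a b η t : ℝ) : ℝ :=
  Real.smoothTransition (η⁻¹ * (t - a)) - Real.smoothTransition (η⁻¹ * (t - b))

def gam (a b η t : ℝ) : ℂ := ((gamR a b η t : ℝ) : ℂ)

theorem gam_eq (a b η : ℝ) : gam a b η = fun t => SC (η⁻¹ * (t - a)) - SC (η⁻¹ * (t - b)) := by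
  funext t; simp [gam, gamR, SC]

theorem SCs_contDiff (a η : ℝ) : ContDiff ℝ ∞ (fun t => SC (η⁻¹ * (t - a))) :=
  SC_contDiff.comp (contDiff_const.mul (contDiff_id.sub contDiff_const))

theorem gam_contDiff (a b η : ℝ) : ContDiff ℝ ∞ (gam a b η) := by
  rw [gam_eq]; exact (SCs_contDiff a η).sub (SCs_contDiff b η)

theorem gamR_continuous (a b η : ℝ) : Continuous (gamR a b η) := by
  unfold gamR
  have := Real.smoothTransition.continuous
  fun_prop

theorem gamR_nonneg {a b η : ℝ} (hη : 0 < η) (hab : a ≤ b) (t : ℝ) : 0 ≤ gamR a b η t := by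
  refine sub_nonneg.mpr (Real.smoothTransition.monotone ?_)
  have : 0 < η⁻¹ := inv_pos.mpr hη
  gcongr

theorem gamR_le_one (a b η t : ℝ) : gamR a b η t ≤ 1 := by
  unfold gamR
  linarith [Real.smoothTransition.le_one (η⁻¹ * (t - a)), Real.smoothTransition.nonneg (η⁻¹ * (t - b))]

theorem gamR_zero {a b η : ℝ} (hη : 0 < η) (hab : a ≤ b) {t : ℝ} (ht : t ∉ Set.Icc a (b + η)) :
    gamR a b η t = 0 := by
  have h0 : 0 < η⁻¹ := inv_pos.mpr hη
  unfold gamR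
  rw [Set.mem_Icc, not_and_or, not_le, not_le] at ht
  rcases ht with ht | ht
  · rw [Real.smoothTransition.zero_of_nonpos, Real.smoothTransition.zero_of_nonpos, sub_zero] <;>
      refine mul_nonpos_of_nonneg_of_nonpos h0.le ?_ <;> linarith
  · rw [Real.smoothTransition.one_of_one_le, Real.smoothTransition.one_of_one_le, sub_self] <;>
      rw [inv_mul_eq_div, le_div_iff₀ hη] <;> linarith

theorem gamR_one {a b η : ℝ} (hη : 0 < η) {t : ℝ} (ht : t ∈ Set.Icc (a + η) b) :
    gamR a b η t = 1 := by
  have h0 : 0 < η⁻¹ := inv_pos.mpr hη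
  unfold gamR
  rw [Real.smoothTransition.one_of_one_le, Real.smoothTransition.zero_of_nonpos, sub_zero]
  · exact mul_nonpos_of_nonneg_of_nonpos h0.le (by linarith [ht.2])
  · rw [inv_mul_eq_div, le_div_iff₀ hη]; linarith [ht.1]

theorem SC_deriv_zero {i : ℕ} (hi : 1 ≤ i) {t : ℝ} (ht : t ∉ Set.Icc (0:ℝ) 1) :
    iteratedDeriv i SC t = 0 := by
  rw [Set.mem_Icc, not_and_or, not_le, not_le] at ht
  rcases ht with ht | ht
  · have : SC =ᶠ[𝓝 t] fun _ => (0 : ℂ) := by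
      filter_upwards [Iio_mem_nhds ht] with s hs
      simp [SC, Real.smoothTransition.zero_of_nonpos (le_of_lt hs)]
    rw [this.iteratedDeriv_eq, iteratedDeriv_const]; simp
  · have : SC =ᶠ[𝓝 t] fun _ => (1 : ℂ) := by
      filter_upwards [Ioi_mem_nhds ht] with s hs
      simp [SC, Real.smoothTransition.one_of_one_le (le_of_lt hs)]
    rw [this.iteratedDeriv_eq, iteratedDeriv_const]
    rw [if_neg (by omega)]

theorem SC_deriv_integrable {i : ℕ} (hi : 1 ≤ i) : Integrable (fun t => ‖iteratedDeriv i SC t‖) := by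
  have hc : Continuous (iteratedDeriv i SC) := SC_contDiff.continuous_iteratedDeriv i (by exact_mod_cast le_top)
  exact hc.norm.integrable_of_hasCompactSupport
    (HasCompactSupport.intro (isCompact_Icc (a := (0:ℝ)) (b := 1)) fun t ht => by
      rw [SC_deriv_zero hi ht, norm_zero])

theorem SCs_deriv (a η : ℝ) (i : ℕ) (t : ℝ) :
    iteratedDeriv i (fun t => SC (η⁻¹ * (t - a))) t = (η⁻¹ ^ i) • iteratedDeriv i SC (η⁻¹ * (t - a)) := by
  have h1 := iteratedDeriv_comp_sub_const (𝕜 := ℝ) i (fun u => SC (η⁻¹ * u)) a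
  rw [h1]
  have h2 := iteratedDeriv_comp_const_smul (𝕜 := ℝ) (n := i) (f := SC) (contDiff_infty.mp SC_contDiff i) η⁻¹
  rw [h2]

theorem gam_bound (k : ℕ) (hk : 1 ≤ k) : ∃ C : ℝ, 0 ≤ C ∧ ∀ a b η : ℝ, 0 < η → η ≤ 1 → a ≤ b →
    b + η - a ≤ 2 → ∀ i ≤ k, ∫ t, ‖iteratedDeriv i (gam a b η) t‖ ≤ C * (η ^ (k - 1))⁻¹ := by
  let D : ℕ → ℝ := fun i => ∫ t, ‖iteratedDeriv i SC t‖
  have hD : ∀ i, 0 ≤ D i := fun i => integral_nonneg fun t => norm_nonneg _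
  have hS : 0 ≤ ∑ i ∈ Finset.range (k+1), D i := Finset.sum_nonneg fun i _ => hD i
  refine ⟨2 + 2 * ∑ i ∈ Finset.range (k+1), D i, by positivity, ?_⟩
  intro a b η hη hη1 hab hba i hi
  have hinv : ∀ j, j ≤ k - 1 → (η ^ j)⁻¹ ≤ (η ^ (k-1))⁻¹ := fun j hj =>
    inv_anti₀ (by positivity) (pow_le_pow_of_le_one hη.le hη1 hj)
  have hE : 0 < (η ^ (k-1))⁻¹ := by positivity
  rcases Nat.eq_zero_or_pos i with rfl | hi0
  · simp only [iteratedDeriv_zero]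
    have h1 : ∫ t, ‖gam a b η t‖ ≤ 2 := by
      rw [← setIntegral_eq_integral_of_forall_compl_eq_zero (s := Set.Icc a (b+η)) (fun t ht => by
        simp [gam, gamR_zero hη hab ht])]
      have h2 := norm_setIntegral_le_of_norm_le_const (μ := volume) (s := Set.Icc a (b+η))
        (f := fun t => ‖gam a b η t‖) (C := 1) (by simp) (fun t _ => by
          rw [norm_norm, gam, Complex.norm_real, Real.norm_eq_abs, abs_le]
          constructor <;> linarith [gamR_nonneg hη hab t, gamR_le_one a b η t])
      rw [Real.norm_eq_abs] at h2
      refine (le_abs_self _).trans (h2.trans ?_)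
      rw [one_mul, Real.volume_real_Icc_of_le (by linarith)]
      exact hba
    have h3 := hinv 0 (by omega)
    simp only [pow_zero, inv_one] at h3
    have : (2:ℝ) * 1 ≤ (2 + 2 * ∑ i ∈ Finset.range (k+1), D i) * (η ^ (k-1))⁻¹ := by
      apply mul_le_mul _ h3 zero_le_one (by positivity)
      linarith
    linarith
  · have hη0 : η⁻¹ ≠ 0 := by positivity
    have hint : ∀ c, Integrable (fun t => ‖iteratedDeriv i SC (η⁻¹ * (t - c))‖) := fun c =>
      ((SC_deriv_integrable hi0).comp_mul_left' hη0).comp_sub_right c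
    have hval : ∀ c, ∫ t, ‖iteratedDeriv i SC (η⁻¹ * (t - c))‖ = η * D i := by
      intro c
      rw [integral_sub_right_eq_self (fun t => ‖iteratedDeriv i SC (η⁻¹ * t)‖) c]
      rw [Measure.integral_comp_mul_left (fun t => ‖iteratedDeriv i SC t‖)]
      simp [abs_of_pos hη, D]
    have hpt : ∀ t, ‖iteratedDeriv i (gam a b η) t‖ ≤ η⁻¹ ^ i * (‖iteratedDeriv i SC (η⁻¹ * (t - a))‖ + ‖iteratedDeriv i SC (η⁻¹ * (t - b))‖) := by
      intro t
      rw [gam_eq]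
      rw [iteratedDeriv_fun_sub ((contDiff_infty.mp (SCs_contDiff a η) i).contDiffAt) ((contDiff_infty.mp (SCs_contDiff b η) i).contDiffAt), SCs_deriv, SCs_deriv]
      refine (norm_sub_le _ _).trans ?_
      rw [norm_smul, norm_smul, Real.norm_of_nonneg (by positivity), mul_add]
    have h1 : ∫ t, ‖iteratedDeriv i (gam a b η) t‖ ≤ η⁻¹ ^ i * (η * D i + η * D i) := by
      rw [← hval a]
      nth_rewrite 2 [hval a]
      rw [← hval b, ← integral_add (hint a) (hint b), ← integral_const_mul]
      refine integral_mono_of_nonneg (Eventually.of_forall fun t => norm_nonneg _) (((hint a).add (hint b)).const_mul _) (Eventually.of_forall hpt)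
    refine h1.trans ?_
    have h2 : η⁻¹ ^ i * (η * D i + η * D i) = 2 * D i * (η ^ (i-1))⁻¹ := by
      obtain ⟨j, rfl⟩ : ∃ j, i = j + 1 := ⟨i-1, by omega⟩
      simp only [Nat.add_sub_cancel]
      rw [inv_pow, pow_succ]
      generalize D (j+1) = d
      field_simp
      ring
    rw [h2]
    have h3 : D i ≤ ∑ i ∈ Finset.range (k+1), D i :=
      Finset.single_le_sum (f := D) (fun i _ => hD i) (Finset.mem_range.mpr (by omega))
    refine mul_le_mul (by linarith) (hinv (i-1) (by omega)) (by positivity) (by positivity)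

end Gam
end
end HFull


open Filter Topology MeasureTheory
open scoped BigOperators ContDiff

namespace HFull

set_option linter.unusedSectionVars false
set_option linter.style.haveILetI false

noncomputable section
section Dyadic
variable {S : Type*}

theorem sum_fib_geom (F : Finset S) (l : S → ℕ) (g : S → ℝ) (A ρ : ℝ) (hA : 0 ≤ A) (hρ : 0 ≤ ρ) (hρ1 : ρ < 1)
    (h : ∀ j, ∑ i ∈ F with l i = j, g i ≤ A * ρ ^ j) : ∑ i ∈ F, g i ≤ A * (1 - ρ)⁻¹ := by
  classical
  rw [← Finset.sum_fiberwise_of_maps_to (s := F) (t := F.image l) (g := l) (fun i hi => Finset.mem_image_of_mem l hi)]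
  refine (Finset.sum_le_sum fun j _ => h j).trans ?_
  rw [← Finset.mul_sum, ← tsum_geometric_of_lt_one hρ hρ1]
  exact mul_le_mul_of_nonneg_left
    ((summable_geometric_of_lt_one hρ hρ1).sum_le_tsum _ (fun i _ => by positivity)) hA

/-- counting hypothesis -/
def CountLe (N : S → ℝ) (C β : ℝ) : Prop :=
  ∀ t : ℝ, 1 ≤ t → ∀ F : Finset S, (∀ i ∈ F, N i ≤ t) → (F.card : ℝ) ≤ C * t ^ β

theorem dy_above {N : S → ℝ} {C β : ℝ} (hC : 0 ≤ C) (hc : CountLe N C β) {s : ℝ}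
    (hs0 : 0 ≤ s) (hs : β < s) : ∃ C' : ℝ, 0 ≤ C' ∧ ∀ x : ℝ, 1 ≤ x → ∀ F : Finset S, (∀ i ∈ F, x ≤ N i) →
      ∑ i ∈ F, N i ^ (-s) ≤ C' * x ^ (β - s) := by
  have hρ1 : (2:ℝ) ^ (β - s) < 1 := Real.rpow_lt_one_of_one_lt_of_neg (by norm_num) (by linarith)
  have hρ : 0 < (2:ℝ) ^ (β - s) := by positivity
  refine ⟨C * 2 ^ β * (1 - (2:ℝ) ^ (β - s))⁻¹, mul_nonneg (by positivity) (inv_nonneg.mpr (by linarith)), ?_⟩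
  intro x hx F hF
  have hx0 : 0 < x := by linarith
  have hl : ∀ i, ∃ j : ℕ, x ≤ N i → (2:ℝ) ^ j ≤ N i / x ∧ N i / x < 2 ^ (j+1) := by
    intro i
    by_cases hi : x ≤ N i
    · obtain ⟨j, h1, h2⟩ := exists_nat_pow_near ((one_le_div hx0).mpr hi) (one_lt_two (α := ℝ))
      exact ⟨j, fun _ => ⟨h1, h2⟩⟩
    · exact ⟨0, fun h => absurd h hi⟩
  choose l hl using hl
  have := sum_fib_geom F l (fun i => N i ^ (-s)) (C * 2 ^ β * x ^ (β - s)) (2 ^ (β - s)) (by positivity) hρ.le hρ1 ?_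
  · refine this.trans (le_of_eq (by ring))
  intro j
  have hcard := hc (2 ^ (j+1) * x) (by
    have : (1:ℝ) ≤ 2 ^ (j+1) := one_le_pow₀ (by norm_num)
    nlinarith) (F.filter fun i => l i = j) (by
      intro i hi
      rw [Finset.mem_filter] at hi
      have := (hl i (hF i hi.1)).2
      rw [hi.2, div_lt_iff₀ hx0] at this
      exact this.le)
  have hb : ∀ i ∈ F.filter (fun i => l i = j), N i ^ (-s) ≤ (2 ^ j * x) ^ (-s) := by
    intro i hi
    rw [Finset.mem_filter] at hi
    have := (hl i (hF i hi.1)).1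
    rw [hi.2, le_div_iff₀ hx0] at this
    exact Real.rpow_le_rpow_of_nonpos (by positivity) this (by linarith)
  refine (Finset.sum_le_card_nsmul _ _ _ hb).trans ?_
  rw [nsmul_eq_mul]
  refine (mul_le_mul_of_nonneg_right hcard (by positivity)).trans (le_of_eq ?_)
  have e1 : ((2:ℝ) ^ (j+1) * x) ^ β = 2 ^ β * (2 ^ j * x) ^ β := by
    rw [← Real.mul_rpow (by norm_num) (by positivity)]; ring_nf
  have e2 : ((2:ℝ) ^ j * x) ^ β * (2 ^ j * x) ^ (-s) = x ^ (β - s) * (2 ^ (β - s)) ^ j := by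
    rw [← Real.rpow_add (by positivity), Real.mul_rpow (by positivity) hx0.le, ← Real.rpow_natCast, ← Real.rpow_natCast,
      ← Real.rpow_mul (by norm_num), ← Real.rpow_mul (by norm_num), mul_comm (j:ℝ), sub_eq_add_neg]
    ring
  rw [e1]
  calc _ = C * 2 ^ β * (((2:ℝ) ^ j * x) ^ β * (2 ^ j * x) ^ (-s)) := by ring
    _ = _ := by rw [e2]; ring

theorem dy_fiber {N : S → ℝ} {C β : ℝ} (hN : ∀ i, 1 ≤ N i) (hC : 0 ≤ C) (hc : CountLe N C β) {s : ℝ}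
    (hs0 : 0 ≤ s) {x : ℝ} (hx : 1 ≤ x) (F : Finset S) (l : S → ℕ)
    (hl : ∀ i ∈ F, (2:ℝ) ^ (l i) ≤ x / N i ∧ x / N i < 2 ^ (l i +1)) (j : ℕ) :
      ∑ i ∈ F with l i = j, N i ^ (-s) ≤ C * 2 ^ s * x ^ (β - s) * (2 ^ (s - β)) ^ j := by
  classical
  have hx0 : 0 < x := by linarith
  by_cases hne : (F.filter (fun i => l i = j)).Nonempty
  · have hle : ∀ i ∈ F.filter (fun i => l i = j), N i ≤ x / 2 ^ j := by
      intro i hi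
      rw [Finset.mem_filter] at hi
      have := (hl i hi.1).1
      rw [hi.2, le_div_iff₀ (by linarith [hN i])] at this
      rw [le_div_iff₀ (by positivity)]; linarith
    have h1 : 1 ≤ x / 2 ^ j := by
      obtain ⟨i, hi⟩ := hne
      exact (hN i).trans (hle i hi)
    have hcard := hc _ h1 _ hle
    have hb : ∀ i ∈ F.filter (fun i => l i = j), N i ^ (-s) ≤ (x / 2 ^ (j+1)) ^ (-s) := by
      intro i hi
      rw [Finset.mem_filter] at hi
      have := (hl i hi.1).2
      rw [hi.2, div_lt_iff₀ (by linarith [hN i])] at this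
      refine Real.rpow_le_rpow_of_nonpos (by positivity) ?_ (by linarith)
      rw [div_le_iff₀ (by positivity)]; linarith
    refine (Finset.sum_le_card_nsmul _ _ _ hb).trans ?_
    rw [nsmul_eq_mul]
    refine (mul_le_mul_of_nonneg_right hcard (by positivity)).trans (le_of_eq ?_)
    have e1 : (x / 2 ^ (j+1)) ^ (-s) = 2 ^ s * (x / 2 ^ j) ^ (-s) := by
      have : x / 2 ^ (j+1) = 2⁻¹ * (x / 2 ^ j) := by field_simp; ring
      rw [this, Real.mul_rpow (by norm_num) (by positivity), Real.inv_rpow (by norm_num), ← Real.rpow_neg (by norm_num), neg_neg]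
    have e2 : (x / 2 ^ j) ^ β * (x / 2 ^ j) ^ (-s) = x ^ (β - s) * (2 ^ (s - β)) ^ j := by
      rw [← Real.rpow_add (by positivity), Real.div_rpow hx0.le (by positivity), ← Real.rpow_natCast, ← Real.rpow_natCast,
        ← Real.rpow_mul (by norm_num), ← Real.rpow_mul (by norm_num), div_eq_mul_inv, ← Real.rpow_neg (by norm_num)]
      ring_nf
    rw [e1]
    calc _ = C * 2 ^ s * ((x / 2 ^ j) ^ β * (x / 2 ^ j) ^ (-s)) := by ring
      _ = _ := by rw [e2]; ring
  · rw [Finset.not_nonempty_iff_eq_empty] at hne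
    rw [hne, Finset.sum_empty]; positivity

theorem dy_exists {N : S → ℝ} (hN : ∀ i, 1 ≤ N i) (x : ℝ) : ∃ l : S → ℕ, 
    ∀ i, N i ≤ x → (2:ℝ) ^ (l i) ≤ x / N i ∧ x / N i < 2 ^ (l i +1) := by
  have hl : ∀ i, ∃ j : ℕ, N i ≤ x → (2:ℝ) ^ j ≤ x / N i ∧ x / N i < 2 ^ (j+1) := by
    intro i
    by_cases hi : N i ≤ x
    · obtain ⟨j, h1, h2⟩ := exists_nat_pow_near ((one_le_div (by linarith [hN i])).mpr hi) (one_lt_two (α := ℝ))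
      exact ⟨j, fun _ => ⟨h1, h2⟩⟩
    · exact ⟨0, fun h => absurd h hi⟩
  choose l hl using hl
  exact ⟨l, hl⟩

theorem dy_below {N : S → ℝ} {C β : ℝ} (hN : ∀ i, 1 ≤ N i) (hC : 0 ≤ C) (hc : CountLe N C β) {s : ℝ}
    (hs0 : 0 ≤ s) (hs : s < β) : ∃ C' : ℝ, 0 ≤ C' ∧ ∀ x : ℝ, 1 ≤ x → ∀ F : Finset S, (∀ i ∈ F, N i ≤ x) →
      ∑ i ∈ F, N i ^ (-s) ≤ C' * x ^ (β - s) := by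
  have hρ1 : (2:ℝ) ^ (s - β) < 1 := Real.rpow_lt_one_of_one_lt_of_neg (by norm_num) (by linarith)
  have hρ : 0 < (2:ℝ) ^ (s - β) := by positivity
  refine ⟨C * 2 ^ s * (1 - (2:ℝ) ^ (s - β))⁻¹, mul_nonneg (by positivity) (inv_nonneg.mpr (by linarith)), ?_⟩
  intro x hx F hF
  obtain ⟨l, hl⟩ := dy_exists hN x
  have := sum_fib_geom F l (fun i => N i ^ (-s)) (C * 2 ^ s * x ^ (β - s)) (2 ^ (s - β)) (by positivity) hρ.le hρ1
    (dy_fiber hN hC hc hs0 hx F l (fun i hi => hl i (hF i hi)))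
  refine this.trans (le_of_eq (by ring))

theorem dy_eq {N : S → ℝ} {C β : ℝ} (hN : ∀ i, 1 ≤ N i) (hC : 0 ≤ C) (hc : CountLe N C β)
    (hs0 : 0 ≤ β) : ∃ C' : ℝ, 0 ≤ C' ∧ ∀ x : ℝ, 1 ≤ x → ∀ F : Finset S, (∀ i ∈ F, N i ≤ x) →
      ∑ i ∈ F, N i ^ (-β) ≤ C' * (1 + Real.log x) := by
  classical
  have hlog2 : 0 < Real.log 2 := Real.log_pos (by norm_num)
  refine ⟨C * 2 ^ β * (1 + (Real.log 2)⁻¹), by positivity, ?_⟩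
  intro x hx F hF
  have hx0 : 0 < x := by linarith
  obtain ⟨l, hl⟩ := dy_exists hN x
  have hlL : ∀ i ∈ F, l i ∈ Finset.range (⌊Real.log x / Real.log 2⌋₊ + 1) := by
    intro i hi
    rw [Finset.mem_range, Nat.lt_succ_iff, Nat.le_floor_iff (div_nonneg (Real.log_nonneg hx) hlog2.le), le_div_iff₀ hlog2,
      ← Real.log_pow]
    refine Real.log_le_log (by positivity) ((hl i (hF i hi)).1.trans ?_)
    exact div_le_self hx0.le (hN i)
  rw [← Finset.sum_fiberwise_of_maps_to hlL]
  have hfib : ∀ j ∈ Finset.range (⌊Real.log x / Real.log 2⌋₊ + 1), ∑ i ∈ F with l i = j, N i ^ (-β) ≤ C * 2 ^ β := by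
    intro j _
    have := dy_fiber hN hC hc hs0 hx F l (fun i hi => hl i (hF i hi)) j
    simpa using this
  refine (Finset.sum_le_card_nsmul _ _ _ hfib).trans ?_
  rw [nsmul_eq_mul, Finset.card_range]
  push_cast
  have h1 : (⌊Real.log x / Real.log 2⌋₊ : ℝ) ≤ Real.log x / Real.log 2 := Nat.floor_le (div_nonneg (Real.log_nonneg hx) hlog2.le)
  have h2 : (⌊Real.log x / Real.log 2⌋₊ : ℝ) + 1 ≤ (1 + (Real.log 2)⁻¹) * (1 + Real.log x) := by
    have h3 := Real.log_nonneg hx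
    have h4 : 0 < (Real.log 2)⁻¹ := by positivity
    have h5 : Real.log x / Real.log 2 = Real.log x * (Real.log 2)⁻¹ := div_eq_mul_inv _ _
    nlinarith
  calc _ ≤ (1 + (Real.log 2)⁻¹) * (1 + Real.log x) * (C * 2 ^ β) := by gcongr
    _ = _ := by ring

end Dyadic
end
end HFull


open Filter Topology MeasureTheory
open scoped BigOperators ContDiff

namespace HFull

set_option linter.unusedSectionVars false
set_option linter.style.haveILetI false

noncomputable section
section Lat
variable {ι : Type*} [Fintype ι]

theorem poisson_bound (f : (ι → ℝ) → ℂ) (hf : Continuous f) (hc : HasCompactSupport f) (B : ℝ)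
    (hB : ∀ F : Finset (ι → ℤ), 0 ∉ F → ∑ κ ∈ F, ‖fhat f κ‖ ≤ B) :
    ‖(∑' m : ι → ℤ, f (vz m)) - fhat f 0‖ ≤ B := by
  classical
  have hs : Summable (fhat f) := by
    refine Summable.of_norm (summable_of_sum_le (c := ‖fhat f 0‖ + B) (fun κ => norm_nonneg _) fun F => ?_)
    have h1 : ∑ κ ∈ F, ‖fhat f κ‖ ≤ ∑ κ ∈ insert 0 (F.erase 0), ‖fhat f κ‖ := by
      refine Finset.sum_le_sum_of_subset_of_nonneg (fun κ hκ => ?_) fun _ _ _ => norm_nonneg _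
      by_cases h : κ = 0
      · simp [h]
      · simp [h, hκ]
    rw [Finset.sum_insert (by simp)] at h1
    linarith [hB (F.erase 0) (by simp)]
  have key := poisson f hf hc hs
  have h2 : Tendsto (fun F : Finset (ι → ℤ) => ‖(∑ κ ∈ F, fhat f κ) - fhat f 0‖) atTop
      (𝓝 ‖(∑' m : ι → ℤ, f (vz m)) - fhat f 0‖) := (key.sub_const _).norm
  refine le_of_tendsto h2 ?_
  filter_upwards [eventually_ge_atTop ({0} : Finset (ι → ℤ))] with F hF
  have h0 : (0 : ι → ℤ) ∈ F := hF (by simp)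
  rw [← Finset.add_sum_erase F _ h0, add_sub_cancel_left]
  exact (norm_sum_le _ _).trans (hB _ (by simp))

theorem one_le_vz {κ : ι → ℤ} (h : κ ≠ 0) : 1 ≤ ‖vz κ‖ := by
  obtain ⟨i, hi⟩ := Function.ne_iff.mp h
  have h1 : ‖vz κ i‖ ≤ ‖vz κ‖ := norm_le_pi_norm (vz κ) i
  refine le_trans ?_ h1
  rw [vz, Real.norm_eq_abs, ← Int.cast_abs]
  exact_mod_cast Int.one_le_abs hi

theorem vz_count : CountLe (fun κ : {κ : ι → ℤ // κ ≠ 0} => ‖vz κ.1‖) (3 ^ (Fintype.card ι)) (Fintype.card ι : ℝ) := by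
  classical
  intro t ht F hF
  have hsub : F.image Subtype.val ⊆ Fintype.piFinset (fun _ : ι => Finset.Icc (-(⌊t⌋₊:ℤ)) ⌊t⌋₊) := by
    intro κ hκ
    rw [Finset.mem_image] at hκ
    obtain ⟨κ', h1, rfl⟩ := hκ
    rw [Fintype.mem_piFinset]
    intro i
    have h2 : |(κ'.1 i : ℝ)| ≤ t := (norm_le_pi_norm (vz κ'.1) i).trans (hF κ' h1)
    have h3 : (κ'.1 i).natAbs ≤ ⌊t⌋₊ := by
      rw [Nat.le_floor_iff (by linarith)]
      rwa [Nat.cast_natAbs, Int.cast_abs]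
    rw [Finset.mem_Icc]
    omega
  have h1 := Finset.card_le_card hsub
  rw [Finset.card_image_of_injective _ Subtype.val_injective, Fintype.card_piFinset] at h1
  simp only [Int.card_Icc, Finset.prod_const, Finset.card_univ] at h1
  have h2 : ((⌊t⌋₊ : ℤ) + 1 - -(⌊t⌋₊:ℤ)).toNat = 2 * ⌊t⌋₊ + 1 := by omega
  rw [h2] at h1
  have h3 : (F.card : ℝ) ≤ ((2 * ⌊t⌋₊ + 1 : ℕ) : ℝ) ^ Fintype.card ι := by exact_mod_cast h1
  refine h3.trans ?_
  rw [Real.rpow_natCast, ← mul_pow]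
  refine pow_le_pow_left₀ (by positivity) ?_ _
  push_cast
  linarith [Nat.floor_le (show 0 ≤ t by linarith)]

/-- for the one-dimensional case -/
theorem shell_sum_one {s : ℝ} (hs : (Fintype.card ι : ℝ) < s) : ∃ C : ℝ, 0 ≤ C ∧ ∀ (A : ℝ) (g : (ι → ℤ) → ℝ), 0 ≤ A →
    (∀ κ, κ ≠ 0 → g κ ≤ A * ‖vz κ‖ ^ (-s)) → ∀ F : Finset (ι → ℤ), 0 ∉ F → ∑ κ ∈ F, g κ ≤ C * A := by
  classical
  obtain ⟨C, hC, h⟩ := dy_above (by positivity) (vz_count (ι := ι)) (s := s) (le_trans (by positivity) hs.le) hs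
  refine ⟨C, hC, fun A g hA hg F hF => ?_⟩
  have h1 := h 1 le_rfl (F.subtype (· ≠ 0)) (fun κ _ => one_le_vz κ.2)
  rw [Real.one_rpow, mul_one] at h1
  have h2 : ∑ κ ∈ F.subtype (· ≠ 0), ‖vz κ.1‖ ^ (-s) = ∑ κ ∈ F, ‖vz κ‖ ^ (-s) := by
    rw [Finset.sum_subtype_of_mem (fun κ => ‖vz κ‖ ^ (-s))]
    intro κ hκ h0
    exact hF (h0 ▸ hκ)
  rw [h2] at h1
  calc ∑ κ ∈ F, g κ ≤ ∑ κ ∈ F, A * ‖vz κ‖ ^ (-s) := Finset.sum_le_sum fun κ hκ => hg κ (fun h0 => hF (h0 ▸ hκ))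
    _ = A * ∑ κ ∈ F, ‖vz κ‖ ^ (-s) := by rw [Finset.mul_sum]
    _ ≤ A * C := by gcongr
    _ = _ := mul_comm _ _

theorem shell_sum {r M : ℝ} (hr0 : 0 ≤ r) (hr : r < (Fintype.card ι : ℝ)) (hM : (Fintype.card ι : ℝ) < r + M) :
    ∃ C : ℝ, 0 ≤ C ∧ ∀ (A Y : ℝ) (g : (ι → ℤ) → ℝ), 0 ≤ A → 1 ≤ Y →
    (∀ κ, κ ≠ 0 → g κ ≤ A * ‖vz κ‖ ^ (-r)) → (∀ κ, κ ≠ 0 → g κ ≤ A * Y ^ M * ‖vz κ‖ ^ (-(r + M))) → 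
    ∀ F : Finset (ι → ℤ), 0 ∉ F → ∑ κ ∈ F, g κ ≤ C * A * Y ^ ((Fintype.card ι : ℝ) - r) := by
  classical
  obtain ⟨C1, hC1, h1⟩ := dy_below (fun κ => one_le_vz κ.2) (by positivity) (vz_count (ι := ι)) (s := r) hr0 hr
  obtain ⟨C2, hC2, h2⟩ := dy_above (by positivity) (vz_count (ι := ι)) (s := r + M) (by linarith [show (0:ℝ) ≤ Fintype.card ι by positivity]) hM
  refine ⟨C1 + C2, by positivity, fun A Y g hA hY hg1 hg2 F hF => ?_⟩
  have hY0 : 0 < Y := by linarith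
  let S := F.subtype (· ≠ 0)
  have e0 : ∑ κ ∈ F, g κ = ∑ κ ∈ S, g κ.1 := by
    rw [Finset.sum_subtype_of_mem]
    intro κ hκ h0
    exact hF (h0 ▸ hκ)
  rw [e0, ← Finset.sum_filter_add_sum_filter_not S (fun κ => ‖vz κ.1‖ ≤ Y)]
  have a1 := h1 Y hY (S.filter fun κ => ‖vz κ.1‖ ≤ Y) (fun κ hκ => (Finset.mem_filter.mp hκ).2)
  have a2 := h2 Y hY (S.filter fun κ => ¬ ‖vz κ.1‖ ≤ Y) (fun κ hκ => (not_le.mp (Finset.mem_filter.mp hκ).2).le)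
  have b1 : ∑ κ ∈ S with ‖vz κ.1‖ ≤ Y, g κ.1 ≤ A * (C1 * Y ^ ((Fintype.card ι : ℝ) - r)) := by
    refine (Finset.sum_le_sum fun κ _ => hg1 κ.1 κ.2).trans ?_
    rw [← Finset.mul_sum]
    gcongr
  have b2 : ∑ κ ∈ S with ¬ ‖vz κ.1‖ ≤ Y, g κ.1 ≤ A * (C2 * Y ^ ((Fintype.card ι : ℝ) - r)) := by
    refine (Finset.sum_le_sum fun κ _ => hg2 κ.1 κ.2).trans ?_
    rw [← Finset.mul_sum]
    refine (mul_le_mul_of_nonneg_left a2 (by positivity)).trans (le_of_eq ?_)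
    have : Y ^ M * Y ^ ((Fintype.card ι : ℝ) - (r + M)) = Y ^ ((Fintype.card ι : ℝ) - r) := by
      rw [← Real.rpow_add hY0]; congr 1; ring
    rw [← this]; ring
  calc _ ≤ _ := add_le_add b1 b2
    _ = _ := by ring

end Lat

section Concrete
open NumberField NumberField.InfinitePlace NumberField.mixedEmbedding Module
open scoped Classical
open NumberField.Units NumberField.Units.dirichletUnitTheorem NumberField.mixedEmbedding.fundamentalCone
variable (K : Type) [Field K] [NumberField K]
variable {ι : Type*} [Fintype ι]

/-- pairing of the trace form with a basis -/
def pairB (b : Basis ι ℝ (mixedSpace K)) : mixedSpace K →ₗ[ℝ] (ι → ℝ) :=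
  LinearMap.pi fun i => (trV K).toLinearMap ∘ₗ LinearMap.mulRight ℝ (b i)

theorem pairB_apply (b : Basis ι ℝ (mixedSpace K)) (ξ : mixedSpace K) (i : ι) : pairB K b ξ i = trV K (ξ * b i) := rfl

theorem pairB_inj (b : Basis ι ℝ (mixedSpace K)) : Function.Injective (pairB K b) := by
  rw [← LinearMap.ker_eq_bot, LinearMap.ker_eq_bot']
  intro ξ hξ
  refine trV_nd K ξ fun v => ?_
  have : (trV K).toLinearMap ∘ₗ LinearMap.mulLeft ℝ ξ = 0 := by
    refine b.ext fun i => ?_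
    exact congrFun hξ i
  exact LinearMap.congr_fun this v

theorem pairB_equiv (b : Basis ι ℝ (mixedSpace K)) : ∃ e : mixedSpace K ≃ₗ[ℝ] (ι → ℝ), ∀ ξ, e ξ = pairB K b ξ := by
  have h : finrank ℝ (mixedSpace K) = finrank ℝ (ι → ℝ) := by
    rw [finrank_eq_card_basis b, finrank_fintype_fun_eq_card]
  exact ⟨LinearEquiv.ofInjectiveOfFinrankEq (pairB K b) (pairB_inj K b) h, fun ξ => rfl⟩

theorem trV_sum (b : Basis ι ℝ (mixedSpace K)) (ξ : mixedSpace K) (x : ι → ℝ) :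
    trV K (ξ * b.equivFun.symm x) = ∑ i, x i * pairB K b ξ i := by
  rw [Basis.equivFun_symm_apply, Finset.mul_sum, map_sum]
  refine Finset.sum_congr rfl fun i _ => ?_
  rw [mul_smul_comm, map_smul, smul_eq_mul, pairB_apply]

theorem int_basis (b : Basis ι ℝ (mixedSpace K)) : ∃ D : ℝ, 0 < D ∧ ∀ (F : mixedSpace K → ℂ) (T : ℝ), 0 < T →
    ∫ x, F (T⁻¹ • b.equivFun.symm x) = ((D * T ^ (finrank ℚ K) : ℝ) : ℂ) * ∫ y, F y := by
  let e : (ι → ℝ) ≃L[ℝ] mixedSpace K := b.equivFun.symm.toContinuousLinearEquiv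
  let μ : Measure (mixedSpace K) := Measure.map e volume
  haveI : μ.IsAddHaarMeasure := e.isAddHaarMeasure_map volume
  have hμ := Measure.isAddLeftInvariant_eq_smul μ (volume : Measure (mixedSpace K))
  have hc := Measure.addHaarScalarFactor_pos_of_isAddHaarMeasure μ (volume : Measure (mixedSpace K))
  generalize Measure.addHaarScalarFactor μ (volume : Measure (mixedSpace K)) = c at hμ hc
  refine ⟨(c : ℝ), by exact_mod_cast hc, ?_⟩
  intro F T hT
  have h1 : ∫ x, F (T⁻¹ • b.equivFun.symm x) = ∫ y, F (T⁻¹ • y) ∂μ := by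
    have := (e.toHomeomorph.measurableEmbedding.integral_map (μ := volume) (fun y => F (T⁻¹ • y)))
    exact this.symm
  rw [h1, hμ]
  rw [integral_smul_nnreal_measure, Measure.integral_comp_smul, mixedEmbedding.finrank]
  rw [NNReal.smul_def, smul_smul]
  rw [Complex.real_smul]
  congr 3
  rw [inv_pow, inv_inv, abs_of_pos (by positivity)]

end Concrete
end
end HFull


open Filter Topology MeasureTheory
open scoped BigOperators ContDiff

namespace HFull

set_option linter.unusedSectionVars false
set_option linter.style.haveILetI false

noncomputable section
section Concrete
open NumberField NumberField.InfinitePlace NumberField.mixedEmbedding Module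
open scoped Classical
open NumberField.Units NumberField.Units.dirichletUnitTheorem NumberField.mixedEmbedding.fundamentalCone
variable (K : Type) [Field K] [NumberField K]
variable {ι : Type*} [Fintype ι]

theorem lat_fourier (b : Basis ι ℝ (mixedSpace K)) : ∃ (D c : ℝ) (Ξ : (ι → ℤ) → mixedSpace K), 0 < D ∧ 0 < c ∧
    Ξ 0 = 0 ∧ (∀ κ, c * ‖vz κ‖ ≤ ‖Ξ κ‖) ∧ ∀ (G : mixedSpace K → ℂ) (T : ℝ), 0 < T → ∀ κ,
      fhat (fun x => G (T⁻¹ • b.equivFun.symm x)) κ = ((D * T ^ (finrank ℚ K) : ℝ) : ℂ) * 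
        ∫ y, G y * Complex.exp (Complex.I * ((trV K ((T • Ξ κ) * y) : ℝ) : ℂ)) := by
  obtain ⟨D, hD, hint⟩ := int_basis K b
  obtain ⟨e, he⟩ := pairB_equiv K b
  let eC := e.toContinuousLinearEquiv
  refine ⟨D, 2 * Real.pi / (‖(eC : mixedSpace K →L[ℝ] (ι → ℝ))‖ + 1), fun κ => e.symm (-(2 * Real.pi) • vz κ), hD, by positivity, ?_, ?_, ?_⟩
  · have : vz (0 : ι → ℤ) = 0 := by ext; simp [vz]
    simp [this]
  · intro κ
    have h1 : ‖eC (e.symm (-(2 * Real.pi) • vz κ))‖ ≤ ‖(eC : mixedSpace K →L[ℝ] (ι → ℝ))‖ * ‖e.symm (-(2 * Real.pi) • vz κ)‖ :=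
      (eC : mixedSpace K →L[ℝ] (ι → ℝ)).le_opNorm _
    have h2 : eC (e.symm (-(2 * Real.pi) • vz κ)) = -(2 * Real.pi) • vz κ := e.apply_symm_apply _
    rw [h2, _root_.norm_smul, norm_neg, Real.norm_of_nonneg (by positivity)] at h1
    rw [div_mul_eq_mul_div, div_le_iff₀ (by positivity)]
    nlinarith [norm_nonneg (e.symm (-(2 * Real.pi) • vz κ))]
  · intro G T hT κ
    rw [← hint _ T hT, fhat]
    congr 1
    funext x
    rw [mul_comm]
    congr 2
    have h1 : (T • e.symm (-(2 * Real.pi) • vz κ)) * (T⁻¹ • b.equivFun.symm x) = e.symm (-(2 * Real.pi) • vz κ) * b.equivFun.symm x := by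
      rw [smul_mul_smul_comm, mul_inv_cancel₀ hT.ne', one_smul]
    rw [h1, trV_sum]
    simp only [← he, LinearEquiv.apply_symm_apply]
    push_cast
    rw [Finset.mul_sum, Finset.mul_sum, ← Finset.sum_neg_distrib]
    refine Finset.sum_congr rfl fun i _ => ?_
    simp only [Pi.smul_apply, vz, smul_eq_mul]
    push_cast
    ring

/-- the smoothed cutoff function -/
def GG (a b η : ℝ) (y : mixedSpace K) : ℂ := phi K y * gam a b η (Mn K y)

/-- admissible parameters -/
def Adm (a b η : ℝ) : Prop := 0 < η ∧ η ≤ 1 ∧ 1/4 ≤ a ∧ a ≤ b ∧ b + η ≤ 2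

theorem Adm.zero {a b η : ℝ} (h : Adm a b η) : ∀ t, t ∉ Set.Icc (1/4 : ℝ) 2 → gam a b η t = 0 := by
  intro t ht
  rw [gam, gamR_zero h.1 h.2.2.2.1, Complex.ofReal_zero]
  intro h2
  exact ht ⟨h.2.2.1.trans h2.1, h2.2.trans h.2.2.2.2⟩

theorem GG_cont {a b η : ℝ} (h : Adm a b η) : Continuous (GG K a b η) :=
  cont_G K _ (gam_contDiff a b η).continuous h.zero

theorem GG_zero {a b η : ℝ} (h : Adm a b η) {y : mixedSpace K} (hy : y ∉ Kset K) : GG K a b η y = 0 := by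
  unfold GG
  by_cases h1 : Mn K y ∈ Set.Icc (1/4 : ℝ) 2
  · have h2 : logMap y ∉ cube K := fun h2 => hy ⟨h1, h2⟩
    rw [phi_ne K (by linarith [h1.1] : Mn K y ≠ 0), PhiL_zero K _ h2, zero_mul]
  · rw [h.zero _ h1, mul_zero]

theorem GG_supp {a b η : ℝ} (h : Adm a b η) : HasCompactSupport (GG K a b η) :=
  HasCompactSupport.intro (isCompact_Kset K) fun _ hy => GG_zero K h hy

theorem GGf_cont {a b η : ℝ} (h : Adm a b η) (B : Basis ι ℝ (mixedSpace K)) (T : ℝ) :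
    Continuous (fun x => GG K a b η (T⁻¹ • B.equivFun.symm x)) := by
  have h1 : Continuous (B.equivFun.symm) := LinearMap.continuous_of_finiteDimensional B.equivFun.symm.toLinearMap
  have h2 : Continuous fun x => T⁻¹ • B.equivFun.symm x := Continuous.comp (continuous_const_smul T⁻¹) h1
  exact (GG_cont K h).comp h2

theorem GGf_supp {a b η : ℝ} (h : Adm a b η) (B : Basis ι ℝ (mixedSpace K)) {T : ℝ} (hT : 0 < T) :
    HasCompactSupport (fun x => GG K a b η (T⁻¹ • B.equivFun.symm x)) := by
  let e := B.equivFun.symm.toContinuousLinearEquiv.toHomeomorph.trans (Homeomorph.smulOfNeZero T⁻¹ (inv_ne_zero hT.ne'))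
  exact (GG_supp K h).comp_homeomorph e

theorem lat_bound (B : Basis ι ℝ (mixedSpace K)) : ∃ D : ℝ, 0 < D ∧
    (∀ (a b η : ℝ) (T : ℝ), 0 < T → fhat (fun x => GG K a b η (T⁻¹ • B.equivFun.symm x)) 0 = ((D * T ^ (finrank ℚ K) : ℝ) : ℂ) * ∫ y, GG K a b η y) ∧
    ∀ (k : ℕ), 1 ≤ k → ∃ C T0 : ℝ, 0 ≤ C ∧ 1 ≤ T0 ∧ ∀ T, T0 ≤ T → ∀ a b η, Adm a b η → ∀ κ, κ ≠ 0 →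
      ‖fhat (fun x => GG K a b η (T⁻¹ • B.equivFun.symm x)) κ‖ ≤ C * T ^ (finrank ℚ K) * (η ^ (k - 1))⁻¹ *
        (T * ‖vz κ‖) ^ (-(k + ((finrank ℚ K : ℝ) - 1) / 2)) := by
  obtain ⟨D, c, Ξ, hD, hc, hΞ0, hΞ, hF⟩ := lat_fourier K B
  refine ⟨D, hD, ?_, ?_⟩
  · intro a b η T hT
    rw [hF _ T hT, hΞ0]
    simp
  intro k hk
  obtain ⟨C1, c1, hC1, hc1, h1⟩ := decayK K k
  obtain ⟨C2, hC2, h2⟩ := gam_bound k hk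
  have hn : (1:ℝ) ≤ finrank ℚ K := by exact_mod_cast (finrank_pos (R := ℚ) (M := K))
  have hk' : (1:ℝ) ≤ k := by exact_mod_cast hk
  set p : ℝ := k + ((finrank ℚ K : ℝ) - 1) / 2 with hp
  have hp0 : 0 ≤ p := by rw [hp]; linarith
  refine ⟨D * C1 * C2 * c ^ (-p), max 1 (c1 * c)⁻¹, by positivity, le_max_left _ _, ?_⟩
  intro T hT a b η hadm κ hκ
  have hT1 : 1 ≤ T := (le_max_left _ _).trans hT
  have hT0 : 0 < T := by linarith
  have hTc : 1 ≤ c1 * c * T := by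
    have := (le_max_right _ _).trans hT
    rwa [inv_le_iff_one_le_mul₀' (by positivity)] at this
  rw [hF _ T hT0 κ, norm_mul, Complex.norm_real, Real.norm_of_nonneg (by positivity)]
  have hv := one_le_vz hκ
  have hnorm : c * (T * ‖vz κ‖) ≤ ‖T • Ξ κ‖ := by
    rw [_root_.norm_smul, Real.norm_of_nonneg hT0.le]
    nlinarith [hΞ κ]
  have hbig : 1 ≤ c1 * ‖T • Ξ κ‖ := by
    have h5 : c * T ≤ ‖T • Ξ κ‖ := le_trans (by nlinarith [mul_pos hc hT0]) hnorm
    nlinarith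
  have h3 := h1 (gam a b η) (C2 * (η ^ (k-1))⁻¹) (T • Ξ κ) (gam_contDiff a b η) hadm.zero
    (h2 a b η hadm.1 hadm.2.1 hadm.2.2.2.1 (by linarith [hadm.2.2.1, hadm.2.2.2.2])) hbig
  have h4 : ‖T • Ξ κ‖ ^ (-p) ≤ c ^ (-p) * (T * ‖vz κ‖) ^ (-p) := by
    rw [← Real.mul_rpow hc.le (by positivity)]
    exact Real.rpow_le_rpow_of_nonpos (by positivity) hnorm (by linarith)
  have hη := hadm.1
  calc _ ≤ (D * T ^ finrank ℚ K) * (C1 * (C2 * (η ^ (k-1))⁻¹) * ‖T • Ξ κ‖ ^ (-p)) := by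
        refine mul_le_mul_of_nonneg_left ?_ (by positivity)
        exact h3
    _ ≤ (D * T ^ finrank ℚ K) * (C1 * (C2 * (η ^ (k-1))⁻¹) * (c ^ (-p) * (T * ‖vz κ‖) ^ (-p))) := by gcongr
    _ = _ := by ring

/-- the exponent in Landau's theorem (slightly worse in degree one) -/
def theta (n : ℕ) : ℝ := if n = 1 then 1/2 else 1 - 2 / ((n:ℝ) + 1)

/-- the smoothing parameter -/
def etaT (n : ℕ) (T : ℝ) : ℝ := T ^ ((n:ℝ) * (theta n - 1))

theorem lat_main (B : Basis ι ℝ (mixedSpace K)) : ∃ D C T0 : ℝ, 0 < D ∧ 0 ≤ C ∧ 1 ≤ T0 ∧ ∀ T, T0 ≤ T → ∀ a b,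
    Adm a b (etaT (finrank ℚ K) T) → 
      ‖(∑' m : ι → ℤ, GG K a b (etaT (finrank ℚ K) T) (T⁻¹ • B.equivFun.symm (vz m))) - 
        ((D * T ^ (finrank ℚ K) : ℝ) : ℂ) * ∫ y, GG K a b (etaT (finrank ℚ K) T) y‖ ≤ C * T ^ ((finrank ℚ K : ℝ) * theta (finrank ℚ K)) := by
  obtain ⟨D, hD, h0, hb⟩ := lat_bound K B
  have hcard : Fintype.card ι = finrank ℚ K := by
    rw [← mixedEmbedding.finrank K, finrank_eq_card_basis B]
  have hn1 : 1 ≤ finrank ℚ K := finrank_pos (R := ℚ) (M := K)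
  set n := finrank ℚ K with hn
  by_cases h1 : n = 1
  · obtain ⟨C, T0, hC, hT0, hbd⟩ := hb 2 (by norm_num)
    obtain ⟨C', hC', hs⟩ := shell_sum_one (ι := ι) (s := 2) (by rw [hcard, h1]; norm_num)
    refine ⟨D, C' * C, T0, hD, by positivity, hT0, ?_⟩
    intro T hT a b hadm
    have hT1 : 1 ≤ T := hT0.trans hT
    have hT0' : 0 < T := by linarith
    rw [← h0 a b _ T hT0']
    refine poisson_bound _ (GGf_cont K hadm B T) (GGf_supp K hadm B hT0') _ ?_
    intro F hF
    rw [mul_assoc]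
    refine hs (C * T ^ ((n:ℝ) * theta n)) _ (by positivity) (fun κ hκ => ?_) F hF
    refine (hbd T hT a b _ hadm κ hκ).trans ?_
    have hv := one_le_vz hκ
    have e1 : etaT n T = T ^ (-(1/2) : ℝ) := by rw [etaT, theta, if_pos h1, h1]; norm_num
    rw [e1, theta, if_pos h1, h1]
    have e3 : (-((2:ℕ) + (((1:ℕ):ℝ) - 1)/2) : ℝ) = -2 := by norm_num
    rw [e3, Real.mul_rpow hT0'.le (by positivity)]
    have e2 : T ^ 1 * ((T ^ (-(1/2) : ℝ)) ^ (2 - 1))⁻¹ * T ^ (-2 : ℝ) ≤ T ^ (((1:ℕ):ℝ) * (1/2)) := by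
      rw [pow_one, show (2:ℕ) - 1 = 1 from rfl, pow_one, ← Real.rpow_neg hT0'.le]
      nth_rewrite 1 [← Real.rpow_one T]
      rw [← Real.rpow_add hT0', ← Real.rpow_add hT0']
      exact Real.rpow_le_rpow_of_exponent_le hT1 (by norm_num)
    calc _ = C * (T ^ 1 * ((T ^ (-(1/2) : ℝ)) ^ (2 - 1))⁻¹ * T ^ (-2 : ℝ)) * ‖vz κ‖ ^ (-2 : ℝ) := by ring
      _ ≤ _ := by gcongr
  · have hn2 : 2 ≤ n := by omega
    have hn2' : (2:ℝ) ≤ n := by exact_mod_cast hn2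
    obtain ⟨C1, T1, hC1, hT1, hb1⟩ := hb 1 le_rfl
    obtain ⟨C2, T2, hC2, hT2, hb2⟩ := hb (n+1) (by omega)
    set r : ℝ := ((n:ℝ) + 1)/2 with hr
    obtain ⟨C', hC', hs⟩ := shell_sum (ι := ι) (r := r) (M := n) (by rw [hr]; positivity) (by rw [hcard, hr]; linarith) (by rw [hcard, hr]; linarith)
    refine ⟨D, C' * (C1 + C2), max T1 T2, hD, by positivity, hT1.trans (le_max_left _ _), ?_⟩
    intro T hT a b hadm
    have hTa : T1 ≤ T := (le_max_left _ _).trans hT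
    have hTb : T2 ≤ T := (le_max_right _ _).trans hT
    have hTT : 1 ≤ T := hT1.trans hTa
    have hT0 : 0 < T := by linarith
    rw [← h0 a b _ T hT0]
    refine poisson_bound _ (GGf_cont K hadm B T) (GGf_supp K hadm B hT0) _ ?_
    intro F hF
    set η := etaT n T with hη
    have hη0 : 0 < η := hadm.1
    have hY : 1 ≤ (η * T)⁻¹ ∧ T ^ ((n:ℝ) - r) * ((η * T)⁻¹) ^ ((n:ℝ) - r) = T ^ ((n:ℝ) * theta n) := by
      have e1 : (η * T)⁻¹ = T ^ (((n:ℝ) - 1) / (n + 1)) := by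
        rw [hη, etaT, theta, if_neg h1]
        nth_rewrite 2 [← Real.rpow_one T]
        rw [← Real.rpow_add hT0, ← Real.rpow_neg hT0.le]
        congr 1
        field_simp
        ring
      rw [e1]
      refine ⟨Real.one_le_rpow hTT (div_nonneg (by linarith) (by linarith)), ?_⟩
      rw [← Real.rpow_mul hT0.le, ← Real.rpow_add hT0, theta, if_neg h1]
      congr 1
      rw [hr]
      field_simp
      ring
    have := hs ((C1 + C2) * T ^ ((n:ℝ) - r)) (η * T)⁻¹ (fun κ => ‖fhat (fun x => GG K a b η (T⁻¹ • B.equivFun.symm x)) κ‖) (by positivity) hY.1 (fun κ hκ => ?_) (fun κ hκ => ?_) F hF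
    · refine this.trans (le_of_eq ?_)
      rw [hcard, ← hY.2]; ring
    · refine (hb1 T hTa a b _ hadm κ hκ).trans ?_
      have hv := one_le_vz hκ
      have e3 : (-((1:ℕ) + ((n:ℝ) - 1)/2) : ℝ) = -r := by rw [hr]; push_cast; ring
      rw [e3, Real.mul_rpow hT0.le (by positivity), sub_eq_add_neg, Real.rpow_add hT0, Real.rpow_natCast]
      simp only [Nat.sub_self, pow_zero, inv_one, mul_one]
      have : 0 ≤ C2 * (T ^ n * (T ^ (-r) * ‖vz κ‖ ^ (-r))) := by positivity
      nlinarith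
    · refine (hb2 T hTb a b _ hadm κ hκ).trans ?_
      have hv := one_le_vz hκ
      have e3 : (-(((n+1 : ℕ):ℝ) + ((n:ℝ) - 1)/2) : ℝ) = -(r + n) := by rw [hr]; push_cast; ring
      rw [e3, Real.mul_rpow hT0.le (by positivity), sub_eq_add_neg, Real.rpow_add hT0, Real.rpow_natCast, Real.rpow_natCast]
      simp only [Nat.add_sub_cancel]
      have e4 : T ^ (-(r + (n:ℝ))) = T ^ (-r) * (T ^ n)⁻¹ := by
        rw [neg_add, Real.rpow_add hT0, Real.rpow_neg hT0.le (n:ℝ), Real.rpow_natCast]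
      rw [e4]
      have : 0 ≤ C1 * (T ^ n * ((η ^ n)⁻¹ * (T ^ (-r) * (T ^ n)⁻¹ * ‖vz κ‖ ^ (-(r + (n:ℝ)))))) := by positivity
      calc _ = C2 * (T ^ n * ((η ^ n)⁻¹ * (T ^ (-r) * (T ^ n)⁻¹ * ‖vz κ‖ ^ (-(r + (n:ℝ)))))) := by ring
        _ ≤ (C1 + C2) * (T ^ n * ((η ^ n)⁻¹ * (T ^ (-r) * (T ^ n)⁻¹ * ‖vz κ‖ ^ (-(r + (n:ℝ)))))) := by linarith
        _ = _ := by rw [inv_pow, mul_pow, mul_inv]; ring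

end Concrete
end
end HFull

open Filter Topology MeasureTheory
open scoped BigOperators ContDiff

namespace HFull

set_option linter.unusedSectionVars false
set_option linter.style.haveILetI false

noncomputable section
section Concrete
open NumberField NumberField.InfinitePlace NumberField.mixedEmbedding Module
open scoped Classical
open NumberField.Units NumberField.Units.dirichletUnitTheorem NumberField.mixedEmbedding.fundamentalCone
variable (K : Type) [Field K] [NumberField K]
variable {ι : Type*} [Fintype ι]

theorem rho_nonneg (x : ℝ) : 0 ≤ rho x := by
  have := Real.smoothTransition.monotone (by linarith : x ≤ x + 1)
  simp only [rho]; linarith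

theorem rho_le_one (x : ℝ) : rho x ≤ 1 := by
  have h1 := Real.smoothTransition.le_one (x + 1)
  have h2 := Real.smoothTransition.nonneg x
  simp only [rho]; linarith

/-- real valued version of `phi` -/
def phiR (y : mixedSpace K) : ℝ := if Mn K y = 0 then 0 else ∏ j, rho ((ubas K).repr (logMap y) j)

theorem phi_ofReal (y : mixedSpace K) : phi K y = ((phiR K y : ℝ) : ℂ) := by
  unfold phi phiR PhiL
  split_ifs <;> simp

theorem phiR_nonneg (y : mixedSpace K) : 0 ≤ phiR K y := by
  unfold phiR; split_ifs
  · exact le_rfl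
  · exact Finset.prod_nonneg fun _ _ => rho_nonneg _

theorem phiR_le_one (y : mixedSpace K) : phiR K y ≤ 1 := by
  unfold phiR; split_ifs
  · exact zero_le_one
  · exact Finset.prod_le_one (fun _ _ => rho_nonneg _) fun _ _ => rho_le_one _

theorem phiR_smul (σ : ℝ) (hσ : 0 < σ) (y : mixedSpace K) : phiR K (σ • y) = phiR K y := by
  have := phi_smul K σ hσ y
  rw [phi_ofReal, phi_ofReal] at this
  exact_mod_cast this

theorem measurable_logMap : Measurable (logMap (K := K)) := by
  refine measurable_pi_iff.mpr fun w ↦ measurable_const.mul ?_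
  exact (continuous_normAtPlace _).measurable.log.sub <|
    (mixedEmbedding.continuous_norm _).measurable.log.mul measurable_const

theorem measurable_phiR : Measurable (phiR K) := by
  unfold phiR
  refine Measurable.ite ((continuous_Mn K).measurable (measurableSet_singleton 0)) measurable_const ?_
  refine Finset.measurable_prod _ fun j _ => ?_
  exact rho_contDiff.continuous.measurable.comp ((continuous_coord K j).measurable.comp (measurable_logMap K))

theorem phiR_zero {y : mixedSpace K} (h : phiR K y ≠ 0) : Mn K y ≠ 0 ∧ logMap y ∈ cube K := by
  have h1 : Mn K y ≠ 0 := by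
    intro h0; apply h; simp [phiR, h0]
  refine ⟨h1, ?_⟩
  by_contra h2
  apply h
  have h3 := PhiL_zero K _ h2
  rw [← phi_ne K h1, phi_ofReal] at h3
  exact_mod_cast h3

theorem phiR_bdd : ∃ R : ℝ, 0 ≤ R ∧ ∀ y, phiR K y ≠ 0 → ‖y‖ ≤ R * Mn K y := by
  obtain ⟨R, hR⟩ := (isCompact_Kset K).isBounded.exists_norm_le
  refine ⟨max R 0, le_max_right _ _, fun y hy => ?_⟩
  obtain ⟨h1, h2⟩ := phiR_zero K hy
  have h0 : 0 < Mn K y := lt_of_le_of_ne (Mn_nonneg K y) (Ne.symm h1)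
  set s := Mn K y with hs
  have h3 : s⁻¹ • y ∈ Kset K := by
    have hy' : phiR K (s⁻¹ • y) ≠ 0 := by rwa [phiR_smul K _ (inv_pos.2 h0)]
    refine ⟨?_, (phiR_zero K hy').2⟩
    rw [Mn_smul K _ (inv_pos.2 h0), ← hs, inv_mul_cancel₀ h1]
    constructor <;> norm_num
  have h4 := hR _ h3
  rw [_root_.norm_smul, norm_inv, Real.norm_of_nonneg h0.le, inv_mul_le_iff₀ h0] at h4
  nlinarith [le_max_left R 0]

/-- cutoff integrand -/
def wI (t : ℝ) (y : mixedSpace K) : ℝ := if Mn K y ≤ t then phiR K y else 0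

theorem wI_integrable (t : ℝ) : Integrable (wI K t) := by
  obtain ⟨R, hR0, hR⟩ := phiR_bdd K
  have hm : Measurable (wI K t) := Measurable.ite (measurableSet_le (continuous_Mn K).measurable measurable_const) (measurable_phiR K) measurable_const
  refine Integrable.mono' (g := Set.indicator (Metric.closedBall 0 (R * t)) (fun _ => (1:ℝ))) ?_ hm.aestronglyMeasurable ?_
  · rw [integrable_indicator_iff measurableSet_closedBall]
    exact integrableOn_const (isCompact_closedBall _ _).measure_lt_top.ne
  · refine Eventually.of_forall fun y => ?_
    by_cases h : wI K t y = 0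
    · rw [h, norm_zero]; exact Set.indicator_nonneg (fun _ _ => zero_le_one) _
    · have h1 : Mn K y ≤ t := by by_contra h1; exact h (by simp [wI, h1])
      have h2 : wI K t y = phiR K y := by simp [wI, h1]
      rw [h2] at h ⊢
      rw [Set.indicator_of_mem, Real.norm_of_nonneg (phiR_nonneg K y)]
      · exact phiR_le_one K y
      · rw [mem_closedBall_zero_iff]
        exact (hR y h).trans (by gcongr)

theorem wI_scale (t : ℝ) (ht : 0 < t) : ∫ y, wI K t y = t ^ (finrank ℚ K) * ∫ y, wI K 1 y := by
  have h := Measure.integral_comp_smul (volume : Measure (mixedSpace K)) (wI K t) t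
  have h2 : (fun y => wI K t (t • y)) = wI K 1 := by
    funext y
    simp only [wI, phiR_smul K t ht, Mn_smul K t ht]
    congr 1
    simp [ht]
  rw [h2, mixedEmbedding.finrank, abs_of_pos (by positivity)] at h
  rw [h, smul_eq_mul, ← mul_assoc, mul_inv_cancel₀ (by positivity), one_mul]

theorem wI_nonneg (t : ℝ) (y) : 0 ≤ wI K t y := by
  unfold wI; split_ifs; exacts [phiR_nonneg K y, le_rfl]

/-- real version of `GG` -/
def GR (a b η : ℝ) (y : mixedSpace K) : ℝ := phiR K y * gamR a b η (Mn K y)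

theorem GG_ofReal (a b η : ℝ) (y : mixedSpace K) : GG K a b η y = ((GR K a b η y : ℝ) : ℂ) := by
  rw [GG, phi_ofReal, gam, GR]; push_cast; rfl

theorem GR_integrable {a b η : ℝ} (h : Adm a b η) : Integrable (GR K a b η) := by
  have h1 : Integrable (GG K a b η) := (GG_cont K h).integrable_of_hasCompactSupport (GG_supp K h)
  have := h1.re
  refine this.congr (Eventually.of_forall fun y => ?_)
  simp [GG_ofReal]

theorem GG_int (a b η : ℝ) : ∫ y, GG K a b η y = ((∫ y, GR K a b η y : ℝ) : ℂ) := by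
  simp only [GG_ofReal]
  exact integral_complex_ofReal

theorem GR_int_bounds {a b η : ℝ} (h : Adm a b η) (h1 : a + η ≤ b) (h2 : η < a) :
    (b ^ (finrank ℚ K) - (a + η) ^ (finrank ℚ K)) * (∫ y, wI K 1 y) ≤ ∫ y, GR K a b η y ∧ 
    ∫ y, GR K a b η y ≤ ((b + η) ^ (finrank ℚ K) - (a - η) ^ (finrank ℚ K)) * (∫ y, wI K 1 y) := by
  have hη := h.1
  have hab := h.2.2.2.1
  have key : ∀ s t : ℝ, 0 < s → 0 < t → (t ^ (finrank ℚ K) - s ^ (finrank ℚ K)) * (∫ y, wI K 1 y) = ∫ y, (wI K t y - wI K s y) := by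
    intro s t hs ht
    rw [integral_sub (wI_integrable K t) (wI_integrable K s), wI_scale K t ht, wI_scale K s hs]; ring
  rw [key _ _ (by linarith) (by linarith), key _ _ (by linarith) (by linarith)]
  constructor
  · refine integral_mono ((wI_integrable K _).sub (wI_integrable K _)) (GR_integrable K h) fun y => ?_
    have hp := phiR_nonneg K y
    simp only [wI, GR]
    split_ifs with c1 c2 c2
    · have := mul_nonneg hp (gamR_nonneg hη hab (Mn K y)); linarith
    · rw [gamR_one hη ⟨by linarith, c1⟩]; linarith
    · have := mul_nonneg hp (gamR_nonneg hη hab (Mn K y)); linarith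
    · have := mul_nonneg hp (gamR_nonneg hη hab (Mn K y)); linarith
  · refine integral_mono (GR_integrable K h) ((wI_integrable K _).sub (wI_integrable K _)) fun y => ?_
    have hp := phiR_nonneg K y
    simp only [wI, GR]
    split_ifs with c1 c2 c2
    · rw [gamR_zero hη hab (fun hc => by linarith [hc.1])]; linarith
    · nlinarith [gamR_le_one a b η (Mn K y)]
    · rw [gamR_zero hη hab (fun hc => by linarith [hc.2])]; linarith
    · rw [gamR_zero hη hab (fun hc => by linarith [hc.2])]; linarith

theorem pow_lip (n : ℕ) : ∃ C : ℝ, 0 ≤ C ∧ ∀ x y : ℝ, 0 ≤ x → x ≤ 2 → 0 ≤ y → y ≤ 2 → |x ^ n - y ^ n| ≤ C * |x - y| := by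
  refine ⟨n * 2 ^ (n-1), by positivity, fun x y hx hx2 hy hy2 => ?_⟩
  refine (abs_pow_sub_pow_le x y n).trans ?_
  have h1 : max |x| |y| ^ (n - 1) ≤ 2 ^ (n-1) := by
    gcongr
    rw [abs_of_nonneg hx, abs_of_nonneg hy]
    exact max_le hx2 hy2
  have := mul_le_mul_of_nonneg_left h1 (by positivity : (0:ℝ) ≤ |x - y| * n)
  linarith

theorem GR_int_est : ∃ I0 C : ℝ, 0 ≤ C ∧ ∀ η, 0 < η → η ≤ 1/8 → 
    |(∫ y, GR K (1/2) (1 - η) η y) - I0| ≤ C * η ∧ |(∫ y, GR K (1/2 - η) 1 η y) - I0| ≤ C * η := by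
  obtain ⟨C, hC, hl⟩ := pow_lip (finrank ℚ K)
  set w := ∫ y, wI K 1 y with hw
  have hw0 : 0 ≤ w := integral_nonneg fun y => wI_nonneg K 1 y
  refine ⟨(1 ^ (finrank ℚ K) - (1/2) ^ (finrank ℚ K)) * w, 3 * C * w, by positivity, fun η h0 h1 => ?_⟩
  have ha1 : Adm (1/2) (1 - η) η := ⟨h0, by linarith, by norm_num, by linarith, by linarith⟩
  have ha2 : Adm (1/2 - η) 1 η := ⟨h0, by linarith, by linarith, by linarith, by linarith⟩
  have e1 := GR_int_bounds K ha1 (by linarith) (by linarith)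
  have e2 := GR_int_bounds K ha2 (by linarith) (by linarith)
  have L : ∀ x y d : ℝ, 0 ≤ x → x ≤ 2 → 0 ≤ y → y ≤ 2 → |x - y| ≤ d → -(C * d) ≤ x ^ (finrank ℚ K) - y ^ (finrank ℚ K) ∧ x ^ (finrank ℚ K) - y ^ (finrank ℚ K) ≤ C * d := by
    intro x y d a1 a2 a3 a4 a5
    exact abs_le.1 ((hl x y a1 a2 a3 a4).trans (mul_le_mul_of_nonneg_left a5 hC))
  have aa : ∀ x y d : ℝ, x - y ≤ d → -d ≤ x - y → |x - y| ≤ d := fun x y d h1 h2 => abs_le.2 ⟨h2, h1⟩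
  rw [← hw] at e1 e2
  have f1 := L (1 - η) 1 η (by linarith) (by linarith) (by linarith) (by linarith) (aa _ _ _ (by linarith) (by linarith))
  have f2 := L (1/2 + η) (1/2) η (by linarith) (by linarith) (by linarith) (by linarith) (aa _ _ _ (by linarith) (by linarith))
  have f3 := L (1/2 - η) (1/2) η (by linarith) (by linarith) (by linarith) (by linarith) (aa _ _ _ (by linarith) (by linarith))
  have f4 := L (1 + η) 1 η (by linarith) (by linarith) (by linarith) (by linarith) (aa _ _ _ (by linarith) (by linarith))
  have f5 := L (1/2 - η - η) (1/2) (2*η) (by linarith) (by linarith) (by linarith) (by linarith) (aa _ _ _ (by linarith) (by linarith))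
  have g1 : (1 - η + η) = 1 := by ring
  have g2 : (1/2 - η + η) = 1/2 := by ring
  rw [g1] at e1
  rw [g2] at e2
  have hCw : 0 ≤ C * η * w := by positivity
  constructor <;> rw [abs_le] <;> constructor
  · nlinarith [mul_le_mul_of_nonneg_right f1.1 hw0, mul_le_mul_of_nonneg_right f2.2 hw0]
  · nlinarith [mul_le_mul_of_nonneg_right f3.1 hw0]
  · nlinarith [e2.1]
  · nlinarith [mul_le_mul_of_nonneg_right f4.2 hw0, mul_le_mul_of_nonneg_right f5.1 hw0]

end Concrete
end
end HFull

open Filter Topology MeasureTheory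
open scoped BigOperators ContDiff

namespace HFull

set_option linter.unusedSectionVars false
set_option linter.style.haveILetI false

noncomputable section
section Concrete
open NumberField NumberField.InfinitePlace NumberField.mixedEmbedding Module
open scoped Classical
open NumberField.Units NumberField.Units.dirichletUnitTheorem NumberField.mixedEmbedding.fundamentalCone
variable (K : Type) [Field K] [NumberField K]
variable {ι : Type*} [Fintype ι]

theorem rho_zero_ge {x : ℝ} (hx : 1 ≤ x) : rho x = 0 := by
  rw [rho, Real.smoothTransition.one_of_one_le hx, Real.smoothTransition.one_of_one_le (by linarith), sub_self]

theorem rho_zero_le {x : ℝ} (hx : x ≤ -1) : rho x = 0 := by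
  rw [rho, Real.smoothTransition.zero_of_nonpos (by linarith), Real.smoothTransition.zero_of_nonpos (by linarith), sub_self]

theorem rho_tsum {c : ℝ} (hc : c ∈ Set.Ico (0:ℝ) 1) : ∑ e ∈ ({-1, 0} : Finset ℤ), rho (c + (e:ℝ)) = 1 := by
  rw [Finset.sum_pair (by norm_num)]
  push_cast
  simp only [rho]
  rw [add_zero, Real.smoothTransition.one_of_one_le (by linarith [hc.1] : 1 ≤ c + 1), 
    Real.smoothTransition.zero_of_nonpos (by linarith [hc.2] : c + -1 ≤ 0), neg_add_cancel_right]
  ring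

theorem rho_prod_tsum {d : ℕ} (c : Fin d → ℝ) (hc : ∀ j, c j ∈ Set.Ico (0:ℝ) 1) : 
    ∑' e : Fin d → ℤ, ∏ j, rho (c j + (e j : ℝ)) = 1 := by
  rw [tsum_eq_sum (s := Fintype.piFinset fun _ => ({-1, 0} : Finset ℤ))]
  · rw [← Finset.prod_univ_sum (fun _ : Fin d => ({-1, 0} : Finset ℤ)) (fun j e => rho (c j + (e : ℝ)))]
    exact Finset.prod_eq_one fun j _ => rho_tsum (hc j)
  · intro e he
    rw [Fintype.mem_piFinset] at he
    push Not at he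
    obtain ⟨j, hj⟩ := he
    refine Finset.prod_eq_zero (Finset.mem_univ j) ?_
    simp only [Finset.mem_insert, Finset.mem_singleton, not_or] at hj
    rcases lt_or_ge (e j) 0 with h | h
    · have : e j ≤ -2 := by omega
      have : (e j : ℝ) ≤ -2 := by exact_mod_cast this
      exact rho_zero_le (by linarith [(hc j).2])
    · have : 1 ≤ e j := by omega
      have : (1:ℝ) ≤ e j := by exact_mod_cast this
      exact rho_zero_ge (by linarith [(hc j).1])

/-- free unit -/
def uE (e : Fin (Units.rank K) → ℤ) : (𝓞 K)ˣ := ∏ j, (fundSystem K j) ^ (e j)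

theorem log_uE (e : Fin (Units.rank K) → ℤ) (j) : 
    (ubas K).repr (logEmbedding K (Additive.ofMul (uE K e))) j = (e j : ℝ) := by
  have h1 : logEmbedding K (Additive.ofMul (uE K e)) = ∑ i, (e i : ℝ) • ubas K i := by
    rw [uE, ofMul_prod, map_sum]
    refine Finset.sum_congr rfl fun i _ => ?_
    rw [ofMul_zpow, map_zsmul, logEmbedding_fundSystem, ubas, Basis.ofZLatticeBasis_apply, Int.cast_smul_eq_zsmul]
  rw [h1, Basis.repr_sum_self]

theorem norm_cone {x : mixedSpace K} (hx : x ∈ fundamentalCone K) : mixedEmbedding.norm x ≠ 0 := hx.2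

theorem coord_cone {x : mixedSpace K} (hx : x ∈ fundamentalCone K) (j) : (ubas K).repr (logMap x) j ∈ Set.Ico (0:ℝ) 1 :=
  (ZSpan.mem_fundamentalDomain (ubas K)).1 hx.1 j

theorem coord_uE {x : mixedSpace K} (hx : mixedEmbedding.norm x ≠ 0) (e j) : 
    (ubas K).repr (logMap (uE K e • x)) j = (ubas K).repr (logMap x) j + (e j : ℝ) := by
  rw [logMap_unit_smul _ hx, map_add, Finsupp.add_apply, log_uE, add_comm]

theorem Mn_unit (u : (𝓞 K)ˣ) (x : mixedSpace K) : Mn K (u • x) = Mn K x := by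
  rw [Mn, norm_unit_smul, Mn]

variable (J : nonZeroDivisors (Ideal (𝓞 K)))

abbrev JB := fractionalIdealLatticeBasis K (FractionalIdeal.mk0 K J)

theorem JB_iff (w : mixedSpace K) : (∃ m, (JB K J).equivFun.symm (vz m) = w) ↔ ∃ a ∈ (J : Set (𝓞 K)), mixedEmbedding K (a : K) = w := by
  have h1 := mem_span_fractionalIdealLatticeBasis K (FractionalIdeal.mk0 K J) (x := w)
  rw [Submodule.mem_span_range_iff_exists_fun] at h1
  have h2 : ∀ m, (JB K J).equivFun.symm (vz m) = ∑ i, m i • (JB K J) i := by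
    intro m
    rw [Basis.equivFun_symm_apply]
    refine Finset.sum_congr rfl fun i _ => ?_
    rw [vz, Int.cast_smul_eq_zsmul]
  simp only [h2]
  rw [h1]
  simp only [FractionalIdeal.coe_mk0, Set.mem_image, SetLike.mem_coe]
  constructor
  · rintro ⟨x, hx, rfl⟩
    obtain ⟨a, ha, rfl⟩ := (FractionalIdeal.mem_coeIdeal _).1 hx
    exact ⟨a, ha, rfl⟩
  · rintro ⟨a, ha, rfl⟩
    exact ⟨_, (FractionalIdeal.mem_coeIdeal _).2 ⟨a, ha, rfl⟩, rfl⟩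

theorem unit_mem (u : (𝓞 K)ˣ) {w : mixedSpace K} (h : ∃ a ∈ (J : Set (𝓞 K)), mixedEmbedding K (a : K) = w) :
    ∃ a ∈ (J : Set (𝓞 K)), mixedEmbedding K (a : K) = u • w := by
  obtain ⟨a, ha, rfl⟩ := h
  refine ⟨(u : 𝓞 K) * a, Ideal.mul_mem_left _ _ ha, ?_⟩
  rw [unitSMul_smul, ← map_mul]
  rfl

theorem uE_neg_smul (e : Fin (Units.rank K) → ℤ) (w : mixedSpace K) : uE K e • (uE K (-e) • w) = w := by
  have : uE K e * uE K (-e) = 1 := by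
    simp [uE]
  rw [← mul_smul, this, one_smul]

theorem unfold_map : ∃ g : (idealSet K J) × (Fin (Units.rank K) → ℤ) → (_ → ℤ), Function.Injective g ∧ 
    (∀ p, (JB K J).equivFun.symm (vz (g p)) = uE K p.2 • (p.1 : mixedSpace K)) ∧
    ∀ m, mixedEmbedding.norm ((JB K J).equivFun.symm (vz m)) ≠ 0 → m ∈ Set.range g := by
  have h1 : ∀ p : (idealSet K J) × (Fin (Units.rank K) → ℤ), ∃ m, (JB K J).equivFun.symm (vz m) = uE K p.2 • (p.1 : mixedSpace K) := by
    intro p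
    rw [JB_iff]
    exact unit_mem K J _ (mem_idealSet.1 p.1.2).2
  choose g hg using h1
  have hvinj : Function.Injective (vz : (_ → ℤ) → ((Free.ChooseBasisIndex ℤ (FractionalIdeal.mk0 K J : FractionalIdeal (nonZeroDivisors (𝓞 K)) K)) → ℝ)) := by
    intro m m' h
    funext i
    have := congrFun h i
    simpa [vz] using this
  refine ⟨g, ?_, hg, ?_⟩
  · rintro ⟨a, e⟩ ⟨a', e'⟩ h
    have h2 : uE K e • (a : mixedSpace K) = uE K e' • (a' : mixedSpace K) := by
      rw [← hg (a, e), ← hg (a', e'), h]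
    have ha := (mem_idealSet.1 a.2).1
    have ha' := (mem_idealSet.1 a'.2).1
    have h3 : e = e' := by
      funext j
      have h4 := coord_uE K (norm_cone K ha) e j
      have h5 := coord_uE K (norm_cone K ha') e' j
      rw [h2, h5] at h4
      have c1 := coord_cone K ha j
      have c2 := coord_cone K ha' j
      have h6 : (e j : ℝ) < e' j + 1 := by linarith [c1.1, c2.2]
      have h7 : (e' j : ℝ) < e j + 1 := by linarith [c2.1, c1.2]
      have h6' : e j < e' j + 1 := by exact_mod_cast h6
      have h7' : e' j < e j + 1 := by exact_mod_cast h7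
      omega
    subst h3
    have h8 : (a : mixedSpace K) = a' := MulAction.injective (uE K e) h2
    rw [Subtype.ext h8]
  · intro m hm
    set w := (JB K J).equivFun.symm (vz m) with hw
    let e : Fin (Units.rank K) → ℤ := fun j => ⌊(ubas K).repr (logMap w) j⌋
    have h2 : uE K (-e) • w ∈ idealSet K J := by
      rw [mem_idealSet]
      refine ⟨⟨(ZSpan.mem_fundamentalDomain (ubas K)).2 fun j => ?_, ?_⟩, unit_mem K J _ ((JB_iff K J w).1 ⟨m, hw.symm⟩)⟩
      · rw [coord_uE K hm]
        have a1 := Int.floor_le ((ubas K).repr (logMap w) j)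
        have a2 := Int.lt_floor_add_one ((ubas K).repr (logMap w) j)
        simp only [Pi.neg_apply, e, Int.cast_neg]
        constructor <;> linarith
      · rw [Set.mem_ofPred_eq, norm_unit_smul]; exact hm
    refine ⟨(⟨_, h2⟩, e), hvinj ((JB K J).equivFun.symm.injective ?_)⟩
    rw [hg]
    exact uE_neg_smul K e w

/-- **Unfolding.** -/
theorem unfold_sum {a b η : ℝ} (h : Adm a b η) {T : ℝ} (hT : 0 < T) : 
    (Function.support fun x : idealSet K J => gamR a b η (T⁻¹ * Mn K (x : mixedSpace K))).Finite ∧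
    ∑' m, GG K a b η (T⁻¹ • (JB K J).equivFun.symm (vz m)) = 
      ((∑' x : idealSet K J, gamR a b η (T⁻¹ * Mn K (x : mixedSpace K)) : ℝ) : ℂ) := by
  obtain ⟨g, ginj, gv, gs⟩ := unfold_map K J
  let f : (_ → ℤ) → ℝ := fun m => GR K a b η (T⁻¹ • (JB K J).equivFun.symm (vz m))
  have hTi : 0 < T⁻¹ := inv_pos.2 hT
  have hfin : f.support.Finite := by
    obtain ⟨Fs, hFs⟩ := finite_supp _ (GGf_supp K h (JB K J) hT) 0
    refine Fs.finite_toSet.subset fun m hm => ?_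
    refine hFs 0 norm_zero.le m ?_
    rw [zero_add, GG_ofReal]
    exact_mod_cast hm
  have hsup : f.support ⊆ Set.range g := by
    intro m hm
    apply gs
    intro h0
    apply hm
    have h1 : Mn K ((JB K J).equivFun.symm (vz m)) = 0 := by
      by_contra h1; exact (Mn_ne_zero K).1 h1 h0
    simp only [f, GR, phiR_smul K _ hTi]
    rw [phiR, if_pos h1, zero_mul]
  have hfg : ∀ p, f (g p) = gamR a b η (T⁻¹ * Mn K (p.1 : mixedSpace K)) * ∏ j, rho ((ubas K).repr (logMap (p.1 : mixedSpace K)) j + (p.2 j : ℝ)) := by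
    intro p
    have ha := (mem_idealSet.1 p.1.2).1
    have hn := norm_cone K ha
    simp only [f, gv, GR, phiR_smul K _ hTi, Mn_smul K _ hTi, Mn_unit]
    rw [phiR, Mn_unit, if_neg ((Mn_ne_zero K).2 hn), mul_comm]
    simp only [coord_uE K hn]
  have hsum1 : Summable f := summable_of_hasFiniteSupport hfin
  have hsum2 : Summable (f ∘ g) := (ginj.summable_iff (fun x hx => by
    by_contra h0; exact hx (hsup h0))).2 hsum1
  have hin : ∀ x : idealSet K J, ∑' e, f (g (x, e)) = gamR a b η (T⁻¹ * Mn K (x : mixedSpace K)) := by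
    intro x
    simp only [hfg]
    rw [tsum_mul_left, rho_prod_tsum, mul_one]
    exact coord_cone K (mem_idealSet.1 x.2).1
  constructor
  · have h3 : (Function.support (f ∘ g)).Finite := by
      have : Function.support (f ∘ g) = g ⁻¹' f.support := rfl
      rw [this]
      exact hfin.preimage ginj.injOn
    refine (h3.image Prod.fst).subset fun x hx => ?_
    have hx' : ∑' e, f (g (x, e)) ≠ 0 := by rw [hin]; exact hx
    obtain ⟨e, he⟩ : ∃ e, f (g (x, e)) ≠ 0 := by
      by_contra hne
      push Not at hne
      exact hx' (by simp [hne])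
    exact ⟨(x, e), he, rfl⟩
  · have h4 : ∑' m, f m = ∑' x : idealSet K J, gamR a b η (T⁻¹ * Mn K (x : mixedSpace K)) := by
      rw [← ginj.tsum_eq hsup]
      have h5 := Summable.tsum_prod hsum2
      simp only [Function.comp_apply, hin] at h5
      exact h5
    rw [← h4, Complex.ofReal_tsum]
    simp only [f, GG_ofReal]

end Concrete
end
end HFull

open Filter Topology MeasureTheory
open scoped BigOperators ContDiff

namespace HFull

set_option linter.unusedSectionVars false
set_option linter.style.haveILetI false

noncomputable section
section Concrete
open NumberField NumberField.InfinitePlace NumberField.mixedEmbedding Module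
open scoped Classical
open NumberField.Units NumberField.Units.dirichletUnitTheorem NumberField.mixedEmbedding.fundamentalCone
variable (K : Type) [Field K] [NumberField K]
variable {ι : Type*} [Fintype ι]

theorem theta_pos {n : ℕ} (hn : 1 ≤ n) : 0 < theta n := by
  unfold theta; split_ifs with h
  · norm_num
  · have : (2:ℝ) ≤ n := by exact_mod_cast (by omega : 2 ≤ n)
    rw [sub_pos, div_lt_one (by linarith)]; linarith

theorem theta_lt {n : ℕ} : theta n < 1 := by
  unfold theta; split_ifs with h
  · norm_num
  · have : (0:ℝ) < 2 / ((n:ℝ) + 1) := by positivity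
    linarith

theorem etaT_small {n : ℕ} (hn : 1 ≤ n) : ∃ T1 : ℝ, 1 ≤ T1 ∧ ∀ T, T1 ≤ T → 0 < etaT n T ∧ etaT n T ≤ 1/8 := by
  have hn' : (1:ℝ) ≤ n := by exact_mod_cast hn
  have h1 : 0 < (n:ℝ) * (1 - theta n) := mul_pos (by linarith) (by linarith [theta_lt (n := n)])
  have h2 := (tendsto_rpow_neg_atTop h1).eventually (ge_mem_nhds (by norm_num : (0:ℝ) < 1/8))
  obtain ⟨T1, hT1⟩ := eventually_atTop.1 h2
  refine ⟨max T1 1, le_max_right _ _, fun T hT => ⟨?_, ?_⟩⟩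
  · exact Real.rpow_pos_of_pos (by linarith [le_max_right T1 1]) _
  · have := hT1 T (le_trans (le_max_left _ _) hT)
    have e : (n:ℝ) * (theta n - 1) = -((n:ℝ) * (1 - theta n)) := by ring
    rwa [etaT, e]

variable (J : nonZeroDivisors (Ideal (𝓞 K)))

theorem Pset_finite (X : ℝ) : {a : idealSet K J | mixedEmbedding.norm (a : mixedSpace K) ≤ X}.Finite := by
  have h1 : ∀ i : ℕ, {a : idealSet K J | mixedEmbedding.norm (a : mixedSpace K) = i}.Finite := by
    intro i
    have : Finite {I : nonZeroDivisors (Ideal (𝓞 K)) // (J : Ideal (𝓞 K)) ∣ I ∧ Submodule.IsPrincipal (I : Ideal (𝓞 K)) ∧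
        Ideal.absNorm (I : Ideal (𝓞 K)) = i} := 
      Set.Finite.subset (Ideal.finite_setOfPred_absNorm_le₀ (S := 𝓞 K) i) (fun I hI => hI.2.2.le)
    exact Finite.of_equiv _ (idealSetEquivNorm K J i).symm
  refine (Set.Finite.biUnion (Set.finite_Iic ⌊X⌋₊) (fun i _ => h1 i)).subset fun a ha => ?_
  have h2 := intNorm_idealSetEquiv_apply a
  rw [Set.mem_ofPred_eq, ← h2] at ha
  simp only [Set.mem_iUnion]
  exact ⟨_, Nat.le_floor ha, h2.symm⟩

theorem norm_le_iff {T : ℝ} (hT : 0 ≤ T) (y : mixedSpace K) : mixedEmbedding.norm y ≤ T ^ (finrank ℚ K) ↔ Mn K y ≤ T := by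
  rw [← Mn_pow, pow_le_pow_iff_left₀ (Mn_nonneg K y) hT finrank_pos.ne']

/-- counting function of the ideal set -/
def Pc (X : ℝ) : ℝ := ({a : idealSet K J | mixedEmbedding.norm (a : mixedSpace K) ≤ X}.ncard : ℝ)

theorem Pc_mono {X Y : ℝ} (h : X ≤ Y) : Pc K J X ≤ Pc K J Y := by
  unfold Pc
  exact_mod_cast Set.ncard_le_ncard (fun a (ha : _ ≤ X) => ha.trans h) (Pset_finite K J Y)

theorem Pc_nonneg (X : ℝ) : 0 ≤ Pc K J X := Nat.cast_nonneg _

/-- dyadic shell -/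
def Qset (T : ℝ) : Set (idealSet K J) := {a | T / 2 < Mn K (a : mixedSpace K) ∧ Mn K (a : mixedSpace K) ≤ T}

theorem Qset_finite {T : ℝ} (hT : 0 ≤ T) : (Qset K J T).Finite := 
  (Pset_finite K J (T ^ (finrank ℚ K))).subset fun _ ha => (norm_le_iff K hT _).2 ha.2

theorem Pc_split {T : ℝ} (hT : 0 ≤ T) : Pc K J (T ^ (finrank ℚ K)) = Pc K J ((T/2) ^ (finrank ℚ K)) + ((Qset K J T).ncard : ℝ) := by
  unfold Pc
  rw [← Nat.cast_add, ← Set.ncard_union_eq _ (Pset_finite K J _) (Qset_finite K J hT)]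
  · congr 2
    ext a
    simp only [Set.mem_union, Set.mem_ofPred_eq, norm_le_iff K hT, norm_le_iff K (by linarith : 0 ≤ T/2), Qset]
    constructor
    · intro h
      by_cases h2 : Mn K (a : mixedSpace K) ≤ T / 2
      · exact Or.inl h2
      · exact Or.inr ⟨not_le.1 h2, h⟩
    · rintro (h | h)
      · linarith
      · exact h.2
  · rw [Set.disjoint_left]
    intro a ha hb
    have := (norm_le_iff K (by linarith : 0 ≤ T/2) _).1 ha
    exact absurd this (not_le.2 hb.1)

theorem Q_est : ∃ E C T0 : ℝ, 0 ≤ C ∧ 1 ≤ T0 ∧ ∀ T, T0 ≤ T → 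
    |((Qset K J T).ncard : ℝ) - E * T ^ (finrank ℚ K)| ≤ C * T ^ ((finrank ℚ K : ℝ) * theta (finrank ℚ K)) := by
  obtain ⟨D, C, T0, hD, hC, hT0, hmain⟩ := lat_main K (JB K J)
  obtain ⟨I0, C1, hC1, hI⟩ := GR_int_est K
  obtain ⟨T1, hT1, hη⟩ := etaT_small (n := finrank ℚ K) finrank_pos
  refine ⟨D * I0, C + D * C1, max T0 T1, by positivity, hT0.trans (le_max_left _ _), fun T hT => ?_⟩
  have hTa : T0 ≤ T := (le_max_left _ _).trans hT
  have hTb : T1 ≤ T := (le_max_right _ _).trans hT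
  have hT0' : 0 < T := by linarith
  obtain ⟨hη0, hη8⟩ := hη T hTb
  have hpow : T ^ (finrank ℚ K) * etaT (finrank ℚ K) T = T ^ ((finrank ℚ K : ℝ) * theta (finrank ℚ K)) := by
    rw [etaT, ← Real.rpow_natCast, ← Real.rpow_add hT0']; congr 1; ring
  set η := etaT (finrank ℚ K) T with hηd
  have ha1 : Adm (1/2) (1 - η) η := ⟨hη0, by linarith, by norm_num, by linarith, by linarith⟩
  have ha2 : Adm (1/2 - η) 1 η := ⟨hη0, by linarith, by linarith, by linarith, by linarith⟩
  have tr : ∀ a b, Adm a b η → |(∫ y, GR K a b η y) - I0| ≤ C1 * η → 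
      |(∑' x : idealSet K J, gamR a b η (T⁻¹ * Mn K (x : mixedSpace K))) - D * I0 * T ^ (finrank ℚ K)| ≤ (C + D * C1) * T ^ ((finrank ℚ K : ℝ) * theta (finrank ℚ K)) := by
    intro a b hab hi
    have h1 := hmain T hTa a b hab
    rw [(unfold_sum K J hab hT0').2, GG_int, ← Complex.ofReal_mul, ← Complex.ofReal_sub, Complex.norm_real, Real.norm_eq_abs] at h1
    set S := ∑' x : idealSet K J, gamR a b η (T⁻¹ * Mn K (x : mixedSpace K))
    set I := ∫ y, GR K a b η y
    have h2 : S - D * I0 * T ^ (finrank ℚ K) = (S - D * T ^ (finrank ℚ K) * I) + D * T ^ (finrank ℚ K) * (I - I0) := by ring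
    rw [h2]
    refine (abs_add_le _ _).trans ?_
    rw [abs_mul, abs_of_nonneg (by positivity : 0 ≤ D * T ^ (finrank ℚ K))]
    have h3 := mul_le_mul_of_nonneg_left hi (by positivity : 0 ≤ D * T ^ (finrank ℚ K))
    have h4 : D * T ^ (finrank ℚ K) * (C1 * η) = D * C1 * (T ^ (finrank ℚ K) * η) := by ring
    rw [h4, hpow] at h3
    linarith
  have t1 := abs_le.1 (tr _ _ ha1 (hI η hη0 hη8).1)
  have t2 := abs_le.1 (tr _ _ ha2 (hI η hη0 hη8).2)
  have hsc : ∀ y : mixedSpace K, (T⁻¹ * Mn K y ≤ 1 ↔ Mn K y ≤ T) ∧ (1/2 < T⁻¹ * Mn K y ↔ T/2 < Mn K y) := by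
    intro y
    constructor
    · rw [inv_mul_le_iff₀ hT0', mul_one]
    · rw [lt_inv_mul_iff₀ hT0']; constructor <;> intro h <;> linarith
  have up : ((Qset K J T).ncard : ℝ) ≤ ∑' x : idealSet K J, gamR (1/2 - η) 1 η (T⁻¹ * Mn K (x : mixedSpace K)) := by
    have hs : Summable fun x : idealSet K J => gamR (1/2 - η) 1 η (T⁻¹ * Mn K (x : mixedSpace K)) :=
      summable_of_hasFiniteSupport (unfold_sum K J ha2 hT0').1
    have h1 := hs.sum_le_tsum (Qset_finite K J hT0'.le).toFinset (fun x _ => gamR_nonneg ha2.1 ha2.2.2.2.1 _)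
    refine le_trans (le_of_eq ?_) h1
    rw [Set.ncard_eq_toFinset_card _ (Qset_finite K J hT0'.le), Finset.card_eq_sum_ones, Nat.cast_sum]
    refine Finset.sum_congr rfl fun x hx => ?_
    rw [Set.Finite.mem_toFinset] at hx
    rw [gamR_one ha2.1, Nat.cast_one]
    have := ((hsc (x : mixedSpace K)).2).2 hx.1
    exact ⟨by linarith, ((hsc (x : mixedSpace K)).1).2 hx.2⟩
  have low : ∑' x : idealSet K J, gamR (1/2) (1 - η) η (T⁻¹ * Mn K (x : mixedSpace K)) ≤ ((Qset K J T).ncard : ℝ) := by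
    rw [tsum_eq_sum (s := (Qset_finite K J hT0'.le).toFinset)]
    · refine (Finset.sum_le_card_nsmul _ _ 1 fun x _ => gamR_le_one _ _ _ _).trans ?_
      rw [Set.ncard_eq_toFinset_card _ (Qset_finite K J hT0'.le), nsmul_eq_mul, mul_one]
    · intro x hx
      rw [Set.Finite.mem_toFinset] at hx
      by_cases h1 : T⁻¹ * Mn K (x : mixedSpace K) = 1/2
      · rw [h1, gamR, sub_self, mul_zero, Real.smoothTransition.zero_of_nonpos le_rfl, Real.smoothTransition.zero_of_nonpos, sub_self]
        exact mul_nonpos_of_nonneg_of_nonpos (inv_nonneg.2 hη0.le) (by linarith)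
      · apply gamR_zero ha1.1 ha1.2.2.2.1
        intro h2
        apply hx
        refine ⟨((hsc (x : mixedSpace K)).2).1 (lt_of_le_of_ne h2.1 (Ne.symm h1)), ((hsc (x : mixedSpace K)).1).1 (by linarith [h2.2])⟩
  rw [abs_le]
  constructor <;> linarith [t1.1, t2.2]

theorem halving (R : ℝ → ℝ) (α C M T1 : ℝ) (hα : 0 < α) (hC : 0 ≤ C) (hT1 : 0 < T1)
    (h1 : ∀ T, T1 ≤ T → |R T - R (T/2)| ≤ C * T ^ α) (h2 : ∀ T, 0 < T → T ≤ T1 → |R T| ≤ M) :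
    ∃ A, 0 ≤ A ∧ ∀ T, 0 < T → |R T| ≤ M + A * T ^ α := by
  have hq : (2:ℝ) ^ (-α) < 1 := Real.rpow_lt_one_of_one_lt_of_neg (by norm_num) (by linarith)
  set q := (2:ℝ) ^ (-α)
  set A := C / (1 - q) with hA
  have hA0 : 0 ≤ A := div_nonneg hC (by linarith)
  have hAq : C + A * q = A := by
    rw [hA]; field_simp [(by linarith : (1 - q) ≠ 0)]; ring
  refine ⟨A, hA0, ?_⟩
  have key : ∀ k : ℕ, ∀ T, 0 < T → T ≤ 2 ^ k * T1 → |R T| ≤ M + A * T ^ α := by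
    intro k
    induction k with
    | zero => 
      intro T hT hT'
      have := h2 T hT (by simpa using hT')
      have : 0 ≤ A * T ^ α := mul_nonneg hA0 (Real.rpow_nonneg hT.le _)
      linarith
    | succ k ih =>
      intro T hT hT'
      rcases le_total T T1 with h | h
      · have := h2 T hT h
        have : 0 ≤ A * T ^ α := mul_nonneg hA0 (Real.rpow_nonneg hT.le _)
        linarith
      · have e1 := h1 T h
        have e2 := ih (T/2) (by linarith) (by rw [pow_succ] at hT'; linarith)
        have e3 : (T/2) ^ α = q * T ^ α := by
          rw [Real.div_rpow hT.le (by norm_num)]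
          simp only [q]
          rw [Real.rpow_neg (by norm_num)]; ring
        rw [e3] at e2
        have e4 : |R T| ≤ |R T - R (T/2)| + |R (T/2)| := by
          have := abs_add_le (R T - R (T/2)) (R (T/2))
          rwa [sub_add_cancel] at this
        have : A * T ^ α = C * T ^ α + A * (q * T ^ α) := by rw [← mul_assoc, ← add_mul, hAq]
        linarith
  intro T hT
  obtain ⟨k, hk⟩ := pow_unbounded_of_one_lt (T / T1) (by norm_num : (1:ℝ) < 2)
  exact key k T hT (by rw [div_lt_iff₀ hT1] at hk; exact hk.le)

theorem Pc_est : ∃ c A : ℝ, 0 ≤ A ∧ ∀ X, 0 < X → |Pc K J X - c * X| ≤ A * (1 + X ^ theta (finrank ℚ K)) := by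
  obtain ⟨E, C, T0, hC, hT0, hQ⟩ := Q_est K J
  set n := finrank ℚ K with hn
  have hn1 : 1 ≤ n := finrank_pos
  have hn0 : (0:ℝ) < n := by exact_mod_cast hn1
  have h2n : (1/2:ℝ)^n < 1 := pow_lt_one₀ (by norm_num) (by norm_num) (by omega)
  set c := E / (1 - (1/2:ℝ)^n) with hc
  have hcE : c - c * (1/2:ℝ)^n = E := by
    have hne : (1 - (1/2:ℝ)^n) ≠ 0 := by linarith
    rw [← mul_one_sub, hc, div_mul_cancel₀ _ hne]
  obtain ⟨A, hA, hR⟩ := halving (fun T => Pc K J (T ^ n) - c * T ^ n) (n * theta n) C (Pc K J (T0 ^ n) + |c| * T0 ^ n) T0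
    (mul_pos hn0 (theta_pos hn1)) hC (by linarith) (by
      intro T hT
      have e := hQ T hT
      rw [Pc_split K J (by linarith : 0 ≤ T), ← hn]
      convert e using 2
      rw [div_pow, ← hcE, div_pow, one_pow]; ring) (by
      intro T hT hT'
      have e1 : T ^ n ≤ T0 ^ n := by gcongr
      have e2 := Pc_mono K J e1
      have e3 := Pc_nonneg K J (T ^ n)
      refine (abs_sub _ _).trans ?_
      rw [abs_of_nonneg e3, abs_mul, abs_of_nonneg (by positivity : 0 ≤ T ^ n)]
      gcongr)
  refine ⟨c, max A (Pc K J (T0 ^ n) + |c| * T0 ^ n), le_max_of_le_left hA, fun X hX => ?_⟩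
  have := hR (X ^ ((n:ℝ)⁻¹)) (Real.rpow_pos_of_pos hX _)
  rw [Real.rpow_inv_natCast_pow hX.le (by omega), ← Real.rpow_mul hX.le] at this
  have e : (n:ℝ)⁻¹ * (n * theta n) = theta n := by field_simp
  rw [e] at this
  refine this.trans ?_
  have h5 := Real.rpow_nonneg hX.le (theta n)
  nlinarith [le_max_left A (Pc K J (T0 ^ n) + |c| * T0 ^ n), le_max_right A (Pc K J (T0 ^ n) + |c| * T0 ^ n), mul_le_mul_of_nonneg_right (le_max_left A (Pc K J (T0 ^ n) + |c| * T0 ^ n)) h5]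

end Concrete
end
end HFull

open Filter Topology MeasureTheory
open scoped BigOperators ContDiff

namespace HFull

set_option linter.unusedSectionVars false
set_option linter.style.haveILetI false

noncomputable section
section Concrete
open NumberField NumberField.InfinitePlace NumberField.mixedEmbedding Module
open scoped Classical
open NumberField.Units NumberField.Units.dirichletUnitTheorem NumberField.mixedEmbedding.fundamentalCone
variable (K : Type) [Field K] [NumberField K]
variable {ι : Type*} [Fintype ι]

theorem class_card {C : ClassGroup (𝓞 K)} {J : nonZeroDivisors (Ideal (𝓞 K))} {s : ℝ} (hJ : ClassGroup.mk0 J = C⁻¹) :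
    Nat.card {I : nonZeroDivisors (Ideal (𝓞 K)) // Ideal.absNorm (I : Ideal (𝓞 K)) ≤ s ∧ ClassGroup.mk0 I = C}
      = Nat.card {I : nonZeroDivisors (Ideal (𝓞 K)) // (J : Ideal (𝓞 K)) ∣ I ∧ Submodule.IsPrincipal (I : Ideal (𝓞 K)) ∧
        Ideal.absNorm (I : Ideal (𝓞 K)) ≤ s * Ideal.absNorm (J : Ideal (𝓞 K))} := by
  simp_rw [← nonZeroDivisors_dvd_iff_dvd_coe]
  refine Nat.card_congr ?_
  refine ((Equiv.dvd J).subtypeEquiv fun I ↦ ?_).trans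
    (Equiv.subtypeSubtypeEquivSubtypeInter (fun I : nonZeroDivisors (Ideal (𝓞 K)) ↦ J ∣ I) _)
  rw [← ClassGroup.mk0_eq_one_iff (SetLike.coe_mem _)]
  simp_rw [Equiv.dvd_apply, Submonoid.coe_mul, ← Submonoid.mul_def, _root_.map_mul, hJ,
    inv_mul_eq_one, Nat.cast_mul, mul_comm s, eq_comm, and_comm, and_congr_left_iff]
  exact fun _ ↦
    (mul_le_mul_iff_of_pos_left (Nat.cast_pos.mpr (Ideal.absNorm_pos_of_nonZeroDivisors J))).symm

theorem class_est (C : ClassGroup (𝓞 K)) : ∃ c A : ℝ, 0 ≤ A ∧ ∀ s : ℝ, 0 < s → 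
    |(Nat.card {I : nonZeroDivisors (Ideal (𝓞 K)) // Ideal.absNorm (I : Ideal (𝓞 K)) ≤ s ∧ ClassGroup.mk0 I = C} : ℝ) - c * s| ≤ 
      A * (1 + s ^ theta (finrank ℚ K)) := by
  obtain ⟨J, hJ⟩ := ClassGroup.mk0_surjective C⁻¹
  obtain ⟨c, A, hA, h⟩ := Pc_est K J
  have hw : (0:ℝ) < torsionOrder K := by exact_mod_cast Nat.pos_of_ne_zero (torsionOrder_ne_zero K)
  have hj : (0:ℝ) < Ideal.absNorm (J : Ideal (𝓞 K)) := Nat.cast_pos.mpr (Ideal.absNorm_pos_of_nonZeroDivisors J)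
  set j : ℝ := (Ideal.absNorm (J : Ideal (𝓞 K)) : ℝ) with hjd
  set θ := theta (finrank ℚ K)
  refine ⟨c * j / torsionOrder K, A * (1 + j ^ θ) / torsionOrder K, by positivity, fun s hs => ?_⟩
  have h1 := h (s * j) (by positivity)
  have h2 := card_isPrincipal_dvd_norm_le K J (s * j)
  rw [← class_card K hJ] at h2
  have h3 : Pc K J (s * j) = (Nat.card {I : nonZeroDivisors (Ideal (𝓞 K)) // Ideal.absNorm (I : Ideal (𝓞 K)) ≤ s ∧ ClassGroup.mk0 I = C} : ℝ) * torsionOrder K := by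
    rw [Pc, ← Nat.cast_mul, h2]; rfl
  rw [h3] at h1
  set N : ℝ := (Nat.card {I : nonZeroDivisors (Ideal (𝓞 K)) // Ideal.absNorm (I : Ideal (𝓞 K)) ≤ s ∧ ClassGroup.mk0 I = C} : ℝ)
  have h4 : N - c * j / torsionOrder K * s = (N * torsionOrder K - c * (s * j)) / torsionOrder K := by
    field_simp
  rw [h4, abs_div, abs_of_pos hw, div_mul_eq_mul_div]
  gcongr
  refine h1.trans ?_
  rw [mul_assoc]
  gcongr
  rw [Real.mul_rpow hs.le hj.le]
  have a1 := Real.rpow_nonneg hs.le θ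
  have a2 := Real.rpow_nonneg hj.le θ
  nlinarith

theorem card_classes {s : ℝ} (hs : 0 ≤ s) : (Nat.card {I : nonZeroDivisors (Ideal (𝓞 K)) // Ideal.absNorm (I : Ideal (𝓞 K)) ≤ s} : ℝ) = 
    ∑ C : ClassGroup (𝓞 K), (Nat.card {I : nonZeroDivisors (Ideal (𝓞 K)) // Ideal.absNorm (I : Ideal (𝓞 K)) ≤ s ∧ ClassGroup.mk0 I = C} : ℝ) := by
  have : Fintype {I : nonZeroDivisors (Ideal (𝓞 K)) // Ideal.absNorm (I : Ideal (𝓞 K)) ≤ s} := by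
    simp_rw [← Nat.le_floor_iff hs]
    refine @Fintype.ofFinite _ (Ideal.finite_setOfPred_absNorm_le₀ ⌊s⌋₊)
  let e := fun C : ClassGroup (𝓞 K) ↦ Equiv.subtypeSubtypeEquivSubtypeInter
    (fun I : nonZeroDivisors (Ideal (𝓞 K)) ↦ Ideal.absNorm I.1 ≤ s) (fun I ↦ ClassGroup.mk0 I = C)
  simp_rw [← Nat.card_congr (e _), Nat.card_eq_fintype_card, Fintype.subtype_card]
  rw [Fintype.card, Finset.card_eq_sum_card_fiberwise (f := fun I ↦ ClassGroup.mk0 I.1)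
    (t := Finset.univ) (fun _ _ ↦ Finset.mem_univ _), Nat.cast_sum]

/-- number of nonzero ideals of norm at most `x` -/
def Ic (x : ℝ) : ℝ := (Nat.card {I : nonZeroDivisors (Ideal (𝓞 K)) // (Ideal.absNorm (I : Ideal (𝓞 K)) : ℝ) ≤ x} : ℝ)

/-- **Landau's theorem**. -/
theorem landau : ∃ A : ℝ, 0 ≤ A ∧ ∀ x, 1 ≤ x → |Ic K x - kappa K * x| ≤ A * x ^ theta (finrank ℚ K) := by
  choose c A hA h using class_est K
  set θ := theta (finrank ℚ K) with hθ
  have hθ0 : 0 < θ := theta_pos finrank_pos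
  have hθ1 : θ < 1 := theta_lt
  have key : ∀ x, 1 ≤ x → |Ic K x - (∑ C, c C) * x| ≤ (2 * ∑ C, A C) * x ^ θ := by
    intro x hx
    rw [Ic, card_classes K (by linarith), Finset.sum_mul, ← Finset.sum_sub_distrib]
    refine (Finset.abs_sum_le_sum_abs _ _).trans ?_
    rw [Finset.mul_sum, Finset.sum_mul]
    refine Finset.sum_le_sum fun C _ => (h C x (by linarith)).trans ?_
    have : 1 ≤ x ^ θ := Real.one_le_rpow hx hθ0.le
    nlinarith [hA C]
  refine ⟨2 * ∑ C, A C, mul_nonneg (by norm_num) (Finset.sum_nonneg fun C _ => hA C), fun x hx => ?_⟩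
  suffices hk : kappa K = ∑ C, c C by rw [hk]; exact key x hx
  have l1 := NumberField.Ideal.tendsto_norm_le_div_atTop₀ K
  have l2 : Tendsto (fun s => Ic K s / s) atTop (𝓝 (∑ C, c C)) := by
    rw [tendsto_iff_norm_sub_tendsto_zero]
    have l3 : Tendsto (fun s : ℝ => (2 * ∑ C, A C) * s ^ (-(1 - θ))) atTop (𝓝 0) := by
      have := (tendsto_rpow_neg_atTop (by linarith : 0 < 1 - θ)).const_mul (2 * ∑ C, A C)
      simpa using this
    refine squeeze_zero' (Eventually.of_forall fun _ => norm_nonneg _) ?_ l3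
    filter_upwards [eventually_ge_atTop 1] with s hs
    have hs0 : 0 < s := by linarith
    have e1 : Ic K s / s - ∑ C, c C = (Ic K s - (∑ C, c C) * s) / s := by field_simp
    rw [e1, norm_div, Real.norm_eq_abs, Real.norm_of_nonneg hs0.le, div_le_iff₀ hs0]
    refine (key s hs).trans (le_of_eq ?_)
    rw [mul_assoc (2 * ∑ C, A C), ← Real.rpow_add_one hs0.ne']
    congr 2; ring
  have l4 := tendsto_nhds_unique l1 l2
  rw [← l4, kappa]
  congr 1
  ring

end Concrete
end
end HFull

open Filter Topology MeasureTheory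
open scoped BigOperators ContDiff

namespace HFull

set_option linter.unusedSectionVars false

noncomputable section
section Beurling
open scoped Classical
variable {P : Type*} (q : P → ℝ)

/-- norm of a generalised integer -/
def NR (f : P →₀ ℕ) : ℝ := f.prod fun p k => q p ^ k

variable {q}

theorem NR_add (f g : P →₀ ℕ) : NR q (f + g) = NR q f * NR q g :=
  Finsupp.prod_add_index' (fun _ => pow_zero _) (fun _ _ _ => pow_add _ _ _)

theorem NR_zero : NR q (0 : P →₀ ℕ) = 1 := Finsupp.prod_zero_index

theorem NR_smul (k : ℕ) (f : P →₀ ℕ) : NR q (k • f) = NR q f ^ k := by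
  induction k with
  | zero => simp [NR_zero]
  | succ k ih => rw [succ_nsmul, NR_add, ih, pow_succ]

theorem one_le_NR (hq : ∀ p, 1 < q p) (f : P →₀ ℕ) : 1 ≤ NR q f :=
  Finset.prod_induction _ (fun x : ℝ => 1 ≤ x) (fun _ _ a b => one_le_mul_of_one_le_of_one_le a b) le_rfl fun p _ => one_le_pow₀ (hq p).le

theorem NR_pos (hq : ∀ p, 1 < q p) (f : P →₀ ℕ) : 0 < NR q f := lt_of_lt_of_le one_pos (one_le_NR hq f)

theorem NR_single (p : P) : NR q (Finsupp.single p 1) = q p := by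
  simp [NR]

theorem NR_rpow (hq : ∀ p, 1 < q p) (f : P →₀ ℕ) (s : Finset P) (hs : f.support ⊆ s) (σ : ℝ) :
    NR q f ^ (-σ) = ∏ p ∈ s, q p ^ (-((f p : ℝ) * σ)) := by
  rw [NR, Finsupp.prod_of_support_subset _ hs _ (fun _ _ => pow_zero _),
    ← Real.finsetProd_rpow _ _ (fun p _ => pow_nonneg (by linarith [hq p]) _)]
  refine Finset.prod_congr rfl fun p _ => ?_
  rw [← Real.rpow_natCast, ← Real.rpow_mul (by linarith [hq p])]
  congr 1; ring

theorem euler_fin (hq : ∀ p, 1 < q p) (T : Finset ℕ) (σ : ℝ) (s : Finset P) :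
    ∑ f ∈ s.finsupp (fun _ => T), NR q f ^ (-σ) = ∏ p ∈ s, ∑ j ∈ T, q p ^ (-((j : ℝ) * σ)) := by
  rw [Finset.prod_sum]
  have : s.finsupp (fun _ => T) = (s.pi (fun _ => T)).map ⟨Finsupp.indicator s, Finsupp.indicator_injective s⟩ := by
    unfold Finset.finsupp
    congr
  rw [this, Finset.sum_map]
  refine Finset.sum_congr rfl fun f _ => ?_
  simp only [Function.Embedding.coeFn_mk]
  rw [NR_rpow hq _ s (Finsupp.support_indicator_subset _ _), ← Finset.prod_attach]
  refine Finset.prod_congr rfl fun p _ => ?_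
  rw [Finsupp.indicator_of_mem p.2]

/-- exponents in `S` -/
def BS (P : Type*) (S : Finset ℕ) : Set (P →₀ ℕ) := {f | ∀ p, f p = 0 ∨ f p ∈ S}

theorem euler (hq : ∀ p, 1 < q p) (S : Finset ℕ) (h0 : 0 ∉ S) (σ : ℝ)
    (hs : ∀ j ∈ S, Summable fun p => q p ^ (-((j : ℝ) * σ))) :
    Summable (fun f : BS P S => NR q f.1 ^ (-σ)) ∧
    HasProd (fun p => 1 + ∑ j ∈ S, q p ^ (-((j : ℝ) * σ))) (∑' f : BS P S, NR q f.1 ^ (-σ)) := by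
  set w : (P →₀ ℕ) → ℝ := (BS P S).indicator (fun f => NR q f ^ (-σ)) with hw
  have hw0 : ∀ f, 0 ≤ w f := fun f => Set.indicator_nonneg (fun f _ => Real.rpow_nonneg (NR_pos hq f).le _) f
  set A : Finset P → Finset (P →₀ ℕ) := fun s => s.finsupp (fun _ => insert 0 S) with hA
  have memA : ∀ s f, f ∈ A s ↔ f.support ⊆ s ∧ f ∈ BS P S := by
    intro s f
    rw [hA, Finset.mem_finsupp_iff]
    refine and_congr_right fun hf => ⟨fun h p => ?_, fun h p _ => ?_⟩
    · by_cases hp : p ∈ s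
      · simpa using h p hp
      · left; by_contra hne; exact hp (hf (Finsupp.mem_support_iff.2 hne))
    · simpa using h p
  have sumA : ∀ s, ∑ f ∈ A s, w f = ∏ p ∈ s, (1 + ∑ j ∈ S, q p ^ (-((j : ℝ) * σ))) := by
    intro s
    rw [Finset.sum_congr rfl (fun f hf => Set.indicator_of_mem ((memA s f).1 hf).2 _), euler_fin hq]
    refine Finset.prod_congr rfl fun p _ => ?_
    rw [Finset.sum_insert h0]; simp
  have hg : Summable fun p => ∑ j ∈ S, q p ^ (-((j : ℝ) * σ)) := summable_sum hs
  have hg0 : ∀ p, 0 ≤ ∑ j ∈ S, q p ^ (-((j : ℝ) * σ)) := fun p =>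
    Finset.sum_nonneg fun j _ => Real.rpow_nonneg (by linarith [hq p]) _
  have bd : ∀ s, ∑ f ∈ A s, w f ≤ Real.exp (∑' p, ∑ j ∈ S, q p ^ (-((j : ℝ) * σ))) := by
    intro s
    rw [sumA]
    calc _ ≤ ∏ p ∈ s, Real.exp (∑ j ∈ S, q p ^ (-((j : ℝ) * σ))) := by
          refine Finset.prod_le_prod (fun p _ => by linarith [hg0 p]) fun p _ => ?_
          rw [add_comm]; exact Real.add_one_le_exp _
      _ = Real.exp (∑ p ∈ s, ∑ j ∈ S, q p ^ (-((j : ℝ) * σ))) := (Real.exp_sum _ _).symm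
      _ ≤ _ := Real.exp_le_exp.2 (hg.sum_le_tsum _ (fun p _ => hg0 p))
  have hsum : Summable w := by
    refine summable_of_sum_le hw0 (c := Real.exp (∑' p, ∑ j ∈ S, q p ^ (-((j : ℝ) * σ)))) fun u => ?_
    refine le_trans ?_ (bd (u.biUnion fun f => f.support))
    have : ∑ f ∈ u, w f = ∑ f ∈ u with f ∈ BS P S, w f := by
      rw [Finset.sum_filter]
      refine Finset.sum_congr rfl fun f _ => ?_
      split_ifs with hf
      · rfl
      · exact Set.indicator_of_notMem hf _
    rw [this]
    refine Finset.sum_le_sum_of_subset_of_nonneg (fun f hf => ?_) (fun f _ _ => hw0 f)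
    rw [Finset.mem_filter] at hf
    exact (memA _ f).2 ⟨Finset.subset_biUnion_of_mem (fun f : P →₀ ℕ => f.support) hf.1, hf.2⟩
  refine ⟨summable_subtype_iff_indicator.2 hsum, ?_⟩
  have e1 : ∑' f : BS P S, NR q f.1 ^ (-σ) = ∑' f, w f := tsum_subtype (BS P S) (fun f => NR q f ^ (-σ))
  rw [e1]
  have hh := hsum.hasSum
  set Bt : Finset P → Finset (P →₀ ℕ) := fun s => A s with hB
  -- pass through the subtype
  have hh2 : HasSum (fun f : BS P S => NR q f.1 ^ (-σ)) (∑' f, w f) := hasSum_subtype_iff_indicator.2 hh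
  let A2 : Finset P → Finset (BS P S) := fun s => (A s).subtype (· ∈ BS P S)
  have ht : Tendsto A2 atTop atTop := by
    refine Filter.tendsto_atTop_finset_of_monotone ?_ ?_
    · intro s t hst f hf
      simp only [A2, Finset.mem_subtype, memA] at hf ⊢
      exact ⟨hf.1.trans hst, hf.2⟩
    · intro f
      refine ⟨f.1.support, ?_⟩
      simp only [A2, Finset.mem_subtype, memA]
      exact ⟨subset_rfl, f.2⟩
  have hl : Tendsto (fun s => ∑ f ∈ A2 s, NR q f.1 ^ (-σ)) atTop (𝓝 (∑' f, w f)) := by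
    have := hh2
    rw [HasSum, SummationFilter.unconditional_filter] at this
    exact this.comp ht
  rw [HasProd, SummationFilter.unconditional_filter]
  refine hl.congr fun s => ?_
  rw [← sumA]
  have e2 : (A2 s).map (Function.Embedding.subtype _) = A s := by
    rw [Finset.subtype_map, Finset.filter_true_of_mem]
    exact fun f hf => ((memA s f).1 hf).2
  rw [← e2, Finset.sum_map]
  refine Finset.sum_congr rfl fun f _ => ?_
  exact (Set.indicator_of_mem f.2 (fun f => NR q f ^ (-σ))).symm

end Beurling
end
end HFull

open Filter Topology MeasureTheory
open scoped BigOperators ContDiff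

namespace HFull

set_option linter.unusedSectionVars false

noncomputable section
section Beurling
open scoped Classical
variable {P : Type*} (q : P → ℝ)

/-- counting function of generalised integers -/
def Icn (y : ℝ) : ℝ := ({f : P →₀ ℕ | NR q f ≤ y}.ncard : ℝ)

variable {q}

theorem card_le_Icn (hfin : ∀ y, {f : P →₀ ℕ | NR q f ≤ y}.Finite) (G : Finset (P →₀ ℕ)) (t : ℝ)
    (hG : ∀ f ∈ G, NR q f ≤ t) : (G.card : ℝ) ≤ Icn q t := by
  rw [Icn, ← Set.ncard_coe_finset G]
  exact_mod_cast Set.ncard_le_ncard (fun f hf => hG f hf) (hfin t)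

theorem primes_summable (hq : ∀ p, 1 < q p) (hfin : ∀ y, {f : P →₀ ℕ | NR q f ≤ y}.Finite)
    {A : ℝ} (hA : 0 ≤ A) (hI : ∀ y, 1 ≤ y → Icn q y ≤ A * y) (s : ℝ) (hs : 1 < s) :
    Summable fun p => q p ^ (-s) := by
  have hc : CountLe q A 1 := by
    intro t ht F hF
    have h1 := card_le_Icn hfin (F.map ⟨fun p => Finsupp.single p 1, Finsupp.single_left_injective one_ne_zero⟩) t (by
      intro f hf
      obtain ⟨p, hp, rfl⟩ := Finset.mem_map.1 hf
      simpa [NR_single] using hF p hp)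
    rw [Finset.card_map] at h1
    rw [Real.rpow_one]
    exact h1.trans (hI t ht)
  obtain ⟨C', hC', h⟩ := dy_above hA hc (by linarith) hs
  refine summable_of_sum_le (fun p => Real.rpow_nonneg (by linarith [hq p]) _) (c := C' * 1 ^ (1 - s)) fun u => ?_
  exact h 1 le_rfl u (fun p _ => (hq p).le)

theorem countLe_BS (hq : ∀ p, 1 < q p) (hfin : ∀ y, {f : P →₀ ℕ | NR q f ≤ y}.Finite)
    {A : ℝ} (hA : 0 ≤ A) (hI : ∀ y, 1 ≤ y → Icn q y ≤ A * y) (h : ℕ) (hh : 2 ≤ h) :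
    ∃ C, 0 ≤ C ∧ CountLe (fun b : BS P (Finset.Icc (h + 1) (2 * h - 1)) => NR q b.1) C (1 / ((h : ℝ) + 1)) := by
  have hpos : (0 : ℝ) < (h : ℝ) + 1 := by positivity
  set S2 := Finset.Icc (h + 2) (2 * h - 1) with hS2
  set σ : ℝ := 1 / ((h : ℝ) + 1) with hσ
  have hσ0 : 0 < σ := by positivity
  obtain ⟨hsum, -⟩ := euler hq S2 (by simp [hS2]) σ (by
    intro j hj
    refine primes_summable hq hfin hA hI _ ?_
    rw [hS2, Finset.mem_Icc] at hj
    have : (h : ℝ) + 2 ≤ j := by exact_mod_cast hj.1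
    rw [hσ, mul_one_div, one_lt_div hpos]; linarith)
  set Z := ∑' f : BS P S2, NR q f.1 ^ (-σ) with hZ
  have hZ0 : 0 ≤ Z := tsum_nonneg fun f => Real.rpow_nonneg (NR_pos hq _).le _
  refine ⟨A * Z, mul_nonneg hA hZ0, ?_⟩
  intro t ht F hF
  let cf : (P →₀ ℕ) → (P →₀ ℕ) := fun b => b.mapRange (fun e => if e = h + 1 then 0 else e) (by simp)
  let af : (P →₀ ℕ) → (P →₀ ℕ) := fun b => b.mapRange (fun e => if e = h + 1 then 1 else 0) (by simp)
  have dec : ∀ b, (h + 1) • af b + cf b = b := by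
    intro b; ext p
    simp only [af, cf, Finsupp.add_apply, Finsupp.smul_apply, Finsupp.mapRange_apply, smul_eq_mul]
    split_ifs with h1
    · rw [h1]; simp
    · simp
  have cmem : ∀ b : BS P (Finset.Icc (h + 1) (2 * h - 1)), cf b.1 ∈ BS P S2 := by
    intro b p
    have := b.2 p
    simp only [cf, Finsupp.mapRange_apply, hS2, Finset.mem_Icc] at this ⊢
    split_ifs <;> omega
  let g : BS P (Finset.Icc (h + 1) (2 * h - 1)) → BS P S2 := fun b => ⟨cf b.1, cmem b⟩
  rw [Finset.card_eq_sum_card_fiberwise (f := g) (t := F.image g) (fun b hb => Finset.mem_image_of_mem g hb)]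
  push_cast
  have fib : ∀ c ∈ F.image g, (({b ∈ F | g b = c}.card : ℕ) : ℝ) ≤ A * t ^ σ * NR q c.1 ^ (-σ) := by
    intro c hc
    have e0 : ∀ b ∈ F, g b = c → NR q (af b.1) ^ (h + 1) * NR q c.1 ≤ t := by
      intro b hb hbc
      have := hF b hb
      rw [← hbc, ← NR_smul, ← NR_add]
      simp only [g]
      rw [dec]; exact this
    have hcp := NR_pos hq c.1
    have hct : NR q c.1 ≤ t := by
      obtain ⟨b, hb, hbc⟩ := Finset.mem_image.1 hc
      refine le_trans ?_ (e0 b hb hbc)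
      exact le_mul_of_one_le_left hcp.le (one_le_pow₀ (one_le_NR hq _))
    have hinj : Set.InjOn (fun b : BS P (Finset.Icc (h + 1) (2 * h - 1)) => af b.1) ({b ∈ F | g b = c} : Finset _) := by
      intro b hb b' hb' hbb
      simp only [Finset.coe_filter, Set.mem_ofPred_eq] at hb hb'
      ext1
      rw [← dec b.1, ← dec b'.1]
      have h1 : cf b.1 = cf b'.1 := congrArg Subtype.val (hb.2.trans hb'.2.symm)
      have h2 : af b.1 = af b'.1 := hbb
      rw [h1, h2]
    have h1 := card_le_Icn hfin (({b ∈ F | g b = c} : Finset _).image (fun b => af b.1)) ((t / NR q c.1) ^ σ) (by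
      intro f hf
      obtain ⟨b, hb, rfl⟩ := Finset.mem_image.1 hf
      rw [Finset.mem_filter] at hb
      have h2 := e0 b hb.1 hb.2
      have h3 : NR q (af b.1) = (NR q (af b.1) ^ (h + 1)) ^ σ := by
        rw [← Real.rpow_natCast, ← Real.rpow_mul (NR_pos hq _).le, hσ]
        push_cast
        rw [mul_one_div_cancel hpos.ne', Real.rpow_one]
      rw [h3]
      refine Real.rpow_le_rpow (pow_nonneg (NR_pos hq _).le _) ?_ hσ0.le
      rwa [le_div_iff₀ hcp])
    rw [Finset.card_image_of_injOn hinj] at h1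
    refine h1.trans ((hI _ (Real.one_le_rpow (by rwa [one_le_div hcp]) hσ0.le)).trans (le_of_eq ?_))
    rw [Real.div_rpow (by linarith) hcp.le, Real.rpow_neg hcp.le]
    ring
  refine (Finset.sum_le_sum fib).trans ?_
  rw [← Finset.mul_sum]
  have := hsum.sum_le_tsum (F.image g) (fun f _ => Real.rpow_nonneg (NR_pos hq _).le _)
  have h0 : 0 ≤ A * t ^ σ := by positivity
  nlinarith [mul_le_mul_of_nonneg_left this h0]

/-- counting function of h-full generalised integers -/
def HFset (q : P → ℝ) (h : ℕ) (x : ℝ) : Set (P →₀ ℕ) := {f | (∀ p, f p = 0 ∨ h ≤ f p) ∧ NR q f ≤ x}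

theorem HF_card (hq : ∀ p, 1 < q p) (hfin : ∀ y, {f : P →₀ ℕ | NR q f ≤ y}.Finite) (h : ℕ) (hh : 2 ≤ h)
    (x : ℝ) (hx : 1 ≤ x) (Bx : Finset (BS P (Finset.Icc (h + 1) (2 * h - 1)))) (hB : ∀ b, b ∈ Bx ↔ NR q b.1 ≤ x) :
    ((HFset q h x).ncard : ℝ) = ∑ b ∈ Bx, Icn q ((x / NR q b.1) ^ (1 / (h : ℝ))) := by
  have hpos : (0 : ℝ) < (h : ℝ) := by positivity
  let bf : (P →₀ ℕ) → (P →₀ ℕ) := fun f => f.mapRange (fun e => if e < h then 0 else if e % h = 0 then 0 else h + e % h) (by simp)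
  let af : (P →₀ ℕ) → (P →₀ ℕ) := fun f => f.mapRange (fun e => if e < h then 0 else if e % h = 0 then e / h else e / h - 1) (by simp)
  have dec : ∀ f, (∀ p, f p = 0 ∨ h ≤ f p) → h • af f + bf f = f := by
    intro f hf; ext p
    simp only [af, bf, Finsupp.add_apply, Finsupp.smul_apply, Finsupp.mapRange_apply, smul_eq_mul]
    have := hf p
    have hd := Nat.div_add_mod (f p) h
    split_ifs with h1 h2
    · omega
    · omega
    · have : 1 ≤ f p / h := (Nat.one_le_div_iff (by omega)).2 (by omega)
      obtain ⟨k, hk⟩ := Nat.exists_eq_add_of_le this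
      rw [hk] at hd ⊢
      rw [Nat.add_sub_cancel_left]
      rw [mul_add, mul_one] at hd
      omega
  have bmem : ∀ f, bf f ∈ BS P (Finset.Icc (h + 1) (2 * h - 1)) := by
    intro f p
    simp only [bf, Finsupp.mapRange_apply, Finset.mem_Icc]
    have := Nat.mod_lt (f p) (show 0 < h by omega)
    split_ifs <;> omega
  let g : (P →₀ ℕ) → BS P (Finset.Icc (h + 1) (2 * h - 1)) := fun b => ⟨bf b, bmem b⟩
  have HFfin : (HFset q h x).Finite := (hfin x).subset fun f hf => hf.2
  have key : ∀ (a : P →₀ ℕ) (b : BS P (Finset.Icc (h + 1) (2 * h - 1))), g (h • a + b.1) = b ∧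
      ∀ p, (h • a + b.1) p = 0 ∨ h ≤ (h • a + b.1) p := by
    intro a b
    have hk : ∀ p, h * a p + b.1 p = 0 ∨ h ≤ h * a p + b.1 p := by
      intro p
      have := b.2 p
      rw [Finset.mem_Icc] at this
      rcases Nat.eq_zero_or_pos (a p) with h0 | h0
      · rw [h0]; omega
      · right
        have := Nat.le_mul_of_pos_right h h0
        omega
    refine ⟨?_, fun p => by simpa using hk p⟩
    ext p
    simp only [g, bf, Finsupp.mapRange_apply, Finsupp.add_apply, Finsupp.smul_apply, smul_eq_mul]
    have h1 := b.2 p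
    rw [Finset.mem_Icc] at h1
    have h2 := hk p
    have hm : (h * a p + b.1 p) % h = b.1 p % h := Nat.mul_add_mod _ _ _
    have h3 : b.1 p = 0 ∧ b.1 p % h = 0 ∨ b.1 p % h = b.1 p - h := by
      rcases h1 with h1 | h1
      · left; simp [h1]
      · right
        rw [Nat.mod_eq_sub_mod (by omega), Nat.mod_eq_of_lt (by omega)]
    have gen : ∀ e : ℕ, e = h * a p + b.1 p → (if e < h then 0 else if e % h = 0 then 0 else h + e % h) = b.1 p := by
      intro e he
      rw [← he] at h2 hm
      have hab := Nat.zero_le (h * a p)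
      split_ifs with h4 h5 <;> omega
    exact gen _ (by simp)
  rw [Set.ncard_eq_toFinset_card _ HFfin, Finset.card_eq_sum_card_fiberwise (f := g) (t := Bx)]
  · push_cast
    refine Finset.sum_congr rfl fun b hb => ?_
    have hbp := NR_pos hq b.1
    rw [Icn]
    congr 1
    rw [← Set.ncard_coe_finset]
    have hinj : Function.Injective (fun a : P →₀ ℕ => h • a + b.1) := by
      intro a a' haa
      have haa' : h • a = h • a' := add_right_cancel haa
      ext p
      have := DFunLike.congr_fun haa' p
      simp only [Finsupp.smul_apply, smul_eq_mul] at this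
      exact Nat.eq_of_mul_eq_mul_left (by omega) this
    refine Eq.trans ?_ (Set.ncard_image_of_injective _ hinj)
    congr 1
    have hiff : ∀ a : P →₀ ℕ, NR q a ≤ (x / NR q b.1) ^ (1 / (h : ℝ)) ↔ NR q (h • a + b.1) ≤ x := by
      intro a
      have ha := NR_pos hq a
      rw [NR_add, NR_smul, ← le_div_iff₀ hbp, one_div, Real.le_rpow_inv_iff_of_pos ha.le (by positivity) hpos, Real.rpow_natCast]
    ext f
    simp only [Finset.coe_filter, Set.mem_ofPred_eq, Set.Finite.mem_toFinset, Set.mem_image]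
    constructor
    · rintro ⟨⟨h1, h2⟩, h3⟩
      have h4 := dec f h1
      have h5 : bf f = b.1 := congrArg Subtype.val h3
      rw [h5] at h4
      refine ⟨af f, ?_, h4⟩
      rw [hiff, h4]; exact h2
    · rintro ⟨a, ha, rfl⟩
      rw [hiff] at ha
      exact ⟨⟨(key a b).2, ha⟩, (key a b).1⟩
  · intro f hf
    simp only [Set.Finite.coe_toFinset] at hf
    simp only [Finset.mem_coe, hB]
    have h4 := dec f hf.1
    refine le_trans ?_ hf.2
    conv_rhs => rw [← h4, NR_add]
    exact le_mul_of_one_le_left (NR_pos hq _).le (one_le_NR hq _)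

end Beurling
end
end HFull

open Filter Topology MeasureTheory
open scoped BigOperators ContDiff

namespace HFull

set_option linter.unusedSectionVars false

noncomputable section
section Beurling
open scoped Classical
variable {P : Type*} {q : P → ℝ}

theorem Icn_linear {κ A θ : ℝ} (hA : 0 ≤ A) (hθ1 : θ < 1)
    (hL : ∀ x, 1 ≤ x → |Icn q x - κ * x| ≤ A * x ^ θ) : ∀ y, 1 ≤ y → Icn q y ≤ (|κ| + A) * y := by
  intro y hy
  have h1 := (abs_le.1 (hL y hy)).2
  have h2 : y ^ θ ≤ y := by
    conv_rhs => rw [← Real.rpow_one y]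
    exact Real.rpow_le_rpow_of_exponent_le hy hθ1.le
  have h3 := le_abs_self κ
  nlinarith

theorem abstract_prod (hq : ∀ p, 1 < q p) (hfin : ∀ y, {f : P →₀ ℕ | NR q f ≤ y}.Finite)
    {κ A θ : ℝ} (hA : 0 ≤ A) (hθ1 : θ < 1) (hL : ∀ x, 1 ≤ x → |Icn q x - κ * x| ≤ A * x ^ θ)
    (h : ℕ) (hh : 2 ≤ h) :
    Summable (fun b : BS P (Finset.Icc (h + 1) (2 * h - 1)) => NR q b.1 ^ (-(1 / (h : ℝ)))) ∧
    HasProd (fun p => 1 + ∑ j ∈ Finset.Icc (h + 1) (2 * h - 1), q p ^ (-((j : ℝ) * (1 / (h : ℝ)))))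
      (∑' b : BS P (Finset.Icc (h + 1) (2 * h - 1)), NR q b.1 ^ (-(1 / (h : ℝ)))) := by
  have hpos : (0 : ℝ) < (h : ℝ) := by positivity
  refine euler hq _ (by simp) _ fun j hj => ?_
  refine primes_summable hq hfin (by positivity) (Icn_linear hA hθ1 hL) _ ?_
  rw [Finset.mem_Icc] at hj
  have : (h : ℝ) + 1 ≤ j := by exact_mod_cast hj.1
  rw [mul_one_div, one_lt_div hpos]; linarith

theorem abstract_main (hq : ∀ p, 1 < q p) (hfin : ∀ y, {f : P →₀ ℕ | NR q f ≤ y}.Finite)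
    {κ A θ : ℝ} (hA : 0 ≤ A) (hθ1 : θ < 1) (hL : ∀ x, 1 ≤ x → |Icn q x - κ * x| ≤ A * x ^ θ)
    (h : ℕ) (hh : 2 ≤ h) {γ : ℝ} (hγ : γ = ∑' b : BS P (Finset.Icc (h + 1) (2 * h - 1)), NR q b.1 ^ (-(1 / (h : ℝ)))) :
    ∃ C, 0 ≤ C ∧ ∀ x, 1 ≤ x → ∃ Bx : Finset (BS P (Finset.Icc (h + 1) (2 * h - 1))), (∀ b ∈ Bx, NR q b.1 ≤ x) ∧
      |((HFset q h x).ncard : ℝ) - κ * γ * x ^ (1 / (h : ℝ))| ≤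
        C * (x ^ (θ / h) * ∑ b ∈ Bx, NR q b.1 ^ (-(θ / h)) + x ^ (1 / ((h : ℝ) + 1))) := by
  have hpos : (0 : ℝ) < (h : ℝ) := by positivity
  obtain ⟨hsum, -⟩ := abstract_prod hq hfin hA hθ1 hL h hh
  obtain ⟨C0, hC0, hc⟩ := countLe_BS hq hfin (by positivity) (Icn_linear hA hθ1 hL) h hh
  obtain ⟨C1, hC1, hd⟩ := dy_above (s := 1 / (h : ℝ)) hC0 hc (by positivity) (one_div_lt_one_div_of_lt hpos (by linarith))
  refine ⟨A + |κ| * C1, by positivity, fun x hx => ?_⟩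
  have hx0 : 0 < x := by linarith
  have hBf : {b : BS P (Finset.Icc (h + 1) (2 * h - 1)) | NR q b.1 ≤ x}.Finite :=
    (hfin x).preimage (f := Subtype.val) Subtype.val_injective.injOn
  set Bx := hBf.toFinset with hBx
  have hB : ∀ b, b ∈ Bx ↔ NR q b.1 ≤ x := fun b => by simp [hBx]
  refine ⟨Bx, fun b hb => (hB b).1 hb, ?_⟩
  rw [HF_card hq hfin h hh x hx Bx hB]
  have hnn : ∀ b : BS P (Finset.Icc (h + 1) (2 * h - 1)), 0 ≤ NR q b.1 ^ (-(1 / (h : ℝ))) := fun b => Real.rpow_nonneg (NR_pos hq _).le _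
  -- tail
  have t1 : ∑ b ∈ Bx, NR q b.1 ^ (-(1 / (h : ℝ))) ≤ γ := hγ ▸ hsum.sum_le_tsum _ (fun b _ => hnn b)
  have t2 : γ ≤ ∑ b ∈ Bx, NR q b.1 ^ (-(1 / (h : ℝ))) + C1 * x ^ (1 / ((h : ℝ) + 1) - 1 / h) := by
    rw [hγ]
    refine Real.tsum_le_of_sum_le hnn fun u => ?_
    rw [← Finset.sum_filter_add_sum_filter_not u (fun b => NR q b.1 ≤ x)]
    refine add_le_add (Finset.sum_le_sum_of_subset_of_nonneg (fun b hb => ?_) (fun b _ _ => hnn b)) ?_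
    · rw [hB]; exact (Finset.mem_filter.1 hb).2
    · refine hd x hx _ fun b hb => ?_
      exact (not_le.1 (Finset.mem_filter.1 hb).2).le
  have main : |∑ b ∈ Bx, Icn q ((x / NR q b.1) ^ (1 / (h : ℝ))) - κ * x ^ (1 / (h : ℝ)) * ∑ b ∈ Bx, NR q b.1 ^ (-(1 / (h : ℝ)))|
      ≤ A * (x ^ (θ / h) * ∑ b ∈ Bx, NR q b.1 ^ (-(θ / h))) := by
    rw [Finset.mul_sum, ← Finset.sum_sub_distrib, Finset.mul_sum, Finset.mul_sum]
    refine (Finset.abs_sum_le_sum_abs _ _).trans (Finset.sum_le_sum fun b hb => ?_)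
    have hb' := (hB b).1 hb
    have hbp := NR_pos hq b.1
    have h1 := hL ((x / NR q b.1) ^ (1 / (h : ℝ))) (Real.one_le_rpow (by rwa [one_le_div hbp]) (by positivity))
    have e1 : (x / NR q b.1) ^ (1 / (h : ℝ)) = x ^ (1 / (h : ℝ)) * NR q b.1 ^ (-(1 / (h : ℝ))) := by
      rw [Real.div_rpow hx0.le hbp.le, Real.rpow_neg hbp.le]; rfl
    have e2 : ((x / NR q b.1) ^ (1 / (h : ℝ))) ^ θ = x ^ (θ / h) * NR q b.1 ^ (-(θ / h)) := by
      rw [← Real.rpow_mul (by positivity), one_div_mul_eq_div, Real.div_rpow hx0.le hbp.le, Real.rpow_neg hbp.le]; rfl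
    rw [e2] at h1
    nth_rewrite 2 [e1] at h1
    rw [← mul_assoc] at h1
    exact h1
  have e3 : x ^ (1 / (h : ℝ)) * x ^ (1 / ((h : ℝ) + 1) - 1 / h) = x ^ (1 / ((h : ℝ) + 1)) := by
    rw [← Real.rpow_add hx0]; congr 1; ring
  have tail : |κ * x ^ (1 / (h : ℝ)) * ∑ b ∈ Bx, NR q b.1 ^ (-(1 / (h : ℝ))) - κ * γ * x ^ (1 / (h : ℝ))|
      ≤ |κ| * C1 * x ^ (1 / ((h : ℝ) + 1)) := by
    have e4 : κ * x ^ (1 / (h : ℝ)) * ∑ b ∈ Bx, NR q b.1 ^ (-(1 / (h : ℝ))) - κ * γ * x ^ (1 / (h : ℝ))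
      = κ * (x ^ (1 / (h : ℝ)) * (∑ b ∈ Bx, NR q b.1 ^ (-(1 / (h : ℝ))) - γ)) := by ring
    rw [e4, abs_mul, abs_mul, abs_of_nonneg (Real.rpow_nonneg hx0.le _), mul_assoc, ← e3]
    refine mul_le_mul_of_nonneg_left ?_ (abs_nonneg _)
    rw [mul_left_comm]
    refine mul_le_mul_of_nonneg_left ?_ (Real.rpow_nonneg hx0.le _)
    rw [abs_sub_comm, abs_of_nonneg (by linarith)]
    linarith
  have := (abs_sub_le _ _ _).trans (add_le_add main tail)
  refine this.trans ?_
  have p1 : 0 ≤ x ^ (θ / h) * ∑ b ∈ Bx, NR q b.1 ^ (-(θ / h)) :=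
    mul_nonneg (Real.rpow_nonneg hx0.le _) (Finset.sum_nonneg fun b _ => Real.rpow_nonneg (NR_pos hq _).le _)
  have p2 : 0 ≤ x ^ (1 / ((h : ℝ) + 1)) := Real.rpow_nonneg hx0.le _
  have p3 : 0 ≤ |κ| * C1 := by positivity
  nlinarith [mul_nonneg p3 p1, mul_nonneg hA p2]

theorem abstract_cases (hq : ∀ p, 1 < q p) (hfin : ∀ y, {f : P →₀ ℕ | NR q f ≤ y}.Finite)
    {κ A θ : ℝ} (hA : 0 ≤ A) (hθ0 : 0 < θ) (hθ1 : θ < 1) (hL : ∀ x, 1 ≤ x → |Icn q x - κ * x| ≤ A * x ^ θ)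
    (h : ℕ) (hh : 2 ≤ h) {γ : ℝ} (hγ : γ = ∑' b : BS P (Finset.Icc (h + 1) (2 * h - 1)), NR q b.1 ^ (-(1 / (h : ℝ)))) :
    ∃ C, 0 ≤ C ∧ ∀ x, 1 ≤ x → 
      |((HFset q h x).ncard : ℝ) - κ * γ * x ^ (1 / (h : ℝ))| ≤
        C * (if 1 / ((h : ℝ) + 1) < θ / h then x ^ (θ / h) else if 1 / ((h : ℝ) + 1) = θ / h then
          x ^ (1 / ((h : ℝ) + 1)) * (1 + Real.log x) else x ^ (1 / ((h : ℝ) + 1))) := by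
  have hpos : (0 : ℝ) < (h : ℝ) := by positivity
  obtain ⟨C, hC, hm⟩ := abstract_main hq hfin hA hθ1 hL h hh hγ
  obtain ⟨C0, hC0, hc⟩ := countLe_BS hq hfin (by positivity) (Icn_linear hA hθ1 hL) h hh
  split_ifs with h1 h2
  · obtain ⟨D, hD, hd⟩ := dy_above hC0 hc (by positivity) h1
    refine ⟨C * (D + 1), by positivity, fun x hx => ?_⟩
    obtain ⟨Bx, hB, hb⟩ := hm x hx
    refine hb.trans ?_
    rw [mul_assoc]
    refine mul_le_mul_of_nonneg_left ?_ hC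
    have h3 := hd 1 le_rfl Bx (fun b _ => one_le_NR hq _)
    rw [Real.one_rpow, mul_one] at h3
    have h4 : x ^ (1 / ((h : ℝ) + 1)) ≤ x ^ (θ / h) := Real.rpow_le_rpow_of_exponent_le hx h1.le
    have h5 : 0 ≤ x ^ (θ / h) := Real.rpow_nonneg (by linarith) _
    nlinarith [mul_le_mul_of_nonneg_left h3 h5]
  · obtain ⟨D, hD, hd⟩ := dy_eq (fun b => one_le_NR hq _) hC0 hc (by positivity)
    refine ⟨C * (D + 1), by positivity, fun x hx => ?_⟩
    obtain ⟨Bx, hB, hb⟩ := hm x hx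
    refine hb.trans ?_
    rw [mul_assoc]
    refine mul_le_mul_of_nonneg_left ?_ hC
    have h3 := hd x hx Bx hB
    rw [← h2]
    have h5 : 0 ≤ x ^ (1 / ((h : ℝ) + 1)) := Real.rpow_nonneg (by linarith) _
    have h6 := Real.log_nonneg hx
    nlinarith [mul_le_mul_of_nonneg_left h3 h5, mul_nonneg h5 h6]
  · have h1' : θ / h < 1 / ((h : ℝ) + 1) := lt_of_le_of_ne (not_lt.1 h1) (Ne.symm h2)
    obtain ⟨D, hD, hd⟩ := dy_below (fun b => one_le_NR hq _) hC0 hc (by positivity) h1'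
    refine ⟨C * (D + 1), by positivity, fun x hx => ?_⟩
    obtain ⟨Bx, hB, hb⟩ := hm x hx
    refine hb.trans ?_
    rw [mul_assoc]
    refine mul_le_mul_of_nonneg_left ?_ hC
    have h3 := hd x hx Bx hB
    have h5 : 0 ≤ x ^ (θ / h) := Real.rpow_nonneg (by linarith) _
    have e3 : x ^ (θ / h) * x ^ (1 / ((h : ℝ) + 1) - θ / h) = x ^ (1 / ((h : ℝ) + 1)) := by
      rw [← Real.rpow_add (by linarith)]; congr 1; ring
    have h6 := mul_le_mul_of_nonneg_left h3 h5
    rw [mul_left_comm, e3] at h6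
    linarith

theorem factor_eq (Q : ℝ) (hQ : 1 < Q) (h : ℕ) (hh : 2 ≤ h) :
    1 + ∑ j ∈ Finset.Icc (h + 1) (2 * h - 1), Q ^ (-((j : ℝ) * (1 / (h : ℝ)))) =
    1 + (Q - Q ^ ((1 : ℝ) / h)) / (Q ^ 2 * (Q ^ ((1 : ℝ) / h) - 1)) := by
  have hpos : (0 : ℝ) < (h : ℝ) := by positivity
  set t := Q ^ ((1 : ℝ) / h) with ht
  have ht1 : 1 < t := Real.one_lt_rpow hQ (by positivity)
  have ht0 : 0 < t := by linarith
  have hQt : Q = t ^ h := by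
    rw [ht, ← Real.rpow_natCast, ← Real.rpow_mul (by linarith), one_div_mul_cancel hpos.ne', Real.rpow_one]
  congr 1
  have e1 : ∀ j : ℕ, Q ^ (-((j : ℝ) * (1 / (h : ℝ)))) = (t⁻¹) ^ j := by
    intro j
    rw [Real.rpow_neg (by linarith), mul_comm, Real.rpow_mul (by linarith), Real.rpow_natCast, inv_pow]
  simp_rw [e1]
  obtain ⟨m, rfl⟩ : ∃ m, h = m + 2 := ⟨h - 2, by omega⟩
  have e2 : Finset.Icc (m + 2 + 1) (2 * (m + 2) - 1) = Finset.Ico (m + 3) (2 * m + 4) := by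
    ext j; simp only [Finset.mem_Icc, Finset.mem_Ico]; omega
  have hne : t - 1 ≠ 0 := by linarith
  have hne2 : t⁻¹ ≠ 1 := by
    intro h; rw [inv_eq_one] at h; linarith
  rw [e2, geom_sum_Ico hne2 (by omega), hQt]
  have hne3 : t⁻¹ - 1 ≠ 0 := sub_ne_zero.2 hne2
  have hne4 : 1 - t ≠ 0 := by intro h; apply hne; linarith
  rw [div_eq_div_iff hne3 (by positivity)]
  simp only [inv_pow]
  have e3 : t ^ (2 * m + 4) = t ^ (m + 2) * t ^ (m + 2) := by ring
  have e4 : t ^ (m + 3) = t ^ (m + 2) * t := by ring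
  rw [e3, e4]
  have : t ^ (m + 2) ≠ 0 := by positivity
  field_simp
  ring

end Beurling
end
end HFull

open Filter Topology MeasureTheory
open scoped BigOperators ContDiff

namespace HFull

set_option linter.unusedSectionVars false
set_option linter.style.haveILetI false

noncomputable section
section Concrete
open NumberField NumberField.InfinitePlace NumberField.mixedEmbedding Module
open scoped Classical
open NumberField.Units NumberField.Units.dirichletUnitTheorem NumberField.mixedEmbedding.fundamentalCone
variable (K : Type) [Field K] [NumberField K]
variable {ι : Type*} [Fintype ι]

/-- nonzero primes -/
abbrev PK : Type := {p : Ideal (𝓞 K) // p.IsPrime ∧ p ≠ ⊥}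

/-- ideal from exponents -/
def EI (f : PK K →₀ ℕ) : Ideal (𝓞 K) := f.prod fun p k => p.1 ^ k

/-- norms of the primes -/
def qK (p : PK K) : ℝ := (Ideal.absNorm p.1 : ℝ)

theorem one_lt_qK (p : PK K) : 1 < qK K p := by
  have h0 : Ideal.absNorm p.1 ≠ 0 := by
    rw [Ne, Ideal.absNorm_eq_zero_iff]; exact p.2.2
  have h1 : Ideal.absNorm p.1 ≠ 1 := by
    rw [Ne, Ideal.absNorm_eq_one_iff]; exact p.2.1.ne_top
  have : 1 < Ideal.absNorm p.1 := by omega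
  unfold qK
  exact_mod_cast this

theorem EI_add (f g : PK K →₀ ℕ) : EI K (f + g) = EI K f * EI K g :=
  Finsupp.prod_add_index' (fun _ => pow_zero _) (fun _ _ _ => pow_add _ _ _)

theorem EI_single (p : PK K) (k : ℕ) : EI K (Finsupp.single p k) = p.1 ^ k := by
  simp [EI]

theorem NR_EI (f : PK K →₀ ℕ) : NR (qK K) f = (Ideal.absNorm (EI K f) : ℝ) := by
  simp only [NR, EI, Finsupp.prod, map_prod, map_pow, Nat.cast_prod, Nat.cast_pow, qK]

theorem EI_ne_zero (f : PK K →₀ ℕ) : EI K f ≠ 0 :=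
  Finset.prod_ne_zero_iff.2 fun p _ => pow_ne_zero _ p.2.2

theorem EI_multiset (f : PK K →₀ ℕ) : EI K f = ((Finsupp.toMultiset f).map Subtype.val).prod := by
  rw [EI, Finsupp.toMultiset_map, Finsupp.prod_toMultiset, Finsupp.prod_mapDomain_index (fun _ => pow_zero _) (fun _ _ _ => pow_add _ _ _)]

theorem EI_injective : Function.Injective (EI K) := by
  intro f g hfg
  rw [EI_multiset, EI_multiset] at hfg
  have key : ∀ f : PK K →₀ ℕ, UniqueFactorizationMonoid.normalizedFactors ((Finsupp.toMultiset f).map Subtype.val).prod = (Finsupp.toMultiset f).map Subtype.val := by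
    intro f
    refine UniqueFactorizationMonoid.normalizedFactors_prod_of_prime fun p hp => ?_
    obtain ⟨p', _, rfl⟩ := Multiset.mem_map.1 hp
    haveI := p'.2.1
    exact Ideal.prime_of_isPrime p'.2.2 p'.2.1
  have h2 : (Finsupp.toMultiset f).map Subtype.val = (Finsupp.toMultiset g).map Subtype.val := by
    rw [← key f, ← key g, hfg]
  exact Multiset.toFinsupp.symm.injective (Multiset.map_injective Subtype.val_injective h2)

theorem EI_surj (I : Ideal (𝓞 K)) (hI : I ≠ 0) : ∃ f, EI K f = I := by
  have h1 := UniqueFactorizationMonoid.prod_normalizedFactors_eq hI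
  rw [normalize_eq] at h1
  have h2 : ∀ p ∈ UniqueFactorizationMonoid.normalizedFactors I, p.IsPrime ∧ p ≠ ⊥ := by
    intro p hp
    have := UniqueFactorizationMonoid.prime_of_normalized_factor p hp
    exact ⟨Ideal.isPrime_of_prime this, this.ne_zero⟩
  obtain ⟨m, hm⟩ : ∃ m : Multiset (PK K), m.map Subtype.val = UniqueFactorizationMonoid.normalizedFactors I :=
    ⟨Multiset.pmap (fun p hp => (⟨p, hp⟩ : PK K)) _ h2, by rw [Multiset.map_pmap]; exact (Multiset.pmap_eq_map _ (fun a => a) _ h2).trans (Multiset.map_id' _)⟩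
  refine ⟨Multiset.toFinsupp m, ?_⟩
  rw [EI_multiset, Multiset.toFinsupp_toMultiset, hm, h1]

theorem pow_dvd_EI (p : PK K) (k : ℕ) (f : PK K →₀ ℕ) : p.1 ^ k ∣ EI K f ↔ k ≤ f p := by
  constructor
  · rintro ⟨J, hJ⟩
    have hJ0 : J ≠ 0 := by
      rintro rfl; rw [mul_zero] at hJ; exact EI_ne_zero K f hJ
    obtain ⟨g, rfl⟩ := EI_surj K J hJ0
    rw [← EI_single, ← EI_add] at hJ
    rw [EI_injective K hJ]
    simp
  · intro hk
    have : Finsupp.single p k + (f - Finsupp.single p k) = f :=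
      add_tsub_cancel_of_le (Finsupp.single_le_iff.2 hk)
    rw [← this, EI_add, EI_single]
    exact dvd_mul_right _ _

theorem isHFull_EI (h : ℕ) (f : PK K →₀ ℕ) : IsHFull K h (EI K f) ↔ ∀ p, f p = 0 ∨ h ≤ f p := by
  constructor
  · rintro ⟨-, h2⟩ p
    rw [or_iff_not_imp_left]
    intro h3
    rw [← pow_dvd_EI]
    refine h2 p.1 p.2.1 ?_
    rw [← pow_one p.1, pow_dvd_EI]; omega
  · intro h2
    refine ⟨EI_ne_zero K f, fun p hp hd => ?_⟩
    have hp0 : p ≠ ⊥ := by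
      rintro rfl
      exact EI_ne_zero K f (zero_dvd_iff.1 hd)
    have h3 := (pow_dvd_EI K ⟨p, hp, hp0⟩ 1 f).1 (by simpa using hd)
    exact (pow_dvd_EI K ⟨p, hp, hp0⟩ h f).2 ((h2 _).resolve_left (by omega))

theorem hfinK (y : ℝ) : {f : PK K →₀ ℕ | NR (qK K) f ≤ y}.Finite := by
  have h1 := (Ideal.finite_setOfPred_absNorm_le (S := 𝓞 K) ⌊y⌋₊).preimage (f := EI K) (EI_injective K).injOn
  refine h1.subset fun f hf => ?_
  simp only [Set.mem_ofPred_eq, NR_EI, Set.mem_preimage] at hf ⊢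
  exact Nat.le_floor hf

theorem Icn_eq (y : ℝ) : Icn (qK K) y = Ic K y := by
  rw [Icn, Ic]
  congr 1
  refine Nat.card_congr (Equiv.ofBijective (fun f => ⟨⟨EI K f.1, mem_nonZeroDivisors_iff_ne_zero.2 (EI_ne_zero K _)⟩, ?_⟩) ⟨?_, ?_⟩)
  · have := f.2
    rw [Set.mem_ofPred_eq, NR_EI] at this
    exact this
  · intro f g hfg
    simp only [Subtype.mk.injEq] at hfg
    exact Subtype.ext (EI_injective K hfg)
  · rintro ⟨⟨I, hI⟩, hI2⟩
    obtain ⟨f, rfl⟩ := EI_surj K I (mem_nonZeroDivisors_iff_ne_zero.1 hI)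
    refine ⟨⟨f, ?_⟩, rfl⟩
    rw [Set.mem_ofPred_eq, NR_EI]
    exact hI2

theorem HF_eq (h : ℕ) (x : ℝ) : Nat.card {m : Ideal (𝓞 K) // IsHFull K h m ∧ (Ideal.absNorm m : ℝ) ≤ x} = (HFset (qK K) h x).ncard := by
  symm
  refine Nat.card_congr (Equiv.ofBijective (fun f => ⟨EI K f.1, ?_⟩) ⟨?_, ?_⟩)
  · have : (∀ p, f.1 p = 0 ∨ h ≤ f.1 p) ∧ NR (qK K) f.1 ≤ x := f.2
    rw [NR_EI] at this
    exact ⟨(isHFull_EI K h f.1).2 this.1, this.2⟩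
  · intro f g hfg
    simp only [Subtype.mk.injEq] at hfg
    exact Subtype.ext (EI_injective K hfg)
  · rintro ⟨I, hI, hI2⟩
    obtain ⟨f, rfl⟩ := EI_surj K I hI.1
    refine ⟨⟨f, ?_⟩, rfl⟩
    change (∀ p, f p = 0 ∨ h ≤ f p) ∧ NR (qK K) f ≤ x
    rw [NR_EI]
    exact ⟨(isHFull_EI K h f).1 hI, hI2⟩

theorem final (h : ℕ) (hh : 2 ≤ h) :
    Multipliable
      (fun p : {p : Ideal (NumberField.RingOfIntegers K) // p.IsPrime ∧ p ≠ ⊥} =>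
        gammaHFactor K h p.1) ∧
    (fun x : ℝ =>
        (Nat.card {m : Ideal (NumberField.RingOfIntegers K) //
            IsHFull K h m ∧ (Ideal.absNorm m : ℝ) ≤ x} : ℝ) -
          kappa K * gammaH K h * x ^ ((1 : ℝ)/h))
      =O[atTop] fun x : ℝ => RNh K h x := by
  have hpos : (0 : ℝ) < (h : ℝ) := by positivity
  obtain ⟨A, hA, hL'⟩ := landau K
  set n := finrank ℚ K with hn
  have hn1 : 1 ≤ n := finrank_pos
  have hL : ∀ x, 1 ≤ x → |Icn (qK K) x - kappa K * x| ≤ A * x ^ theta n := by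
    intro x hx; rw [Icn_eq]; exact hL' x hx
  obtain ⟨-, hprod⟩ := abstract_prod (one_lt_qK K) (hfinK K) hA theta_lt hL h hh
  have hprod' : HasProd (fun p : PK K => gammaHFactor K h p.1) (∑' b : BS (PK K) (Finset.Icc (h + 1) (2 * h - 1)), NR (qK K) b.1 ^ (-(1 / (h : ℝ)))) := by
    refine hprod.congr_fun ?_
    intro p
    exact (factor_eq (qK K p) (one_lt_qK K p) h hh).symm
  refine ⟨hprod'.multipliable, ?_⟩
  obtain ⟨C, hC, hm⟩ := abstract_cases (one_lt_qK K) (hfinK K) hA (theta_pos hn1) theta_lt hL h hh (γ := gammaH K h) hprod'.tprod_eq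
  refine Asymptotics.IsBigO.of_bound (2 * C) ?_
  filter_upwards [eventually_ge_atTop (Real.exp 1)] with x hx
  have hx1 : 1 ≤ x := (Real.one_le_exp zero_le_one).trans hx
  have hlog : 1 ≤ Real.log x := by
    rw [← Real.log_exp 1]; exact Real.log_le_log (Real.exp_pos 1) hx
  have hx0 : 0 < x := by linarith
  rw [HF_eq, Real.norm_eq_abs, Real.norm_eq_abs]
  refine (hm x hx1).trans ?_
  rw [mul_comm 2 C, mul_assoc]
  refine mul_le_mul_of_nonneg_left ?_ hC
  refine le_trans ?_ (mul_le_mul_of_nonneg_left (le_abs_self _) (by norm_num))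
  have hpow : ∀ a : ℝ, 0 ≤ x ^ a := fun a => Real.rpow_nonneg hx0.le a
  -- comparison of the exponents
  have lt_iff : ∀ θ : ℝ, 1 / ((h : ℝ) + 1) < θ / h ↔ (h : ℝ) / (h + 1) < θ := by
    intro θ
    rw [lt_div_iff₀ hpos, one_div_mul_eq_div]
  have eq_iff : ∀ θ : ℝ, 1 / ((h : ℝ) + 1) = θ / h ↔ (h : ℝ) / (h + 1) = θ := by
    intro θ
    rw [eq_div_iff hpos.ne', one_div_mul_eq_div]
  rw [RNh, ← hn]
  simp only [lt_iff, eq_iff]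
  by_cases hn' : n = 1
  · have hth : theta n = 1 / 2 := by rw [theta, if_pos hn']
    have hge : (1 : ℝ) / 2 < (h : ℝ) / (h + 1) := by
      rw [div_lt_div_iff₀ (by norm_num) (by positivity)]
      have : (2 : ℝ) ≤ h := by exact_mod_cast hh
      linarith
    have e0 : 1 - 2 / ((n : ℝ) + 1) = 0 := by rw [hn']; norm_num
    rw [hth, e0, if_neg (by linarith), if_neg (by linarith), if_neg (by linarith), if_neg (by linarith)]
    linarith [hpow (1 / ((h : ℝ) + 1))]
  · have hth : theta n = 1 - 2 / ((n : ℝ) + 1) := by rw [theta, if_neg hn']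
    rw [← hth]
    split_ifs with h1 h2
    · rw [one_div_mul_eq_div]
      linarith [hpow (theta n / h)]
    · have := hpow (1 / ((h : ℝ) + 1))
      nlinarith
    · linarith [hpow (1 / ((h : ℝ) + 1))]

end Concrete
end
end HFull

/-- **Distribution of `h`-full ideals**:
`|N_h(x)| = κ γ_h x^{1/h} + O_h(R_{N_h}(x))`, where the infinite product defining `γ_h`
converges. -/
theorem count_hFull_ideals (h : ℕ) (hh : 2 ≤ h) :
    Multipliable
      (fun p : {p : Ideal (NumberField.RingOfIntegers K) // p.IsPrime ∧ p ≠ ⊥} =>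
        gammaHFactor K h p.1) ∧
    (fun x : ℝ =>
        (Nat.card {m : Ideal (NumberField.RingOfIntegers K) //
            IsHFull K h m ∧ (Ideal.absNorm m : ℝ) ≤ x} : ℝ) -
          kappa K * gammaH K h * x ^ ((1 : ℝ)/h))
      =O[atTop] fun x : ℝ => RNh K h x := by
  exact HFull.final K h hh

end
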